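/- Let h(u,v) = \sum_{i=0}^{12} \binom{12}{i} \alpha_i u^i v^{12-i} with (\alpha_0, \dots, \alpha_{12}) = (-81, -27, -27, -27, -9, 9, 171/7, 33, 63, 141, 149, -67, -1657). Define g = (1/132^2)(h_{uu} h_{vv} - h_{uv}^2) and f = (1/240)(h_u g_v - h_v g_u), where subscripts denote partial derivatives with respect to u and v; then f is a binary form of degree 30 with integer coefficients. There are no integers u, v, y with (u, v) \neq (0, 0) and y^2 = f(u, v). -/

import Mathlib

open MvPolynomial

/-- The coefficient vector `(α₀, …, α₁₂)`. -/
noncomputable def alphaC16 : Fin 13 → ℚ := ![-81, -27, -27, -27, -9, 9, 171/7, 33, 63, 141, 149, -67, -1657]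

/-- The binary form `h(u,v) = ∑ i, (12 choose i) αᵢ uⁱ v^(12-i)`,
as a polynomial in the two variables `X 0 = u` and `X 1 = v`. -/
noncomputable def hC16 : MvPolynomial (Fin 2) ℚ :=
  ∑ i : Fin 13, C ((Nat.choose 12 i : ℚ) * alphaC16 i) * X 0 ^ (i : ℕ) * X 1 ^ (12 - (i : ℕ))

/-- `g = (1/132²)·(h_uu h_vv - h_uv²)`. -/
noncomputable def gC16 : MvPolynomial (Fin 2) ℚ :=
  C ((1 : ℚ) / 132 ^ 2) *
    (pderiv 0 (pderiv 0 hC16) * pderiv 1 (pderiv 1 hC16) -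
      pderiv 1 (pderiv 0 hC16) * pderiv 1 (pderiv 0 hC16))

/-- `f = (1/240)·(h_u g_v - h_v g_u)`. -/
noncomputable def fC16 : MvPolynomial (Fin 2) ℚ :=
  C ((1 : ℚ) / 240) *
    (pderiv 0 hC16 * pderiv 1 gC16 - pderiv 1 hC16 * pderiv 0 gC16)


section
namespace C16

/-- Elements of the quintic order `A⟨1, θ, θ², θ³/3, θ⁴/3⟩` with `θ⁵ + 30θ² + 45θ + 18 = 0`. -/
@[ext] structure Q5 (A : Type) where
  c0 : A
  c1 : A
  c2 : A
  c3 : A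
  c4 : A

namespace Q5
variable {A : Type}

instance [DecidableEq A] : DecidableEq (Q5 A) := fun x y =>
  decidable_of_iff (x.c0 = y.c0 ∧ x.c1 = y.c1 ∧ x.c2 = y.c2 ∧ x.c3 = y.c3 ∧ x.c4 = y.c4)
    (by rw [Q5.ext_iff])

variable [CommRing A]

instance : Zero (Q5 A) := ⟨⟨0, 0, 0, 0, 0⟩⟩
instance : One (Q5 A) := ⟨⟨1, 0, 0, 0, 0⟩⟩
instance : Add (Q5 A) := ⟨fun x y => ⟨x.c0 + y.c0, x.c1 + y.c1, x.c2 + y.c2, x.c3 + y.c3, x.c4 + y.c4⟩⟩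
instance : Neg (Q5 A) := ⟨fun x => ⟨-x.c0, -x.c1, -x.c2, -x.c3, -x.c4⟩⟩
instance : Sub (Q5 A) := ⟨fun x y => ⟨x.c0 - y.c0, x.c1 - y.c1, x.c2 - y.c2, x.c3 - y.c3, x.c4 - y.c4⟩⟩
instance : SMul ℤ (Q5 A) := ⟨fun n x => ⟨n * x.c0, n * x.c1, n * x.c2, n * x.c3, n * x.c4⟩⟩
instance : SMul ℕ (Q5 A) := ⟨fun n x => ⟨n * x.c0, n * x.c1, n * x.c2, n * x.c3, n * x.c4⟩⟩
instance : NatCast (Q5 A) := ⟨fun n => ⟨n, 0, 0, 0, 0⟩⟩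
instance : IntCast (Q5 A) := ⟨fun n => ⟨n, 0, 0, 0, 0⟩⟩
instance : Mul (Q5 A) := ⟨fun x y =>
  ⟨x.c0 * y.c0 - 6 * (x.c1 * y.c4 + x.c4 * y.c1 + x.c2 * y.c3 + x.c3 * y.c2) + 60 * (x.c4 * y.c4),
   x.c0 * y.c1 + x.c1 * y.c0 - 15 * (x.c1 * y.c4 + x.c4 * y.c1 + x.c2 * y.c3 + x.c3 * y.c2)
     - 6 * (x.c2 * y.c4 + x.c4 * y.c2) - 2 * (x.c3 * y.c3) + 150 * (x.c4 * y.c4),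
   x.c0 * y.c2 + x.c2 * y.c0 + x.c1 * y.c1
     - 10 * (x.c1 * y.c4 + x.c4 * y.c1 + x.c2 * y.c3 + x.c3 * y.c2)
     - 15 * (x.c2 * y.c4 + x.c4 * y.c2) - 5 * (x.c3 * y.c3)
     - 2 * (x.c3 * y.c4 + x.c4 * y.c3) + 100 * (x.c4 * y.c4),
   x.c0 * y.c3 + x.c3 * y.c0 + 3 * (x.c1 * y.c2 + x.c2 * y.c1)
     - 30 * (x.c2 * y.c4 + x.c4 * y.c2) - 10 * (x.c3 * y.c3)
     - 15 * (x.c3 * y.c4 + x.c4 * y.c3) - 6 * (x.c4 * y.c4),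
   x.c0 * y.c4 + x.c4 * y.c0 + x.c1 * y.c3 + x.c3 * y.c1 + 3 * (x.c2 * y.c2)
     - 10 * (x.c3 * y.c4 + x.c4 * y.c3) - 15 * (x.c4 * y.c4)⟩⟩

lemma zero_def : (0 : Q5 A) = ⟨0, 0, 0, 0, 0⟩ := rfl
lemma qone_def : (1 : Q5 A) = ⟨1, 0, 0, 0, 0⟩ := rfl
lemma add_def (x y : Q5 A) : x + y =
  ⟨x.c0 + y.c0, x.c1 + y.c1, x.c2 + y.c2, x.c3 + y.c3, x.c4 + y.c4⟩ := rfl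
lemma neg_def (x : Q5 A) : -x = ⟨-x.c0, -x.c1, -x.c2, -x.c3, -x.c4⟩ := rfl
lemma sub_def (x y : Q5 A) : x - y =
  ⟨x.c0 - y.c0, x.c1 - y.c1, x.c2 - y.c2, x.c3 - y.c3, x.c4 - y.c4⟩ := rfl
lemma zsmul_def' (n : ℤ) (x : Q5 A) : n • x = ⟨n * x.c0, n * x.c1, n * x.c2, n * x.c3, n * x.c4⟩ := rfl
lemma nsmul_def' (n : ℕ) (x : Q5 A) : n • x = ⟨n * x.c0, n * x.c1, n * x.c2, n * x.c3, n * x.c4⟩ := rfl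
lemma natCast_def' (n : ℕ) : (n : Q5 A) = ⟨n, 0, 0, 0, 0⟩ := rfl
lemma intCast_def' (n : ℤ) : (n : Q5 A) = ⟨n, 0, 0, 0, 0⟩ := rfl
lemma qmul_def (x y : Q5 A) : x * y =
  ⟨x.c0 * y.c0 - 6 * (x.c1 * y.c4 + x.c4 * y.c1 + x.c2 * y.c3 + x.c3 * y.c2) + 60 * (x.c4 * y.c4),
   x.c0 * y.c1 + x.c1 * y.c0 - 15 * (x.c1 * y.c4 + x.c4 * y.c1 + x.c2 * y.c3 + x.c3 * y.c2)
     - 6 * (x.c2 * y.c4 + x.c4 * y.c2) - 2 * (x.c3 * y.c3) + 150 * (x.c4 * y.c4),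
   x.c0 * y.c2 + x.c2 * y.c0 + x.c1 * y.c1
     - 10 * (x.c1 * y.c4 + x.c4 * y.c1 + x.c2 * y.c3 + x.c3 * y.c2)
     - 15 * (x.c2 * y.c4 + x.c4 * y.c2) - 5 * (x.c3 * y.c3)
     - 2 * (x.c3 * y.c4 + x.c4 * y.c3) + 100 * (x.c4 * y.c4),
   x.c0 * y.c3 + x.c3 * y.c0 + 3 * (x.c1 * y.c2 + x.c2 * y.c1)
     - 30 * (x.c2 * y.c4 + x.c4 * y.c2) - 10 * (x.c3 * y.c3)
     - 15 * (x.c3 * y.c4 + x.c4 * y.c3) - 6 * (x.c4 * y.c4),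
   x.c0 * y.c4 + x.c4 * y.c0 + x.c1 * y.c3 + x.c3 * y.c1 + 3 * (x.c2 * y.c2)
     - 10 * (x.c3 * y.c4 + x.c4 * y.c3) - 15 * (x.c4 * y.c4)⟩ := rfl

instance : CommRing (Q5 A) where
  add_assoc x y z := by ext <;> simp only [add_def] <;> ring
  zero_add x := by ext <;> simp only [add_def, zero_def] <;> ring
  add_zero x := by ext <;> simp only [add_def, zero_def] <;> ring
  add_comm x y := by ext <;> simp only [add_def] <;> ring
  neg_add_cancel x := by ext <;> simp only [add_def, neg_def, zero_def] <;> ring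
  sub_eq_add_neg x y := by ext <;> simp only [add_def, neg_def, sub_def] <;> ring
  nsmul n x := n • x
  nsmul_zero x := by ext <;> simp only [nsmul_def', zero_def] <;> push_cast <;> ring
  nsmul_succ n x := by ext <;> simp only [nsmul_def', add_def] <;> push_cast <;> ring
  zsmul n x := n • x
  zsmul_zero' x := by ext <;> simp only [zsmul_def', zero_def] <;> push_cast <;> ring
  zsmul_succ' n x := by ext <;> simp only [zsmul_def', add_def] <;> push_cast <;> ring
  zsmul_neg' n x := by ext <;> simp only [zsmul_def', neg_def, Int.cast_negSucc] <;> push_cast <;> ring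
  mul_assoc x y z := by ext <;> simp only [qmul_def] <;> ring
  one_mul x := by ext <;> simp only [qmul_def, qone_def] <;> ring
  mul_one x := by ext <;> simp only [qmul_def, qone_def] <;> ring
  left_distrib x y z := by ext <;> simp only [qmul_def, add_def] <;> ring
  right_distrib x y z := by ext <;> simp only [qmul_def, add_def] <;> ring
  zero_mul x := by ext <;> simp only [qmul_def, zero_def] <;> ring
  mul_zero x := by ext <;> simp only [qmul_def, zero_def] <;> ring
  mul_comm x y := by ext <;> simp only [qmul_def] <;> ring
  natCast_zero := by ext <;> simp only [natCast_def', zero_def] <;> push_cast <;> ring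
  natCast_succ n := by ext <;> simp only [natCast_def', qone_def, add_def] <;> push_cast <;> ring
  intCast_ofNat n := by ext <;> simp only [natCast_def', intCast_def'] <;> push_cast <;> ring
  intCast_negSucc n := by
    ext <;> simp only [natCast_def', intCast_def', neg_def, Int.cast_negSucc] <;> push_cast <;> ring

lemma natCast_def (n : ℕ) : (n : Q5 A) = ⟨n, 0, 0, 0, 0⟩ := rfl
lemma intCast_def (n : ℤ) : (n : Q5 A) = ⟨n, 0, 0, 0, 0⟩ := rfl
lemma ofNat_def (n : ℕ) [n.AtLeastTwo] : (OfNat.ofNat n : Q5 A) = ⟨OfNat.ofNat n, 0, 0, 0, 0⟩ := by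
  rw [← Nat.cast_ofNat, natCast_def]; simp
lemma zsmul_def (n : ℤ) (x : Q5 A) : n • x = ⟨n * x.c0, n * x.c1, n * x.c2, n * x.c3, n * x.c4⟩ := rfl

/-- Functoriality of `Q5`. -/
def map {B : Type} [CommRing B] (φ : A →+* B) : Q5 A →+* Q5 B where
  toFun x := ⟨φ x.c0, φ x.c1, φ x.c2, φ x.c3, φ x.c4⟩
  map_one' := by simp [qone_def]
  map_zero' := by simp [zero_def]
  map_add' x y := by simp [add_def]
  map_mul' x y := by
    have e6 : φ 6 = 6 := map_ofNat φ 6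
    have e60 : φ 60 = 60 := map_ofNat φ 60
    have e15 : φ 15 = 15 := map_ofNat φ 15
    have e2 : φ 2 = 2 := map_ofNat φ 2
    have e150 : φ 150 = 150 := map_ofNat φ 150
    have e10 : φ 10 = 10 := map_ofNat φ 10
    have e5 : φ 5 = 5 := map_ofNat φ 5
    have e100 : φ 100 = 100 := map_ofNat φ 100
    have e3 : φ 3 = 3 := map_ofNat φ 3
    have e30 : φ 30 = 30 := map_ofNat φ 30
    simp only [qmul_def, map_add, map_sub, map_mul, e6, e60, e15, e2, e150, e10, e5, e100, e3, e30]

/-- The evaluation `θ ↦ r` at a root `r` of the quintic, in a ring where `3` is invertible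
(with inverse `k`). -/
def ev {B : Type} [CommRing B] (φ : A →+* B) (r k : B) (hk : 3 * k = 1)
    (hr : r ^ 5 + 30 * r ^ 2 + 45 * r + 18 = 0) : Q5 A →+* B where
  toFun x := φ x.c0 + φ x.c1 * r + φ x.c2 * r ^ 2 + φ x.c3 * (k * r ^ 3) + φ x.c4 * (k * r ^ 4)
  map_one' := by simp [qone_def]
  map_zero' := by simp [zero_def]
  map_add' x y := by simp [add_def]; ring
  map_mul' x y := by
    have e6 : φ 6 = 6 := map_ofNat φ 6
    have e60 : φ 60 = 60 := map_ofNat φ 60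
    have e15 : φ 15 = 15 := map_ofNat φ 15
    have e2 : φ 2 = 2 := map_ofNat φ 2
    have e150 : φ 150 = 150 := map_ofNat φ 150
    have e10 : φ 10 = 10 := map_ofNat φ 10
    have e5 : φ 5 = 5 := map_ofNat φ 5
    have e100 : φ 100 = 100 := map_ofNat φ 100
    have e3 : φ 3 = 3 := map_ofNat φ 3
    have e30 : φ 30 = 30 := map_ofNat φ 30
    simp only [qmul_def, map_add, map_sub, map_mul, e6, e60, e15, e2, e150, e10, e5, e100, e3, e30]
    have h12 : r * r ^ 2 = 3 * (k * r ^ 3) := by linear_combination (-r ^ 3) * hk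
    have h22 : r ^ 2 * r ^ 2 = 3 * (k * r ^ 4) := by linear_combination (-r ^ 4) * hk
    have h14 : r * (k * r ^ 4) = -10 * r ^ 2 - 15 * r - 6 := by
      linear_combination k * hr - (10 * r ^ 2 + 15 * r + 6) * hk
    have h23 : r ^ 2 * (k * r ^ 3) = -10 * r ^ 2 - 15 * r - 6 := by rw [← h14]; ring
    have h24 : r ^ 2 * (k * r ^ 4) = -30 * (k * r ^ 3) - 15 * r ^ 2 - 6 * r := by
      linear_combination r * h14 - 10 * h12
    have h33 : (k * r ^ 3) * (k * r ^ 3) = -10 * (k * r ^ 3) - 5 * r ^ 2 - 2 * r := by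
      linear_combination k * h24 + (-10 * (k * r ^ 3) - 5 * r ^ 2 - 2 * r) * hk
    have h34 : (k * r ^ 3) * (k * r ^ 4) = -10 * (k * r ^ 4) - 15 * (k * r ^ 3) - 2 * r ^ 2 := by
      linear_combination r * h33 - 5 * h12
    have h44 : (k * r ^ 4) * (k * r ^ 4) = 100 * r ^ 2 + 150 * r + 60 - 15 * (k * r ^ 4)
        - 6 * (k * r ^ 3) := by
      linear_combination r * h34 - 2 * h12 - 10 * h14
    linear_combination -(φ x.c1 * φ y.c2 + φ x.c2 * φ y.c1) * h12 - (φ x.c2 * φ y.c2) * h22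
      - (φ x.c1 * φ y.c4 + φ x.c4 * φ y.c1) * h14 - (φ x.c2 * φ y.c3 + φ x.c3 * φ y.c2) * h23
      - (φ x.c2 * φ y.c4 + φ x.c4 * φ y.c2) * h24 - (φ x.c3 * φ y.c3) * h33
      - (φ x.c3 * φ y.c4 + φ x.c4 * φ y.c3) * h34 - (φ x.c4 * φ y.c4) * h44

/-- Multiplication as a `ℤ`-linear equivalence with coordinates. -/
def toFun5 : Q5 ℤ ≃ₗ[ℤ] (Fin 5 → ℤ) where
  toFun x := ![x.c0, x.c1, x.c2, x.c3, x.c4]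
  invFun f := ⟨f 0, f 1, f 2, f 3, f 4⟩
  left_inv x := rfl
  right_inv f := by ext i; fin_cases i <;> rfl
  map_add' x y := by ext i; fin_cases i <;> rfl
  map_smul' n x := by ext i; fin_cases i <;> rfl

noncomputable def bas : Module.Basis (Fin 5) ℤ (Q5 ℤ) := Module.Basis.ofEquivFun toFun5

end Q5
end C16

end


section
namespace C16
namespace Q5
open Module

lemma intCast_mul_inj {y : ℤ} (hy : y ≠ 0) {a b : Q5 ℤ} (h : (y : Q5 ℤ) * a = y * b) : a = b := by
  have key : ∀ z : Q5 ℤ, (y : Q5 ℤ) * z = ⟨y * z.c0, y * z.c1, y * z.c2, y * z.c3, y * z.c4⟩ := by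
    intro z
    rw [intCast_def, qmul_def]
    ext <;> simp
  rw [key, key, Q5.ext_iff] at h
  obtain ⟨h0, h1, h2, h3, h4⟩ := h
  ext
  · exact mul_left_cancel₀ hy h0
  · exact mul_left_cancel₀ hy h1
  · exact mul_left_cancel₀ hy h2
  · exact mul_left_cancel₀ hy h3
  · exact mul_left_cancel₀ hy h4

lemma lattice (α α' s t : Q5 ℤ) (y : ℤ) (hy : y ≠ 0) (h : α * α' = (y : Q5 ℤ) ^ 2)
    (hc : s * α + t * α' = 1) :
    ∃ P : Matrix (Fin 5) (Fin 5) ℤ, |Algebra.norm ℤ α| = P.det ^ 2 ∧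
      ∀ c : Fin 5 → ℤ, α ∣ (toFun5.symm (P.mulVec c)) ^ 2 := by
  have : Module.Free ℤ (Q5 ℤ) := Module.Free.of_basis bas
  have : Module.Finite ℤ (Q5 ℤ) := Module.Finite.of_basis bas
  let fy : Q5 ℤ →ₗ[ℤ] Q5 ℤ := LinearMap.mulRight ℤ (y : Q5 ℤ)
  let fa : Q5 ℤ →ₗ[ℤ] Q5 ℤ := LinearMap.mulLeft ℤ α
  have hfy : Function.Injective fy := by
    intro a b hab
    apply intCast_mul_inj hy
    simpa [fy, mul_comm] using hab
  have hfa : Function.Injective fa := by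
    intro a b hab
    have h1 : α * a = α * b := by simpa [fa] using hab
    apply intCast_mul_inj hy
    apply intCast_mul_inj hy
    linear_combination α' * h1 + (b - a) * h
  let J : Submodule ℤ (Q5 ℤ) := LinearMap.range fa
  let Y : Submodule ℤ (Q5 ℤ) := LinearMap.range fy
  let I : Submodule ℤ (Q5 ℤ) := Y ⊔ J
  have memI : ∀ x, x ∈ I ↔ ∃ a b, x = a * y + α * b := by
    intro x
    simp only [I, Y, J, Submodule.mem_sup, LinearMap.mem_range]
    constructor
    · rintro ⟨_, ⟨a, rfl⟩, _, ⟨b, rfl⟩, rfl⟩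
      exact ⟨a, b, by simp [fy, fa]⟩
    · rintro ⟨a, b, rfl⟩
      exact ⟨_, ⟨a, rfl⟩, _, ⟨b, rfl⟩, by simp [fy, fa]⟩
  have hcom : J.toAddSubgroup.comap fy.toAddMonoidHom = I.toAddSubgroup := by
    ext x
    simp only [AddSubgroup.mem_comap, Submodule.mem_toAddSubgroup]
    rw [memI]
    change fy x ∈ J ↔ _
    simp only [J, LinearMap.mem_range]
    constructor
    · rintro ⟨z, hz⟩
      have hz' : α * z = x * y := by simpa [fy, fa] using hz
      have h2 : x * α' = y * z := by
        apply intCast_mul_inj hy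
        linear_combination (-α') * hz' + z * h
      refine ⟨t * z, s * x, ?_⟩
      linear_combination (-x) * hc + t * h2
    · rintro ⟨a, b, rfl⟩
      refine ⟨α' * a + b * y, ?_⟩
      simp only [fy, fa, LinearMap.mulLeft_apply, LinearMap.mulRight_apply]
      linear_combination a * h
  have hidx : J.toAddSubgroup.index = I.toAddSubgroup.index ^ 2 := by
    have h1 : I.toAddSubgroup.index = J.toAddSubgroup.relIndex Y.toAddSubgroup := by
      rw [← hcom, AddSubgroup.index_comap]; rfl
    have h2 : J.toAddSubgroup.relIndex I.toAddSubgroup =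
        J.toAddSubgroup.relIndex Y.toAddSubgroup := by
      have : I.toAddSubgroup = Y.toAddSubgroup ⊔ J.toAddSubgroup := by
        simp [I, Submodule.sup_toAddSubgroup]
      rw [this, AddSubgroup.relIndex_sup_right]
    have h3 : J.toAddSubgroup ≤ I.toAddSubgroup := by
      intro x hx
      exact (le_sup_right : J ≤ Y ⊔ J) hx
    rw [← AddSubgroup.relIndex_mul_index h3, h2, ← h1, sq]
  have hJ : J.toAddSubgroup.index = (Algebra.norm ℤ α).natAbs := by
    have := Submodule.natAbs_det_equiv J (LinearEquiv.ofInjective fa hfa)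
    rw [Algebra.norm_apply]
    change Nat.card (Q5 ℤ ⧸ J) = _
    rw [← this]
    rfl
  have hrk : finrank ℤ I = 5 := by
    have h5 : finrank ℤ (Q5 ℤ) = 5 := by
      rw [Module.finrank_eq_card_basis bas]; rfl
    apply le_antisymm
    · rw [← h5]; exact Submodule.finrank_le I
    · rw [← h5]
      let g : Q5 ℤ →ₗ[ℤ] I := fy.codRestrict I (fun x => (memI _).2 ⟨x, 0, by simp [fy]⟩)
      apply LinearMap.finrank_le_finrank_of_injective (f := g)
      intro a b hab
      exact hfy (congrArg Subtype.val hab)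
  let bI : Basis (Fin 5) ℤ I := Module.finBasisOfFinrankEq ℤ I hrk
  have hbI := Submodule.natAbs_det_basis_change bas I bI
  refine ⟨bas.toMatrix (fun j => (bI j : Q5 ℤ)), ?_, ?_⟩
  · have h1 : (bas.toMatrix (fun j => (bI j : Q5 ℤ))).det.natAbs = I.toAddSubgroup.index := by
      rw [Basis.det_apply] at hbI
      have e : (fun j => (bI j : Q5 ℤ)) = Subtype.val ∘ bI := rfl
      rw [e, hbI]
      exact (AddSubgroup.index_eq_card I.toAddSubgroup).symm
    rw [← sq_abs, Int.abs_eq_natAbs, Int.abs_eq_natAbs, h1, ← hJ, hidx]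
    push_cast; rfl
  · intro c
    have hmem : toFun5.symm ((bas.toMatrix (fun j => (bI j : Q5 ℤ))).mulVec c) ∈ I := by
      have : toFun5.symm ((bas.toMatrix (fun j => (bI j : Q5 ℤ))).mulVec c)
          = ∑ j, c j • (bI j : Q5 ℤ) := by
        rw [LinearEquiv.symm_apply_eq, map_sum]
        ext i
        simp only [Matrix.mulVec, dotProduct, map_smul, Finset.sum_apply, Pi.smul_apply, smul_eq_mul]
        apply Finset.sum_congr rfl
        intro j _
        rw [mul_comm]
        rfl
      rw [this]
      exact Submodule.sum_mem _ (fun j _ => Submodule.smul_mem _ _ (bI j).2)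
    obtain ⟨a, b, hx⟩ := (memI _).1 hmem
    rw [hx]
    exact ⟨a ^ 2 * α' + 2 * a * b * y + α * b ^ 2, by linear_combination (-(a ^ 2)) * h⟩

end Q5
end C16

end


section
namespace C16
open MeasureTheory Metric Real

lemma minkowski57 (A : Matrix (Fin 5) (Fin 5) ℝ) (h0 : A.det ≠ 0) (hD : A.det ^ 2 ≤ 16200000) :
    ∃ c : Fin 5 → ℤ, c ≠ 0 ∧ ∑ i, (A.mulVec (fun j => (c j : ℝ))) i ^ 2 ≤ 57 := by
  let f : (Fin 5 → ℝ) →ₗ[ℝ] (Fin 5 → ℝ) := Matrix.toLin' A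
  have hdet : LinearMap.det f = A.det := LinearMap.det_toLin' A
  let B : Set (Fin 5 → ℝ) := (@WithLp.toLp 2 (Fin 5 → ℝ)) ⁻¹' (ball (0 : EuclideanSpace ℝ (Fin 5)) (√57))
  have hBmem : ∀ x : Fin 5 → ℝ, x ∈ B ↔ ∑ i, x i ^ 2 < 57 := by
    intro x
    simp only [B, Set.mem_preimage, mem_ball_zero_iff, EuclideanSpace.norm_eq]
    rw [Real.sqrt_lt_sqrt_iff (by positivity)]
    simp
  have hBvol : volume B = ENNReal.ofReal (√57 ^ 5 * (π ^ 2 * 8 / 15)) := by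
    have h1 : volume B = volume (ball (0 : EuclideanSpace ℝ (Fin 5)) (√57)) :=
      (PiLp.volume_preserving_toLp (Fin 5)).measure_preimage measurableSet_ball.nullMeasurableSet
    rw [h1, InnerProductSpace.volume_ball_of_dim_odd (k := 2) (by simp)]
    rw [ENNReal.ofReal_mul (by positivity), ENNReal.ofReal_pow (by positivity)]
    norm_num [Nat.doubleFactorial]
  let s : Set (Fin 5 → ℝ) := f ⁻¹' B
  have hsvol : volume s = ENNReal.ofReal |A.det⁻¹| * ENNReal.ofReal (√57 ^ 5 * (π ^ 2 * 8 / 15)) := by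
    rw [← hBvol, ← hdet]
    exact Measure.addHaar_preimage_linearMap volume (by rwa [hdet]) B
  have hsymm : ∀ x ∈ s, -x ∈ s := by
    intro x hx
    have hx' : f x ∈ B := hx
    change f (-x) ∈ B
    rw [map_neg]
    rw [hBmem] at hx' ⊢
    simpa using hx'
  have hconv : Convex ℝ s := by
    have hB : Convex ℝ B := by
      have := (convex_ball (0 : EuclideanSpace ℝ (Fin 5)) (√57)).linear_preimage
        (WithLp.linearEquiv 2 ℝ (Fin 5 → ℝ)).symm.toLinearMap
      exact this
    exact hB.linear_preimage f
  let b := Pi.basisFun ℝ (Fin 5)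
  have fund := ZSpan.isAddFundamentalDomain' b (volume : Measure (Fin 5 → ℝ))
  have hF : volume (ZSpan.fundamentalDomain b) = 1 := by
    rw [ZSpan.fundamentalDomain_pi_basisFun, volume_pi, Measure.pi_pi]
    simp
  have hlt : volume (ZSpan.fundamentalDomain b) * 2 ^ Module.finrank ℝ (Fin 5 → ℝ) < volume s := by
    rw [hF, hsvol, ← ENNReal.ofReal_mul (abs_nonneg _), one_mul]
    have h32 : (2 : ENNReal) ^ Module.finrank ℝ (Fin 5 → ℝ) = ENNReal.ofReal 32 := by
      simp; norm_num
    rw [h32, ENNReal.ofReal_lt_ofReal_iff_of_nonneg (by norm_num), abs_inv]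
    have hpos : 0 < |A.det| := abs_pos.mpr h0
    rw [lt_inv_mul_iff₀ hpos]
    apply lt_of_pow_lt_pow_left₀ 2 (by positivity)
    have h57 : √57 ^ 2 = 57 := Real.sq_sqrt (by norm_num)
    have e1 : (√57 ^ 5 * (π ^ 2 * 8 / 15)) ^ 2 = 57 ^ 5 * (64 / 225) * π ^ 4 := by
      have : (√57 ^ 5 * (π ^ 2 * 8 / 15)) ^ 2 = (√57 ^ 2) ^ 5 * (64 / 225) * π ^ 4 := by ring
      rw [this, h57]
    rw [e1, mul_pow, sq_abs]
    have hpi : (3.1415 : ℝ) ^ 4 < π ^ 4 := pow_lt_pow_left₀ Real.pi_gt_d4 (by norm_num) (by norm_num)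
    norm_num at hpi ⊢
    linarith
  have : Countable (Submodule.span ℤ (Set.range b)).toAddSubgroup :=
    inferInstanceAs (Countable (Submodule.span ℤ (Set.range b)))
  obtain ⟨x, hx0, hxs⟩ := exists_ne_zero_mem_lattice_of_measure_mul_two_pow_lt_measure fund hsymm hconv hlt
  have hx := x.2
  have hx2 : (x : Fin 5 → ℝ) ∈ Submodule.span ℤ (Set.range b) := hx
  rw [b.mem_span_iff_repr_mem ℤ] at hx2
  choose c hc using hx2
  have hxc : (x : Fin 5 → ℝ) = fun j => (c j : ℝ) := by
    ext j
    have := hc j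
    simp [b] at this
    exact this.symm
  refine ⟨c, ?_, ?_⟩
  · rintro rfl
    apply hx0
    apply Subtype.ext
    rw [hxc]
    ext; simp
  · have h1 : f (x : Fin 5 → ℝ) ∈ B := hxs
    rw [hBmem, hxc] at h1
    exact le_of_lt (by simpa [f] using h1)

end C16

end


section
namespace C16
open Polynomial

/-- The quintic polynomial over `ℂ`. -/
noncomputable def pc : ℂ[X] :=
  Polynomial.X ^ 5 + Polynomial.C 30 * Polynomial.X ^ 2 + Polynomial.C 45 * Polynomial.X + Polynomial.C 18

lemma pc_natDegree : pc.natDegree = 5 := by unfold pc; compute_degree!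
lemma pc_monic : pc.Monic := by unfold pc; monicity!
lemma pc_eval (z : ℂ) : pc.eval z = z ^ 5 + 30 * z ^ 2 + 45 * z + 18 := by simp [pc]

lemma near_root (z0 : ℂ) (ε : ℝ) (hε : 0 < ε) (h : ‖z0 ^ 5 + 30 * z0 ^ 2 + 45 * z0 + 18‖ < ε ^ 5) :
    ∃ r : ℂ, r ^ 5 + 30 * r ^ 2 + 45 * r + 18 = 0 ∧ ‖z0 - r‖ < ε := by
  by_contra hcon
  push Not at hcon
  have hs : pc.Splits := IsAlgClosed.splits pc
  have hcard : pc.roots.card = 5 := by rw [← hs.natDegree_eq_card_roots, pc_natDegree]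
  have heval : pc.eval z0 = (pc.roots.map (fun a => z0 - a)).prod := by
    conv_lhs => rw [hs.eq_prod_roots_of_monic pc_monic]
    rw [eval_multiset_prod, Multiset.map_map]
    simp
  have hn : ‖pc.eval z0‖ = (pc.roots.map (fun a => ‖z0 - a‖)).prod := by
    rw [heval]
    have := map_multiset_prod (normHom : ℂ →*₀ ℝ) (pc.roots.map (fun a => z0 - a))
    rw [Multiset.map_map] at this
    exact this
  have hge : ε ^ 5 ≤ (pc.roots.map (fun a => ‖z0 - a‖)).prod := by
    have := Multiset.prod_map_le_prod_map₀ (s := pc.roots) (fun _ => ε) (fun a => ‖z0 - a‖)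
      (fun _ _ => hε.le) (fun a ha => hcon a (by
        have := (mem_roots pc_monic.ne_zero).1 ha
        rw [IsRoot, pc_eval] at this
        exact this))
    simpa [hcard, pow_succ, mul_assoc] using this
  rw [pc_eval] at hn
  linarith

lemma real_root : ∃ r : ℝ, r ^ 5 + 30 * r ^ 2 + 45 * r + 18 = 0 ∧
    |r + 2.44421078948| ≤ 1 / 10 ^ 7 := by
  have hcont : ContinuousOn (fun r : ℝ => r ^ 5 + 30 * r ^ 2 + 45 * r + 18)
    (Set.Icc (-2.44421083948) (-2.44421073948)) := by fun_prop
  have := intermediate_value_Icc (by norm_num) hcont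
  have h0 : (0 : ℝ) ∈ Set.Icc ((fun r : ℝ => r ^ 5 + 30 * r ^ 2 + 45 * r + 18) (-2.44421083948))
    ((fun r : ℝ => r ^ 5 + 30 * r ^ 2 + 45 * r + 18) (-2.44421073948)) := by
    constructor <;> norm_num
  obtain ⟨r, ⟨h1, h2⟩, hr⟩ := this h0
  refine ⟨r, hr, ?_⟩
  rw [abs_le]
  constructor <;> norm_num at * <;> linarith

lemma norm_lt_of_parts (z : ℂ) (ε : ℝ) (hε : 0 < ε) (h : z.re ^ 2 + z.im ^ 2 < ε ^ 2) : ‖z‖ < ε := by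
  apply lt_of_pow_lt_pow_left₀ 2 hε.le
  rw [Complex.sq_norm, Complex.normSq_apply]
  linarith

lemma root2 : ∃ r : ℂ, r ^ 5 + 30 * r ^ 2 + 45 * r + 18 = 0 ∧
    ‖(⟨-0.776973525817050844568218477481330352294, 0.184248067994978447312436598610552675631⟩ : ℂ) - r‖
      < 1 / 10 ^ 6 := by
  apply near_root _ _ (by norm_num)
  apply norm_lt_of_parts _ _ (by norm_num)
  simp only [pow_succ, pow_zero, one_mul, Complex.add_re, Complex.mul_re, Complex.mul_im,
    Complex.add_im, Complex.re_ofNat, Complex.im_ofNat]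
  norm_num

lemma root3 : ∃ r : ℂ, r ^ 5 + 30 * r ^ 2 + 45 * r + 18 = 0 ∧
    ‖(⟨1.999078920558534312661118497636791994873, 2.748297697047145977578472922557883429680⟩ : ℂ) - r‖
      < 1 / 10 ^ 6 := by
  apply near_root _ _ (by norm_num)
  apply norm_lt_of_parts _ _ (by norm_num)
  simp only [pow_succ, pow_zero, one_mul, Complex.add_re, Complex.mul_re, Complex.mul_im,
    Complex.add_im, Complex.re_ofNat, Complex.im_ofNat]
  norm_num

lemma prod_of_roots (s : Fin 5 → ℂ) (hs : ∀ i, (s i) ^ 5 + 30 * (s i) ^ 2 + 45 * (s i) + 18 = 0)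
    (hinj : Function.Injective s) (z : ℂ) :
    z ^ 5 + 30 * z ^ 2 + 45 * z + 18 = ∏ i, (z - s i) := by
  have key : pc = ∏ i, (Polynomial.X - Polynomial.C (s i)) := by
    have hle : (Finset.univ.val.map s) ≤ pc.roots := by
      rw [Multiset.le_iff_subset]
      · intro a ha
        rw [Multiset.mem_map] at ha
        obtain ⟨i, _, rfl⟩ := ha
        rw [mem_roots pc_monic.ne_zero, IsRoot, pc_eval]
        exact hs i
      · exact (Multiset.nodup_map_iff_of_injective hinj).2 Finset.univ.nodup
    have hsp : pc.Splits := IsAlgClosed.splits pc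
    have hcard : pc.roots.card = 5 := by rw [← hsp.natDegree_eq_card_roots, pc_natDegree]
    have heq := Multiset.eq_of_le_of_card_le hle (by simp [hcard])
    conv_lhs => rw [hsp.eq_prod_roots_of_monic pc_monic, ← heq, Multiset.map_map]
    rfl
  rw [← pc_eval, key, Polynomial.eval_prod]
  simp

lemma power_sums (a b c d e : ℂ)
    (h : ∀ z : ℂ, z ^ 5 + 30 * z ^ 2 + 45 * z + 18 = (z - a) * (z - b) * (z - c) * (z - d) * (z - e)) :
    a + b + c + d + e = 0 ∧ a ^ 2 + b ^ 2 + c ^ 2 + d ^ 2 + e ^ 2 = 0 ∧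
    a ^ 3 + b ^ 3 + c ^ 3 + d ^ 3 + e ^ 3 = -90 ∧ a ^ 4 + b ^ 4 + c ^ 4 + d ^ 4 + e ^ 4 = -180 := by
  have h0 := h 0
  have h1 := h 1
  have h2 := h (-1)
  have h3 := h 2
  have h4 := h (-2)
  have e1 : a + b + c + d + e = 0 := by
    linear_combination (1 / 4 : ℂ) * h0 - (1 / 6 : ℂ) * h1 - (1 / 6 : ℂ) * h2
      + (1 / 24 : ℂ) * h3 + (1 / 24 : ℂ) * h4
  have e2 : a * b + a * c + a * d + a * e + b * c + b * d + b * e + c * d + c * e + d * e = 0 := by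
    linear_combination (1 / 6 : ℂ) * h1 - (1 / 6 : ℂ) * h2 - (1 / 12 : ℂ) * h3 + (1 / 12 : ℂ) * h4
  have e3 : a * b * c + a * b * d + a * b * e + a * c * d + a * c * e + a * d * e + b * c * d
      + b * c * e + b * d * e + c * d * e = -30 := by
    linear_combination (-(5 / 4 : ℂ)) * h0 + (2 / 3 : ℂ) * h1 + (2 / 3 : ℂ) * h2
      - (1 / 24 : ℂ) * h3 - (1 / 24 : ℂ) * h4
  have e4 : a * b * c * d + a * b * c * e + a * b * d * e + a * c * d * e + b * c * d * e = 45 := by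
    linear_combination (-(2 / 3 : ℂ)) * h1 + (2 / 3 : ℂ) * h2 + (1 / 12 : ℂ) * h3 - (1 / 12 : ℂ) * h4
  have p2 : a ^ 2 + b ^ 2 + c ^ 2 + d ^ 2 + e ^ 2 = 0 := by
    linear_combination (a + b + c + d + e) * e1 - 2 * e2
  have p3 : a ^ 3 + b ^ 3 + c ^ 3 + d ^ 3 + e ^ 3 = -90 := by
    linear_combination (a + b + c + d + e) * p2 - (a + b + c + d + e) * e2 + 3 * e3
  refine ⟨e1, p2, p3, ?_⟩
  linear_combination (a + b + c + d + e) * p3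
    - (a * b + a * c + a * d + a * e + b * c + b * d + b * e + c * d + c * e + d * e) * p2
    + (a + b + c + d + e) * e3 - 4 * e4 - 120 * e1

end C16

end


section
namespace C16
open Q5

noncomputable def r1 : ℝ := Classical.choose real_root
noncomputable def r2 : ℂ := Classical.choose root2
noncomputable def r3 : ℂ := Classical.choose root3
lemma r1_root : r1 ^ 5 + 30 * r1 ^ 2 + 45 * r1 + 18 = 0 := (Classical.choose_spec real_root).1
lemma r2_root : r2 ^ 5 + 30 * r2 ^ 2 + 45 * r2 + 18 = 0 := (Classical.choose_spec root2).1
lemma r3_root : r3 ^ 5 + 30 * r3 ^ 2 + 45 * r3 + 18 = 0 := (Classical.choose_spec root3).1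
lemma r1_near : |r1 + 2.44421078948| ≤ 1 / 10 ^ 7 := (Classical.choose_spec real_root).2
lemma r2_near : ‖(⟨-0.776973525817050844568218477481330352294, 0.184248067994978447312436598610552675631⟩ : ℂ) - r2‖
      < 1 / 10 ^ 6 := (Classical.choose_spec root2).2
lemma r3_near : ‖(⟨1.999078920558534312661118497636791994873, 2.748297697047145977578472922557883429680⟩ : ℂ) - r3‖
      < 1 / 10 ^ 6 := (Classical.choose_spec root3).2

lemma parts_near {a b ε : ℝ} {r : ℂ} (h : ‖(⟨a, b⟩ : ℂ) - r‖ < ε) :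
    |a - r.re| < ε ∧ |b - r.im| < ε :=
  ⟨lt_of_le_of_lt (by simpa using Complex.abs_re_le_norm ((⟨a, b⟩ : ℂ) - r)) h,
   lt_of_le_of_lt (by simpa using Complex.abs_im_le_norm ((⟨a, b⟩ : ℂ) - r)) h⟩

noncomputable def σ1 : Q5 ℤ →+* ℝ := ev (Int.castRingHom ℝ) r1 (1 / 3) (by norm_num) r1_root
noncomputable def σ2 : Q5 ℤ →+* ℂ := ev (Int.castRingHom ℂ) r2 (1 / 3) (by norm_num) r2_root
noncomputable def σ3 : Q5 ℤ →+* ℂ := ev (Int.castRingHom ℂ) r3 (1 / 3) (by norm_num) r3_root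

lemma σ1_apply (x : Q5 ℤ) : σ1 x = x.c0 + x.c1 * r1 + x.c2 * r1 ^ 2 + x.c3 * (1 / 3 * r1 ^ 3)
    + x.c4 * (1 / 3 * r1 ^ 4) := rfl
lemma σ2_apply (x : Q5 ℤ) : σ2 x = x.c0 + x.c1 * r2 + x.c2 * r2 ^ 2 + x.c3 * (1 / 3 * r2 ^ 3)
    + x.c4 * (1 / 3 * r2 ^ 4) := rfl
lemma σ3_apply (x : Q5 ℤ) : σ3 x = x.c0 + x.c1 * r3 + x.c2 * r3 ^ 2 + x.c3 * (1 / 3 * r3 ^ 3)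
    + x.c4 * (1 / 3 * r3 ^ 4) := rfl

open ComplexConjugate in
lemma psums : r1 + 2 * r2.re + 2 * r3.re = 0 ∧ r1 ^ 2 + 2 * (r2 ^ 2).re + 2 * (r3 ^ 2).re = 0 ∧
    r1 ^ 3 + 2 * (r2 ^ 3).re + 2 * (r3 ^ 3).re = -90 ∧
    r1 ^ 4 + 2 * (r2 ^ 4).re + 2 * (r3 ^ 4).re = -180 := by
  have hc2 : (conj r2) ^ 5 + 30 * (conj r2) ^ 2 + 45 * (conj r2) + 18 = 0 := by
    have := congrArg conj r2_root
    simpa only [map_add, map_mul, map_pow, map_ofNat, map_zero] using this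
  have hc3 : (conj r3) ^ 5 + 30 * (conj r3) ^ 2 + 45 * (conj r3) + 18 = 0 := by
    have := congrArg conj r3_root
    simpa only [map_add, map_mul, map_pow, map_ofNat, map_zero] using this
  have hc1 : (r1 : ℂ) ^ 5 + 30 * (r1 : ℂ) ^ 2 + 45 * (r1 : ℂ) + 18 = 0 := by
    exact_mod_cast r1_root
  obtain ⟨a2, b2⟩ := parts_near r2_near
  obtain ⟨a3, b3⟩ := parts_near r3_near
  have a1 := r1_near
  change |_ - r2.re| < _ at a2
  change |_ - r2.im| < _ at b2
  change |_ - r3.re| < _ at a3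
  change |_ - r3.im| < _ at b3
  rw [abs_lt] at a2 b2 a3 b3
  rw [abs_le] at a1
  norm_num at a1 a2 b2 a3 b3
  have hprod := prod_of_roots ![(r1 : ℂ), r2, conj r2, r3, conj r3]
    (by intro i; fin_cases i <;> first | exact hc1 | exact r2_root | exact hc2 | exact r3_root | exact hc3)
    (by
      intro i j hij
      have h1 := congrArg Complex.re hij
      have h2 := congrArg Complex.im hij
      fin_cases i <;> fin_cases j <;> simp at h1 h2 ⊢ <;> linarith)
  simp only [Fin.prod_univ_five] at hprod
  obtain ⟨p1, p2, p3, p4⟩ := power_sums _ _ _ _ _ hprod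
  have q : ∀ (k : ℕ) (m : ℝ), (r1 : ℂ) ^ k + r2 ^ k + (conj r2) ^ k + r3 ^ k + (conj r3) ^ k = m →
      r1 ^ k + 2 * (r2 ^ k).re + 2 * (r3 ^ k).re = m := by
    intro k m h
    have h1 := congrArg Complex.re h
    rw [← map_pow, ← map_pow, ← Complex.ofReal_pow] at h1
    simp only [Complex.add_re, Complex.conj_re, Complex.ofReal_re] at h1
    linarith
  refine ⟨?_, ?_, ?_, ?_⟩
  · simpa using q 1 0 (by simpa using p1)
  · exact q 2 0 (by simpa using p2)
  · exact q 3 (-90) (by simpa using p3)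
  · exact q 4 (-180) (by simpa using p4)

/-- The trace form. -/
def tr (x : Q5 ℤ) : ℤ := 5 * x.c0 - 30 * x.c3 - 60 * x.c4

lemma tr_eq (x : Q5 ℤ) : σ1 x + 2 * (σ2 x).re + 2 * (σ3 x).re = tr x := by
  obtain ⟨p1, p2, p3, p4⟩ := psums
  rw [σ1_apply, σ2_apply, σ3_apply, tr]
  have e : ∀ r : ℂ, ((x.c0 : ℂ) + x.c1 * r + x.c2 * r ^ 2 + x.c3 * (1 / 3 * r ^ 3)
    + x.c4 * (1 / 3 * r ^ 4)).re = x.c0 + x.c1 * r.re + x.c2 * (r ^ 2).re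
      + x.c3 * (1 / 3 * (r ^ 3).re) + x.c4 * (1 / 3 * (r ^ 4).re) := by
    intro r
    have h3 : (1 / 3 * r ^ 3) = (((1 / 3 : ℝ) : ℂ)) * r ^ 3 := by push_cast; ring
    have h4 : (1 / 3 * r ^ 4) = (((1 / 3 : ℝ) : ℂ)) * r ^ 4 := by push_cast; ring
    have hi : ∀ (n : ℤ) (z : ℂ), ((n : ℂ) * z).re = n * z.re := by
      intro n z; simp
    rw [h3, h4]
    simp only [Complex.add_re, hi, Complex.re_ofReal_mul, Complex.intCast_re]
  rw [e, e]
  push_cast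
  linear_combination (x.c1 : ℝ) * p1 + (x.c2 : ℝ) * p2 + (x.c3 / 3 : ℝ) * p3 + (x.c4 / 3 : ℝ) * p4

end C16

end


section
namespace C16
open Q5 Module

/-- The Minkowski vector of an element. -/
noncomputable def V (x : Q5 ℤ) : Fin 5 → ℝ :=
  ![σ1 x, √2 * (σ2 x).re, √2 * (σ2 x).im, √2 * (σ3 x).re, √2 * (σ3 x).im]

noncomputable def E : Matrix (Fin 5) (Fin 5) ℝ := Matrix.of fun i j => V (bas j) i

lemma V_add (x y : Q5 ℤ) : V (x + y) = V x + V y := by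
  ext i; fin_cases i <;> simp [V] <;> ring
lemma V_zsmul (n : ℤ) (x : Q5 ℤ) : V (n • x) = (n : ℝ) • V x := by
  ext i; fin_cases i <;> simp [V] <;> ring
/-- `V` as a linear map. -/
noncomputable def Vl : Q5 ℤ →ₗ[ℤ] (Fin 5 → ℝ) where
  toFun := V
  map_add' := V_add
  map_smul' n x := by rw [V_zsmul]; ext i; simp

lemma E_mulVec (c : Fin 5 → ℤ) : E.mulVec (fun j => (c j : ℝ)) = V (toFun5.symm c) := by
  have h1 : toFun5.symm c = ∑ j, c j • bas j := by
    have := bas.sum_repr (toFun5.symm c)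
    rw [← this]
    apply Finset.sum_congr rfl
    intro j _
    have : bas.repr (toFun5.symm c) j = c j := by simp [bas]
    rw [this]
  have h2 : V (toFun5.symm c) = ∑ j, c j • V (bas j) := by
    rw [h1]
    change Vl _ = _
    rw [map_sum]
    simp only [map_zsmul]; rfl
  rw [h2]
  ext i
  simp [Matrix.mulVec, dotProduct, E, mul_comm]

lemma gram (x y : Q5 ℤ) : V x 0 * V y 0 + V x 1 * V y 1 - V x 2 * V y 2 + V x 3 * V y 3
    - V x 4 * V y 4 = tr (x * y) := by
  rw [← tr_eq]
  have h2 : √2 * √2 = (2 : ℝ) := Real.mul_self_sqrt (by norm_num)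
  simp [V, Complex.mul_re]
  linear_combination ((σ2 x).re * (σ2 y).re - (σ2 x).im * (σ2 y).im
    + (σ3 x).re * (σ3 y).re - (σ3 x).im * (σ3 y).im) * h2

/-- integral Gram matrix of the trace form -/
def G : Matrix (Fin 5) (Fin 5) ℤ := Matrix.of fun i j =>
  tr ((toFun5.symm (Pi.single i 1)) * (toFun5.symm (Pi.single j 1)))

lemma bas_eq (j : Fin 5) : bas j = toFun5.symm (Pi.single j 1) := by
  simp [bas]

lemma G_det : G.det = 16200000 := by decide +kernel

lemma E_det_sq : E.det ^ 2 = 16200000 := by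
  have key : E.transpose * Matrix.diagonal ![1, 1, -1, 1, -1] * E = G.map (Int.cast : ℤ → ℝ) := by
    ext i j
    rw [Matrix.mul_apply]
    simp only [Fin.sum_univ_five, Matrix.mul_diagonal, Matrix.transpose_apply, E, Matrix.of_apply,
      Matrix.map_apply, G, ← bas_eq, ← gram]
    simp
    ring
  have := congrArg Matrix.det key
  rw [Matrix.det_mul, Matrix.det_mul, Matrix.det_transpose, Matrix.det_diagonal] at this
  have h2 : (G.map (Int.cast : ℤ → ℝ)).det = 16200000 := by
    have := Int.cast_det (R := ℝ) G
    rw [G_det] at this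
    rw [← this]; norm_num
  rw [h2] at this
  simp [Fin.prod_univ_five] at this
  linarith

/-- block matrix of multiplication -/
noncomputable def Blk (x : Q5 ℤ) : Matrix (Fin 5) (Fin 5) ℝ :=
  !![σ1 x, 0, 0, 0, 0;
     0, (σ2 x).re, -(σ2 x).im, 0, 0;
     0, (σ2 x).im, (σ2 x).re, 0, 0;
     0, 0, 0, (σ3 x).re, -(σ3 x).im;
     0, 0, 0, (σ3 x).im, (σ3 x).re]

lemma Blk_det (x : Q5 ℤ) : (Blk x).det = σ1 x * ‖σ2 x‖ ^ 2 * ‖σ3 x‖ ^ 2 := by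
  rw [Complex.sq_norm, Complex.sq_norm, Complex.normSq_apply, Complex.normSq_apply]
  simp [Blk, Matrix.det_succ_row_zero, Fin.sum_univ_succ, Fin.succAbove, Matrix.submatrix]
  ring

lemma Blk_V (x y : Q5 ℤ) : (Blk x).mulVec (V y) = V (x * y) := by
  ext i
  fin_cases i <;> simp [Blk, V, Matrix.mulVec, dotProduct, Fin.sum_univ_five, Complex.mul_re,
    Complex.mul_im] <;> ring

lemma norm_eq (x : Q5 ℤ) : (Algebra.norm ℤ x : ℝ) = σ1 x * ‖σ2 x‖ ^ 2 * ‖σ3 x‖ ^ 2 := by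
  have hE : E.det ≠ 0 := by
    intro h; have := E_det_sq; rw [h] at this; norm_num at this
  have key : E * (Algebra.leftMulMatrix bas x).map (Int.cast : ℤ → ℝ) = Blk x * E := by
    ext i j
    have h1 : (Blk x * E) i j = V (x * bas j) i := by
      rw [← Blk_V]; rfl
    have h2 : (E * (Algebra.leftMulMatrix bas x).map (Int.cast : ℤ → ℝ)) i j =
        E.mulVec (fun k => (((Algebra.leftMulMatrix bas x) k j : ℤ) : ℝ)) i := rfl
    rw [h1, h2, E_mulVec]
    congr 2
    rw [LinearEquiv.symm_apply_eq]
    ext k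
    rw [Algebra.leftMulMatrix_eq_repr_mul]
    rfl
  have := congrArg Matrix.det key
  rw [Matrix.det_mul, Matrix.det_mul, Blk_det, mul_comm] at this
  have h2 := mul_right_cancel₀ hE this
  rw [← h2, Algebra.norm_eq_matrix_det bas]
  exact Int.cast_det (R := ℝ) _

end C16

end


section
namespace C16
open Q5 Module

lemma isq (a : ℝ) (ha : 0 < a) : (√a)⁻¹ ^ 2 = a⁻¹ := by
  rw [inv_pow, Real.sq_sqrt ha.le]

lemma exists_beta (α α' s t : Q5 ℤ) (y : ℤ) (hy : y ≠ 0) (h : α * α' = (y : Q5 ℤ) ^ 2)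
    (hc : s * α + t * α' = 1) (hpos : 0 < σ1 α) :
    ∃ β γ : Q5 ℤ, β ≠ 0 ∧ α * β = γ ^ 2 ∧ |σ1 β| + 2 * ‖σ2 β‖ + 2 * ‖σ3 β‖ ≤ 57 ∧
      IsSquare (Algebra.norm ℤ β) := by
  obtain ⟨P, hP, hdiv⟩ := lattice α α' s t y hy h hc
  have hyC : ∀ {K : Type} [Field K] [CharZero K] (f : Q5 ℤ →+* K), f α ≠ 0 := by
    intro K _ _ f h0
    have h1 := congrArg f h
    rw [map_mul, h0, zero_mul, map_pow, map_intCast] at h1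
    exact hy (by exact_mod_cast (pow_eq_zero_iff two_ne_zero).1 h1.symm)
  have h1 : σ1 α ≠ 0 := hyC σ1
  have h2 : 0 < ‖σ2 α‖ := norm_pos_iff.2 (hyC σ2)
  have h3 : 0 < ‖σ3 α‖ := norm_pos_iff.2 (hyC σ3)
  have hN := norm_eq α
  have hNpos : (0 : ℝ) < (Algebra.norm ℤ α : ℝ) := by rw [hN]; positivity
  have hNpos' : 0 < Algebra.norm ℤ α := by exact_mod_cast hNpos
  rw [abs_of_pos hNpos'] at hP
  have hE : E.det ≠ 0 := by
    intro h; have := E_det_sq; rw [h] at this; norm_num at this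
  let d : Fin 5 → ℝ := ![(√(σ1 α))⁻¹, (√‖σ2 α‖)⁻¹, (√‖σ2 α‖)⁻¹, (√‖σ3 α‖)⁻¹, (√‖σ3 α‖)⁻¹]
  let A : Matrix (Fin 5) (Fin 5) ℝ := Matrix.diagonal d * (E * P.map (Int.cast : ℤ → ℝ))
  have hAdet : A.det ^ 2 = 16200000 := by
    have hPd : (P.map (Int.cast : ℤ → ℝ)).det = (P.det : ℝ) := (Int.cast_det (R := ℝ) P).symm
    have e1 : (P.det : ℝ) ^ 2 = σ1 α * ‖σ2 α‖ ^ 2 * ‖σ3 α‖ ^ 2 := by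
      rw [← hN, hP]; push_cast; rfl
    simp only [A, Matrix.det_mul, Matrix.det_diagonal, hPd, mul_pow, e1, E_det_sq]
    simp only [d, Fin.prod_univ_five]
    simp [mul_pow, Real.sq_sqrt hpos.le, Real.sq_sqrt h2.le, Real.sq_sqrt h3.le]
    field_simp
  have hA0 : A.det ≠ 0 := by
    intro h; rw [h] at hAdet; norm_num at hAdet
  obtain ⟨c, hc0, hcle⟩ := minkowski57 A hA0 hAdet.le
  obtain ⟨β, hβ⟩ := hdiv c
  set γ := toFun5.symm (P.mulVec c) with hγ
  have hAc : A.mulVec (fun j => (c j : ℝ)) = fun i => d i * V γ i := by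
    have e0 : (P.map (Int.cast : ℤ → ℝ)).mulVec (fun j => (c j : ℝ)) =
        fun i => ((P.mulVec c i : ℤ) : ℝ) := by
      ext i; simp [Matrix.mulVec, dotProduct]
    simp only [A, ← Matrix.mulVec_mulVec]
    rw [e0, E_mulVec]
    ext i
    rw [Matrix.mulVec_diagonal]
  have n1 : |σ1 β| = σ1 γ ^ 2 / σ1 α := by
    have := congrArg σ1 hβ
    rw [map_pow, map_mul] at this
    rw [this, mul_div_cancel_left₀ _ h1, abs_of_nonneg]
    by_contra hneg
    push Not at hneg
    nlinarith [sq_nonneg (σ1 γ)]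
  have n2 : ‖σ2 β‖ = ‖σ2 γ‖ ^ 2 / ‖σ2 α‖ := by
    have := congrArg (fun x => ‖σ2 x‖) hβ
    simp only [map_pow, map_mul, norm_pow, norm_mul] at this
    rw [this, mul_div_cancel_left₀ _ h2.ne']
  have n3 : ‖σ3 β‖ = ‖σ3 γ‖ ^ 2 / ‖σ3 α‖ := by
    have := congrArg (fun x => ‖σ3 x‖) hβ
    simp only [map_pow, map_mul, norm_pow, norm_mul] at this
    rw [this, mul_div_cancel_left₀ _ h3.ne']
  have hsum : ∑ i, (A.mulVec (fun j => (c j : ℝ))) i ^ 2 = |σ1 β| + 2 * ‖σ2 β‖ + 2 * ‖σ3 β‖ := by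
    rw [hAc, n1, n2, n3, Complex.sq_norm, Complex.sq_norm, Complex.normSq_apply, Complex.normSq_apply]
    have hs : (√2 : ℝ) ^ 2 = 2 := Real.sq_sqrt (by norm_num)
    simp only [Fin.sum_univ_five, d, V, mul_pow]
    simp [mul_pow, Real.sq_sqrt hpos.le, Real.sq_sqrt h2.le, Real.sq_sqrt h3.le, hs]
    ring
  refine ⟨β, γ, ?_, hβ.symm, by rw [← hsum]; exact hcle, ?_⟩
  · rintro rfl
    simp only [map_zero, abs_zero, norm_zero] at hsum
    have hz : A.mulVec (fun j => (c j : ℝ)) = 0 := by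
      ext i
      have := (Finset.sum_eq_zero_iff_of_nonneg (fun i _ => sq_nonneg _)).1
        (show ∑ i, (A.mulVec (fun j => (c j : ℝ))) i ^ 2 = 0 by rw [hsum]; norm_num) i
        (Finset.mem_univ _)
      simpa using this
    have := Matrix.eq_zero_of_mulVec_eq_zero hA0 hz
    apply hc0
    ext i
    have := congrFun this i
    simpa using this
  · have hn := congrArg (Algebra.norm ℤ) hβ
    rw [map_pow, map_mul, hP] at hn
    have hd : P.det ≠ 0 := by
      intro h0; rw [h0] at hP; simp at hP; omega
    have hdv : P.det ∣ Algebra.norm ℤ γ := by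
      rw [← Int.pow_dvd_pow_iff two_ne_zero, hn]; exact dvd_mul_right _ _
    obtain ⟨k, hk⟩ := hdv
    refine ⟨k, ?_⟩
    rw [hk] at hn
    apply mul_left_cancel₀ (pow_ne_zero 2 hd)
    linear_combination -hn

end C16

end


section
namespace C16
open Q5 Module

lemma tr_bound (β δ : Q5 ℤ) (B : ℝ) (hB : |σ1 β| + 2 * ‖σ2 β‖ + 2 * ‖σ3 β‖ ≤ 57)
    (h1 : |σ1 δ| ≤ B) (h2 : ‖σ2 δ‖ ≤ B) (h3 : ‖σ3 δ‖ ≤ B) : |(tr (β * δ) : ℝ)| ≤ 57 * B := by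
  have hB0 : 0 ≤ B := (abs_nonneg _).trans h1
  rw [← tr_eq]
  have a1 : |σ1 (β * δ)| ≤ |σ1 β| * B := by
    rw [map_mul, abs_mul]; exact mul_le_mul_of_nonneg_left h1 (abs_nonneg _)
  have a2 : |(σ2 (β * δ)).re| ≤ ‖σ2 β‖ * B := by
    refine (Complex.abs_re_le_norm _).trans ?_
    rw [map_mul, norm_mul]; exact mul_le_mul_of_nonneg_left h2 (norm_nonneg _)
  have a3 : |(σ3 (β * δ)).re| ≤ ‖σ3 β‖ * B := by
    refine (Complex.abs_re_le_norm _).trans ?_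
    rw [map_mul, norm_mul]; exact mul_le_mul_of_nonneg_left h3 (norm_nonneg _)
  have : (|σ1 β| + 2 * ‖σ2 β‖ + 2 * ‖σ3 β‖) * B ≤ 57 * B := mul_le_mul_of_nonneg_right hB hB0
  rw [abs_le] at *
  constructor <;> linarith [a1.1, a1.2, a2.1, a2.2, a3.1, a3.2]

lemma ev_near (z r : ℂ) (h : ‖z - r‖ ≤ 1 / 10 ^ 6) (hz : ‖z‖ ≤ 7 / 2) (c0 c1 c2 c3 c4 : ℤ)
    (h1 : |c1| ≤ 120) (h2 : |c2| ≤ 8) (h3 : |c3| ≤ 12) (h4 : |c4| ≤ 12) :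
    ‖(c0 : ℂ) + c1 * r + c2 * r ^ 2 + c3 * (1 / 3 * r ^ 3) + c4 * (1 / 3 * r ^ 4)‖ ≤
    ‖(c0 : ℂ) + c1 * z + c2 * z ^ 2 + c3 * (1 / 3 * z ^ 3) + c4 * (1 / 3 * z ^ 4)‖ + 2 / 1000 := by
  have hr : ‖r‖ ≤ 4 := by
    have : r = z - (z - r) := by ring
    rw [this]
    refine (norm_sub_le _ _).trans ?_
    norm_num at h ⊢; linarith
  have hz' : ‖z‖ ≤ 4 := by linarith
  have step : ∀ (k : ℕ) (ε : ℝ), ‖z ^ k - r ^ k‖ ≤ ε → ‖z ^ (k + 1) - r ^ (k + 1)‖ ≤ 4 * ε + 4 ^ k * (1 / 10 ^ 6) := by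
    intro k ε hk
    have e : z ^ (k + 1) - r ^ (k + 1) = z * (z ^ k - r ^ k) + r ^ k * (z - r) := by ring
    rw [e]
    refine (norm_add_le _ _).trans ?_
    rw [norm_mul, norm_mul, norm_pow]
    have := pow_le_pow_left₀ (norm_nonneg r) hr k
    gcongr
  have e1 : ‖z ^ 1 - r ^ 1‖ ≤ 1 / 10 ^ 6 := by simpa using h
  have e2 := step 1 _ e1
  have e3 := step 2 _ e2
  have e4 := step 3 _ e3
  norm_num at e1 e2 e3 e4
  have cst : ∀ (c : ℤ) (b : ℤ) (x : ℂ) (e : ℝ), |c| ≤ b → ‖x‖ ≤ e → ‖(c : ℂ) * x‖ ≤ b * e := by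
    intro c b x e hc hx
    rw [norm_mul, Complex.norm_intCast]
    have : (|c| : ℝ) ≤ b := by exact_mod_cast hc
    have h0 : (0 : ℝ) ≤ b := (abs_nonneg _).trans this
    exact mul_le_mul this hx (norm_nonneg _) h0
  have f1 := cst c1 120 _ _ h1 e1
  have f2 := cst c2 8 _ _ h2 e2
  have f3 := cst c3 12 _ _ h3 e3
  have f4 := cst c4 12 _ _ h4 e4
  have third : ‖(1 / 3 : ℂ)‖ = 1 / 3 := by norm_num
  have g3 : ‖(1 / 3 : ℂ) * (c3 * (z ^ 3 - r ^ 3))‖ ≤ 1 / 3 * (12 * (3 / 62500)) := by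
    rw [norm_mul, third]; gcongr; exact_mod_cast f3
  have g4 : ‖(1 / 3 : ℂ) * (c4 * (z ^ 4 - r ^ 4))‖ ≤ 1 / 3 * (12 * (4 / 15625)) := by
    rw [norm_mul, third]; gcongr; exact_mod_cast f4
  have key : (c0 : ℂ) + c1 * r + c2 * r ^ 2 + c3 * (1 / 3 * r ^ 3) + c4 * (1 / 3 * r ^ 4) =
      ((c0 : ℂ) + c1 * z + c2 * z ^ 2 + c3 * (1 / 3 * z ^ 3) + c4 * (1 / 3 * z ^ 4))
      - (c1 * (z - r) + c2 * (z ^ 2 - r ^ 2) + (1 / 3 : ℂ) * (c3 * (z ^ 3 - r ^ 3))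
        + (1 / 3 : ℂ) * (c4 * (z ^ 4 - r ^ 4))) := by ring
  rw [key]
  refine (norm_sub_le _ _).trans ?_
  have := norm_add_le (c1 * (z - r) + c2 * (z ^ 2 - r ^ 2) + (1 / 3 : ℂ) * (c3 * (z ^ 3 - r ^ 3)))
    ((1 / 3 : ℂ) * (c4 * (z ^ 4 - r ^ 4)))
  have := norm_add_le (c1 * (z - r) + c2 * (z ^ 2 - r ^ 2)) ((1 / 3 : ℂ) * (c3 * (z ^ 3 - r ^ 3)))
  have := norm_add_le (c1 * (z - r)) (c2 * (z ^ 2 - r ^ 2))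
  push_cast at f1 f2
  linarith

lemma norm_le_of_parts (z : ℂ) (ε : ℝ) (hε : 0 ≤ ε) (h : z.re ^ 2 + z.im ^ 2 ≤ ε ^ 2) : ‖z‖ ≤ ε := by
  apply le_of_sq_le_sq _ hε
  rw [Complex.sq_norm, Complex.normSq_apply]
  linarith

/-- rational form of the check that an element is small at an approximate root `a + b i` -/
def smallAt (a b B : ℚ) (c : Q5 ℤ) : Prop :=
  let a2 := a * a - b * b
  let b2 := 2 * a * b
  let a3 := a2 * a - b2 * b
  let b3 := a2 * b + b2 * a
  let a4 := a2 * a2 - b2 * b2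
  let b4 := 2 * a2 * b2
  (c.c0 + c.c1 * a + c.c2 * a2 + c.c3 * (1 / 3 * a3) + c.c4 * (1 / 3 * a4)) ^ 2 +
  (c.c1 * b + c.c2 * b2 + c.c3 * (1 / 3 * b3) + c.c4 * (1 / 3 * b4)) ^ 2 ≤ (B - 2 / 1000) ^ 2

lemma small_of (a b B : ℚ) (r : ℂ) (hr : ‖(⟨a, b⟩ : ℂ) - r‖ ≤ 1 / 10 ^ 6) (hab : a ^ 2 + b ^ 2 ≤ (7 / 2) ^ 2)
    (c : Q5 ℤ) (h : smallAt a b B c) (hB : 2 / 1000 ≤ B)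
    (h1 : |c.c1| ≤ 120) (h2 : |c.c2| ≤ 8) (h3 : |c.c3| ≤ 12) (h4 : |c.c4| ≤ 12) :
    ‖(c.c0 : ℂ) + c.c1 * r + c.c2 * r ^ 2 + c.c3 * (1 / 3 * r ^ 3) + c.c4 * (1 / 3 * r ^ 4)‖ ≤ B := by
  have hz : ‖(⟨a, b⟩ : ℂ)‖ ≤ 7 / 2 := by
    apply norm_le_of_parts _ _ (by norm_num)
    have : ((a ^ 2 + b ^ 2 : ℚ) : ℝ) ≤ (((7 / 2) ^ 2 : ℚ) : ℝ) := by exact_mod_cast hab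
    push_cast at this
    exact this
  refine (ev_near _ r hr hz c.c0 c.c1 c.c2 c.c3 c.c4 h1 h2 h3 h4).trans ?_
  have hB' : (2 / 1000 : ℝ) ≤ B := by
    have : ((2 / 1000 : ℚ) : ℝ) ≤ (B : ℝ) := by exact_mod_cast hB
    push_cast at this; exact this
  suffices hh : ‖(c.c0 : ℂ) + c.c1 * (⟨a, b⟩ : ℂ) + c.c2 * (⟨a, b⟩ : ℂ) ^ 2 + c.c3 * (1 / 3 * (⟨a, b⟩ : ℂ) ^ 3)
      + c.c4 * (1 / 3 * (⟨a, b⟩ : ℂ) ^ 4)‖ ≤ B - 2 / 1000 by linarith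
  apply norm_le_of_parts _ _ (by linarith)
  unfold smallAt at h
  simp only at h
  have h' := (Rat.cast_le (K := ℝ)).2 h
  push_cast at h'
  have e3 : (1 / 3 : ℂ) = ((1 / 3 : ℝ) : ℂ) := by push_cast; rfl
  rw [e3]
  simp only [pow_succ, pow_zero, one_mul, Complex.add_re, Complex.mul_re, Complex.mul_im,
    Complex.add_im, Complex.ofReal_re, Complex.ofReal_im, Complex.intCast_re, Complex.intCast_im]
  refine le_trans (le_of_eq ?_) (h'.trans (le_of_eq (by ring)))
  ring

def q1 : ℚ := -2.44421078948
def q2a : ℚ := -0.776973525817050844568218477481330352294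
def q2b : ℚ := 0.184248067994978447312436598610552675631
def q3a : ℚ := 1.999078920558534312661118497636791994873
def q3b : ℚ := 2.748297697047145977578472922557883429680

lemma small_all (c : Q5 ℤ) (B : ℚ) (hB : 2 / 1000 ≤ B)
    (h1 : |c.c1| ≤ 120) (h2 : |c.c2| ≤ 8) (h3 : |c.c3| ≤ 12) (h4 : |c.c4| ≤ 12)
    (s1 : smallAt q1 0 B c) (s2 : smallAt q2a q2b B c) (s3 : smallAt q3a q3b B c) (β : Q5 ℤ)
    (hβ : |σ1 β| + 2 * ‖σ2 β‖ + 2 * ‖σ3 β‖ ≤ 57) : |(tr (β * c) : ℚ)| ≤ 57 * B := by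
  have := tr_bound β c B hβ ?_ ?_ ?_
  · have h : (|(tr (β * c) : ℚ)| : ℝ) ≤ ((57 * B : ℚ) : ℝ) := by push_cast; exact this
    exact_mod_cast h
  · have hr : ‖(⟨((q1 : ℚ) : ℝ), ((0 : ℚ) : ℝ)⟩ : ℂ) - (r1 : ℂ)‖ ≤ 1 / 10 ^ 6 := by
      have e : (⟨((q1 : ℚ) : ℝ), ((0 : ℚ) : ℝ)⟩ : ℂ) - (r1 : ℂ) = (((q1 : ℝ) - r1 : ℝ) : ℂ) := by
        apply Complex.ext <;> simp
      rw [e, Complex.norm_real, Real.norm_eq_abs]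
      have := r1_near
      rw [abs_le] at this ⊢
      unfold q1
      norm_num at this ⊢
      constructor <;> linarith
    have := small_of q1 0 B r1 hr (by norm_num [q1]) c s1 hB h1 h2 h3 h4
    rw [σ1_apply, ← Real.norm_eq_abs, ← Complex.norm_real]
    push_cast
    exact this
  · rw [σ2_apply]
    refine small_of q2a q2b B r2 ?_ (by norm_num [q2a, q2b]) c s2 hB h1 h2 h3 h4
    have := r2_near.le
    unfold q2a q2b
    push_cast
    exact this
  · rw [σ3_apply]
    refine small_of q3a q3b B r3 ?_ (by norm_num [q3a, q3b]) c s3 hB h1 h2 h3 h4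
    have := r3_near.le
    unfold q3a q3b
    push_cast
    exact this

lemma box_aux (c : Q5 ℤ) (B : ℚ) (hB : 2 / 1000 ≤ B)
    (h1 : |c.c1| ≤ 120) (h2 : |c.c2| ≤ 8) (h3 : |c.c3| ≤ 12) (h4 : |c.c4| ≤ 12)
    (s1 : smallAt q1 0 B c) (s2 : smallAt q2a q2b B c) (s3 : smallAt q3a q3b B c) (β : Q5 ℤ)
    (hβ : |σ1 β| + 2 * ‖σ2 β‖ + 2 * ‖σ3 β‖ ≤ 57) (k m : ℤ) (hk : 57 * B < 60 * (m + 1))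
    (e : tr (β * c) = 60 * k) : |k| ≤ m := by
  have := small_all c B hB h1 h2 h3 h4 s1 s2 s3 β hβ
  rw [e] at this
  have h := lt_of_le_of_lt this hk
  rw [← Int.cast_abs, abs_mul] at h
  have h' : ((|60| * |k| : ℤ) : ℚ) < ((60 * (m + 1) : ℤ) : ℚ) := by push_cast at h ⊢; exact h
  have := Int.cast_lt.1 h'
  norm_num at this
  omega

lemma box (β : Q5 ℤ) (hβ : |σ1 β| + 2 * ‖σ2 β‖ + 2 * ‖σ3 β‖ ≤ 57) (b0 b1 b2 b3 b4 : ℤ)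
    (h0 : b0 = -β.c0 + 6 * β.c3 + 12 * β.c4) (h1 : b1 = β.c1 + β.c2 - 10 * β.c4)
    (h2 : b2 = -2 * β.c2 - 2 * β.c3 - β.c4) (h3 : b3 = β.c3 + β.c4) (h4 : b4 = β.c2) :
    |b0| ≤ 11 ∧ |b1| ≤ 6 ∧ |b2| ≤ 5 ∧ |b3| ≤ 5 ∧ |b4| ≤ 4 ∧ |b0 - 4 * b1 + b2 - 3 * b3 + b4| ≤ 29 ∧
    |b1 - 2 * b3 + 2 * b4| ≤ 9 ∧ |b0 - b1 - b2 - b3 - 2 * b4| ≤ 16 ∧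
    |b0 - 2 * b1 - b2 + b3 + 6 * b4| ≤ 25 := by
  subst h0 h1 h2 h3 h4
  refine ⟨?_, ?_, ?_, ?_, ?_, ?_, ?_, ?_, ?_⟩
  · refine box_aux ⟨-12, 0, 0, 0, 0⟩ 12.5 ?_ ?_ ?_ ?_ ?_ ?_ ?_ ?_ β hβ _ _ ?_ ?_ <;>
      first | (norm_num [smallAt, q1, q2a, q2b, q3a, q3b]; done) | (simp only [tr, qmul_def]; ring)
  · refine box_aux ⟨-6, -9, -1, 1, -1⟩ 7 ?_ ?_ ?_ ?_ ?_ ?_ ?_ ?_ β hβ _ _ ?_ ?_ <;>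
      first | (norm_num [smallAt, q1, q2a, q2b, q3a, q3b]; done) | (simp only [tr, qmul_def]; ring)
  · refine box_aux ⟨-18, -19, 0, 1, -2⟩ 6 ?_ ?_ ?_ ?_ ?_ ?_ ?_ ?_ β hβ _ _ ?_ ?_ <;>
      first | (norm_num [smallAt, q1, q2a, q2b, q3a, q3b]; done) | (simp only [tr, qmul_def]; ring)
  · refine box_aux ⟨-18, -29, -1, 3, -3⟩ 6 ?_ ?_ ?_ ?_ ?_ ?_ ?_ ?_ β hβ _ _ ?_ ?_ <;>
      first | (norm_num [smallAt, q1, q2a, q2b, q3a, q3b]; done) | (simp only [tr, qmul_def]; ring)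
  · refine box_aux ⟨-18, -21, 0, 1, -2⟩ 5 ?_ ?_ ?_ ?_ ?_ ?_ ?_ ?_ β hβ _ _ ?_ ?_ <;>
      first | (norm_num [smallAt, q1, q2a, q2b, q3a, q3b]; done) | (simp only [tr, qmul_def]; ring)
  · refine box_aux ⟨30, 83, 7, -11, 9⟩ 31 ?_ ?_ ?_ ?_ ?_ ?_ ?_ ?_ β hβ _ _ ?_ ?_ <;>
      first | (norm_num [smallAt, q1, q2a, q2b, q3a, q3b]; done) | (simp only [tr, qmul_def]; ring)
  · refine box_aux ⟨-6, 7, 1, -3, 1⟩ 10.5 ?_ ?_ ?_ ?_ ?_ ?_ ?_ ?_ β hβ _ _ ?_ ?_ <;>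
      first | (norm_num [smallAt, q1, q2a, q2b, q3a, q3b]; done) | (simp only [tr, qmul_def]; ring)
  · refine box_aux ⟨66, 99, 2, -7, 10⟩ 17.8 ?_ ?_ ?_ ?_ ?_ ?_ ?_ ?_ β hβ _ _ ?_ ?_ <;>
      first | (norm_num [smallAt, q1, q2a, q2b, q3a, q3b]; done) | (simp only [tr, qmul_def]; ring)
  · refine box_aux ⟨-108, -118, 1, 6, -11⟩ 27 ?_ ?_ ?_ ?_ ?_ ?_ ?_ ?_ β hβ _ _ ?_ ?_ <;>
      first | (norm_num [smallAt, q1, q2a, q2b, q3a, q3b]; done) | (simp only [tr, qmul_def]; ring)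

end C16

end


section
namespace C16
open Q5 Module

def qf0 {R : Type} [CommSemiring R] (g0 g1 g2 g3 g4 : R) : R :=
  7 * (g0 * g0) + 4 * (g0 * g3) + 4 * (g1 * g2) + 4 * (g1 * g4) + 4 * (g2 * g2) + 4 * (g2 * g3) + 4 * (g3 * g3) + 4 * (g3 * g4) + 4 * (g4 * g4)
def qf1 {R : Type} [CommSemiring R] (g0 g1 g2 g3 g4 : R) : R :=
  3 * (g0 * g0) + 4 * (g0 * g2) + 2 * (g0 * g3) + 2 * (g0 * g4) + 2 * (g1 * g1) + 6 * (g1 * g2) + 2 * (g1 * g3) + 4 * (g1 * g4) + 7 * (g2 * g2) + 4 * (g2 * g3) + 4 * (g3 * g3) + 6 * (g3 * g4) + 3 * (g4 * g4)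
def qf2 {R : Type} [CommSemiring R] (g0 g1 g2 g3 g4 : R) : R :=
  7 * (g0 * g0) + 6 * (g0 * g2) + 4 * (g0 * g4) + 7 * (g1 * g1) + 4 * (g1 * g3) + 6 * (g2 * g2) + 6 * (g2 * g4) + 5 * (g3 * g3) + 4 * (g3 * g4) + 2 * (g4 * g4)
def qf3 {R : Type} [CommSemiring R] (g0 g1 g2 g3 g4 : R) : R :=
  1 * (g0 * g0) + 6 * (g0 * g1) + 2 * (g0 * g2) + 4 * (g0 * g4) + 1 * (g1 * g1) + 4 * (g1 * g3) + 6 * (g1 * g4) + 6 * (g2 * g2) + 6 * (g2 * g3) + 6 * (g2 * g4) + 5 * (g3 * g3) + 4 * (g3 * g4) + 4 * (g4 * g4)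
def qf4 {R : Type} [CommSemiring R] (g0 g1 g2 g3 g4 : R) : R :=
  3 * (g0 * g0) + 4 * (g0 * g3) + 6 * (g0 * g4) + 4 * (g1 * g1) + 4 * (g1 * g2) + 6 * (g1 * g3) + 4 * (g1 * g4) + 5 * (g2 * g2) + 4 * (g2 * g3) + 7 * (g4 * g4)

/-- Laplace expansion of a `5 × 5` determinant. -/
def det5 (a0 a1 a2 a3 a4 b0 b1 b2 b3 b4 c0 c1 c2 c3 c4 d0 d1 d2 d3 d4 e0 e1 e2 e3 e4 : ℤ) : ℤ :=
  (a0 * b1 - a1 * b0) * (c2 * (d3 * e4 - d4 * e3) - c3 * (d2 * e4 - d4 * e2) + c4 * (d2 * e3 - d3 * e2))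
  - (a0 * b2 - a2 * b0) * (c1 * (d3 * e4 - d4 * e3) - c3 * (d1 * e4 - d4 * e1) + c4 * (d1 * e3 - d3 * e1))
  + (a0 * b3 - a3 * b0) * (c1 * (d2 * e4 - d4 * e2) - c2 * (d1 * e4 - d4 * e1) + c4 * (d1 * e2 - d2 * e1))
  - (a0 * b4 - a4 * b0) * (c1 * (d2 * e3 - d3 * e2) - c2 * (d1 * e3 - d3 * e1) + c3 * (d1 * e2 - d2 * e1))
  + (a1 * b2 - a2 * b1) * (c0 * (d3 * e4 - d4 * e3) - c3 * (d0 * e4 - d4 * e0) + c4 * (d0 * e3 - d3 * e0))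
  - (a1 * b3 - a3 * b1) * (c0 * (d2 * e4 - d4 * e2) - c2 * (d0 * e4 - d4 * e0) + c4 * (d0 * e2 - d2 * e0))
  + (a1 * b4 - a4 * b1) * (c0 * (d2 * e3 - d3 * e2) - c2 * (d0 * e3 - d3 * e0) + c3 * (d0 * e2 - d2 * e0))
  + (a2 * b3 - a3 * b2) * (c0 * (d1 * e4 - d4 * e1) - c1 * (d0 * e4 - d4 * e0) + c4 * (d0 * e1 - d1 * e0))
  - (a2 * b4 - a4 * b2) * (c0 * (d1 * e3 - d3 * e1) - c1 * (d0 * e3 - d3 * e0) + c3 * (d0 * e1 - d1 * e0))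
  + (a3 * b4 - a4 * b3) * (c0 * (d1 * e2 - d2 * e1) - c1 * (d0 * e2 - d2 * e0) + c2 * (d0 * e1 - d1 * e0))

/-- The norm form. -/
def nrm (c0 c1 c2 c3 c4 : ℤ) : ℤ :=
  det5 (c0) (-6 * c4) (-6 * c3) (-6 * c2) (-6 * c1 + 60 * c4)
    (c1) (c0 - 15 * c4) (-15 * c3 - 6 * c4) (-15 * c2 - 2 * c3) (-15 * c1 - 6 * c2 + 150 * c4)
    (c2) (c1 - 10 * c4) (c0 - 10 * c3 - 15 * c4) (-10 * c2 - 5 * c3 - 2 * c4) (-10 * c1 - 15 * c2 - 2 * c3 + 100 * c4)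
    (c3) (3 * c2) (3 * c1 - 30 * c4) (c0 - 10 * c3 - 15 * c4) (-30 * c2 - 15 * c3 - 6 * c4)
    (c4) (c3) (3 * c2) (c1 - 10 * c4) (c0 - 10 * c3 - 15 * c4)

lemma det5_eq (M : Matrix (Fin 5) (Fin 5) ℤ) : M.det = det5 (M 0 0) (M 0 1) (M 0 2) (M 0 3) (M 0 4)
    (M 1 0) (M 1 1) (M 1 2) (M 1 3) (M 1 4) (M 2 0) (M 2 1) (M 2 2) (M 2 3) (M 2 4)
    (M 3 0) (M 3 1) (M 3 2) (M 3 3) (M 3 4) (M 4 0) (M 4 1) (M 4 2) (M 4 3) (M 4 4) := by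
  have s0 : ∀ i : Fin 4, (0 : Fin 5).succAbove i = i.succ := fun i => rfl
  simp [det5, Matrix.det_succ_row_zero, Fin.sum_univ_succ, Fin.succAbove, Matrix.submatrix]
  ring

lemma norm_eq_nrm (x : Q5 ℤ) : Algebra.norm ℤ x = nrm x.c0 x.c1 x.c2 x.c3 x.c4 := by
  rw [Algebra.norm_eq_matrix_det bas, det5_eq, nrm]
  have h : ∀ i j, Algebra.leftMulMatrix bas x i j = toFun5 (x * toFun5.symm (Pi.single j 1)) i := by
    intro i j
    rw [Algebra.leftMulMatrix_eq_repr_mul, bas_eq]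
    simp [bas]
  have s0 : toFun5.symm (Pi.single 0 1) = ⟨1, 0, 0, 0, 0⟩ := by decide
  have s1 : toFun5.symm (Pi.single 1 1) = ⟨0, 1, 0, 0, 0⟩ := by decide
  have s2 : toFun5.symm (Pi.single 2 1) = ⟨0, 0, 1, 0, 0⟩ := by decide
  have s3 : toFun5.symm (Pi.single 3 1) = ⟨0, 0, 0, 1, 0⟩ := by decide
  have s4 : toFun5.symm (Pi.single 4 1) = ⟨0, 0, 0, 0, 1⟩ := by decide
  have t0 : ∀ z, toFun5 z 0 = z.c0 := fun _ => rfl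
  have t1 : ∀ z, toFun5 z 1 = z.c1 := fun _ => rfl
  have t2 : ∀ z, toFun5 z 2 = z.c2 := fun _ => rfl
  have t3 : ∀ z, toFun5 z 3 = z.c3 := fun _ => rfl
  have t4 : ∀ z, toFun5 z 4 = z.c4 := fun _ => rfl
  simp only [h, s0, s1, s2, s3, s4, t0, t1, t2, t3, t4]
  congr 1 <;> simp only [qmul_def] <;> ring


/-- Evaluation helper, forcing its argument. -/
def fn (n : ℕ) (k : ℕ → Bool) : Bool := match n with
  | 0 => k 0
  | m + 1 => k (m + 1)
lemma fn_eq (n : ℕ) (k : ℕ → Bool) : fn n k = k n := by cases n <;> rfl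
/-- Evaluation helper, forcing its argument. -/
def fz (x : ℤ) (k : ℤ → Bool) : Bool := match x with
  | Int.ofNat n => fn n fun n => k (Int.ofNat n)
  | Int.negSucc n => fn n fun n => k (Int.negSucc n)
lemma fz_eq (x : ℤ) (k : ℤ → Bool) : fz x k = k x := by
  cases x <;> simp only [fz, fn_eq]

def isqr (n : ℕ) : ℕ := [4096, 2048, 1024, 512, 256, 128, 64, 32, 16, 8, 4, 2, 1].foldl
  (fun s k => bif Nat.ble ((s + k) * (s + k)) n then s + k else s) 0

def nonsq : ℤ → Bool
  | Int.negSucc _ => true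
  | Int.ofNat n => fn n fun n => fn (isqr n) fun s => Nat.blt (s * s) n && Nat.blt n ((s + 1) * (s + 1))

lemma nonsq_sound (N : ℤ) (h : nonsq N = true) : ¬ IsSquare N := by
  rintro ⟨k, hk⟩
  rcases N with n | n
  · simp only [nonsq, fn_eq, Bool.and_eq_true, Nat.blt_eq] at h
    have hn : n = k.natAbs * k.natAbs := by
      have := congrArg Int.natAbs hk
      rw [Int.natAbs_mul] at this
      simpa using this
    rw [hn] at h
    obtain ⟨h1, h2⟩ := h
    have a1 := lt_of_mul_self_lt_mul_self₀ (Nat.zero_le _) h1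
    have a2 := lt_of_mul_self_lt_mul_self₀ (Nat.zero_le _) h2
    rw [← hn] at a1 a2
    omega
  · have := mul_self_nonneg k
    rw [← hk] at this
    simp at this

def nsqK (x0 x1 x2 x3 x4 : ℤ) : Bool :=
  fz x0 fun c0 => fz x1 fun c1 => fz x2 fun c2 => fz x3 fun c3 => fz x4 fun c4 =>
  fz (-6 * c4) fun m01 =>
  fz (-6 * c3) fun m02 =>
  fz (-6 * c2) fun m03 =>
  fz (-6 * c1 + 60 * c4) fun m04 =>
  fz (c0 - 15 * c4) fun m11 =>
  fz (-15 * c3 - 6 * c4) fun m12 =>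
  fz (-15 * c2 - 2 * c3) fun m13 =>
  fz (-15 * c1 - 6 * c2 + 150 * c4) fun m14 =>
  fz (c1 - 10 * c4) fun m21 =>
  fz (c0 - 10 * c3 - 15 * c4) fun m22 =>
  fz (-10 * c2 - 5 * c3 - 2 * c4) fun m23 =>
  fz (-10 * c1 - 15 * c2 - 2 * c3 + 100 * c4) fun m24 =>
  fz (3 * c2) fun m31 =>
  fz (3 * c1 - 30 * c4) fun m32 =>
  fz (c0 - 10 * c3 - 15 * c4) fun m33 =>
  fz (-30 * c2 - 15 * c3 - 6 * c4) fun m34 =>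
  fz (c3) fun m41 =>
  fz (3 * c2) fun m42 =>
  fz (c1 - 10 * c4) fun m43 =>
  fz (c0 - 10 * c3 - 15 * c4) fun m44 =>
  nonsq (det5 c0 m01 m02 m03 m04 c1 m11 m12 m13 m14 c2 m21 m22 m23 m24 c3 m31 m32 m33 m34 c4 m41 m42 m43 m44)
lemma nsqK_eq (x0 x1 x2 x3 x4 : ℤ) : nsqK x0 x1 x2 x3 x4 = nonsq (nrm x0 x1 x2 x3 x4) := by
  simp only [nsqK, nrm, fz_eq]
  

def okb (b0 b1 b2 b3 b4 : ℤ) : Bool :=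
  !(Nat.ble (b0 - 4 * b1 + b2 - 3 * b3 + b4).natAbs 29) ||
  (!(Nat.ble (b1 - 2 * b3 + 2 * b4).natAbs 9) ||
  (!(Nat.ble (b0 - b1 - b2 - b3 - 2 * b4).natAbs 16) ||
  (!(Nat.ble (b0 - 2 * b1 - b2 + b3 + 6 * b4).natAbs 25) ||
  (nsqK (-b0 + 6 * b2 + 18 * b3 + 12 * b4) (b1 + 10 * b2 + 20 * b3 + 19 * b4) b4
      (-b2 - b3 - 2 * b4) (b2 + 2 * b3 + 2 * b4) ||
  (decide (b1 = 0 ∧ b4 = 0 ∧ ((b0 = 0 ∧ b2 = 0 ∧ b3 = 0) ∨ (b0 = -4 ∧ b2 = 0 ∧ b3 = 0) ∨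
    (b0 = 3 ∧ b2 = 1 ∧ b3 = -3)) ∨ (b0 = -1 ∧ b1 = -2 ∧ b2 = 2 ∧ b3 = 0 ∧ b4 = 0)))))))

def lift11 (r : ℕ) : List ℤ := match r with
  | 0 => [Int.negSucc 7, Int.ofNat 0, Int.ofNat 8]
  | 1 => [Int.negSucc 6, Int.ofNat 1, Int.ofNat 9]
  | 2 => [Int.negSucc 5, Int.ofNat 2, Int.ofNat 10]
  | 3 => [Int.negSucc 4, Int.ofNat 3, Int.ofNat 11]
  | 4 => [Int.negSucc 3, Int.ofNat 4]
  | 5 => [Int.negSucc 10, Int.negSucc 2, Int.ofNat 5]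
  | 6 => [Int.negSucc 9, Int.negSucc 1, Int.ofNat 6]
  | 7 => [Int.negSucc 8, Int.negSucc 0, Int.ofNat 7]
  | _ => []
lemma mem_lift11 (r : ℕ) (x : ℤ) (hx : |x| ≤ 11) (h : x % 8 = (r : ℤ) % 8) :
    x ∈ lift11 (r % 8) := by
  rw [abs_le] at hx
  obtain ⟨h1, h2⟩ := hx
  have h3 : r % 8 = (x % 8).toNat := by omega
  rw [h3]
  interval_cases x <;> decide

def lift6 (r : ℕ) : List ℤ := match r with
  | 0 => [Int.ofNat 0]
  | 1 => [Int.ofNat 1]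
  | 2 => [Int.negSucc 5, Int.ofNat 2]
  | 3 => [Int.negSucc 4, Int.ofNat 3]
  | 4 => [Int.negSucc 3, Int.ofNat 4]
  | 5 => [Int.negSucc 2, Int.ofNat 5]
  | 6 => [Int.negSucc 1, Int.ofNat 6]
  | 7 => [Int.negSucc 0]
  | _ => []
lemma mem_lift6 (r : ℕ) (x : ℤ) (hx : |x| ≤ 6) (h : x % 8 = (r : ℤ) % 8) :
    x ∈ lift6 (r % 8) := by
  rw [abs_le] at hx
  obtain ⟨h1, h2⟩ := hx
  have h3 : r % 8 = (x % 8).toNat := by omega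
  rw [h3]
  interval_cases x <;> decide

def lift5 (r : ℕ) : List ℤ := match r with
  | 0 => [Int.ofNat 0]
  | 1 => [Int.ofNat 1]
  | 2 => [Int.ofNat 2]
  | 3 => [Int.negSucc 4, Int.ofNat 3]
  | 4 => [Int.negSucc 3, Int.ofNat 4]
  | 5 => [Int.negSucc 2, Int.ofNat 5]
  | 6 => [Int.negSucc 1]
  | 7 => [Int.negSucc 0]
  | _ => []
lemma mem_lift5 (r : ℕ) (x : ℤ) (hx : |x| ≤ 5) (h : x % 8 = (r : ℤ) % 8) :
    x ∈ lift5 (r % 8) := by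
  rw [abs_le] at hx
  obtain ⟨h1, h2⟩ := hx
  have h3 : r % 8 = (x % 8).toNat := by omega
  rw [h3]
  interval_cases x <;> decide

def lift4 (r : ℕ) : List ℤ := match r with
  | 0 => [Int.ofNat 0]
  | 1 => [Int.ofNat 1]
  | 2 => [Int.ofNat 2]
  | 3 => [Int.ofNat 3]
  | 4 => [Int.negSucc 3, Int.ofNat 4]
  | 5 => [Int.negSucc 2]
  | 6 => [Int.negSucc 1]
  | 7 => [Int.negSucc 0]
  | _ => []
lemma mem_lift4 (r : ℕ) (x : ℤ) (hx : |x| ≤ 4) (h : x % 8 = (r : ℤ) % 8) :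
    x ∈ lift4 (r % 8) := by
  rw [abs_le] at hx
  obtain ⟨h1, h2⟩ := hx
  have h3 : r % 8 = (x % 8).toNat := by omega
  rw [h3]
  interval_cases x <;> decide

def chk1 (r0 r1 r2 r3 r4 : ℕ) : Bool :=
  (lift11 r0).all fun b0 => (lift6 r1).all fun b1 => (lift5 r2).all fun b2 =>
    (lift5 r3).all fun b3 => (lift4 r4).all fun b4 => okb b0 b1 b2 b3 b4

def l4 : List ℕ := [0, 1, 2, 3]

def chk : Bool := l4.all fun g0 => l4.all fun g1 => l4.all fun g2 => l4.all fun g3 => l4.all fun g4 =>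
  chk1 (qf0 g0 g1 g2 g3 g4 % 8) (qf1 g0 g1 g2 g3 g4 % 8) (qf2 g0 g1 g2 g3 g4 % 8)
    (qf3 g0 g1 g2 g3 g4 % 8) (qf4 g0 g1 g2 g3 g4 % 8)

set_option maxRecDepth 100000 in
lemma chk_true : chk = true := by decide +kernel

end C16

end


section
namespace C16
open Q5 Module

lemma qf0_shift (g0 g1 g2 g3 g4 k0 k1 k2 k3 k4 : ℤ) :
    qf0 (g0 + 4 * k0) (g1 + 4 * k1) (g2 + 4 * k2) (g3 + 4 * k3) (g4 + 4 * k4) = qf0 g0 g1 g2 g3 g4 +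
      8 * (7 * (g0 * k0) + 2 * (g0 * k3 + g3 * k0) + 2 * (g1 * k2 + g2 * k1) + 2 * (g1 * k4 + g4 * k1) + 4 * (g2 * k2) + 2 * (g2 * k3 + g3 * k2) + 4 * (g3 * k3) + 2 * (g3 * k4 + g4 * k3) + 4 * (g4 * k4) + 2 * qf0 k0 k1 k2 k3 k4) := by
  simp only [qf0]; ring
lemma qf0_res (β g e : Q5 ℤ) (h : β = ⟨1, 6, 3, 2, 7⟩ * g ^ 2 + 8 * e) (n0 n1 n2 n3 n4 : ℕ) (k0 k1 k2 k3 k4 : ℤ)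
    (h0 : g.c0 = n0 + 4 * k0) (h1 : g.c1 = n1 + 4 * k1) (h2 : g.c2 = n2 + 4 * k2)
    (h3 : g.c3 = n3 + 4 * k3) (h4 : g.c4 = n4 + 4 * k4) :
    (-β.c0 + 6 * β.c3 + 12 * β.c4) % 8 = ((qf0 n0 n1 n2 n3 n4 : ℕ) : ℤ) % 8 := by
  have hc : ((qf0 n0 n1 n2 n3 n4 : ℕ) : ℤ) = qf0 (n0 : ℤ) n1 n2 n3 n4 := by
    simp only [qf0]; push_cast; rfl
  have hs := qf0_shift n0 n1 n2 n3 n4 k0 k1 k2 k3 k4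
  rw [← h0, ← h1, ← h2, ← h3, ← h4] at hs
  have hb : -β.c0 + 6 * β.c3 + 12 * β.c4 = qf0 g.c0 g.c1 g.c2 g.c3 g.c4 + 8 * ((11) * (g.c0 * g.c0) + (30) * (g.c0 * g.c1) + (-258) * (g.c0 * g.c2) + (-374) * (g.c0 * g.c3) + (-711) * (g.c0 * g.c4) + (-129) * (g.c1 * g.c1) + (-1121) * (g.c1 * g.c2) + (-711) * (g.c1 * g.c3) + (1987) * (g.c1 * g.c4) + (-1067) * (g.c2 * g.c2) + (1987) * (g.c2 * g.c3) + (14895) * (g.c2 * g.c4) + (2482) * (g.c3 * g.c3) + (13228) * (g.c3 * g.c4) + (-3485) * (g.c4 * g.c4) + (-e.c0 + 6 * e.c3 + 12 * e.c4)) := by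
    rw [h, ofNat_def]
    simp only [add_def, qmul_def, sq, qf0]
    ring
  rw [hc, hb, hs]
  omega

lemma qf1_shift (g0 g1 g2 g3 g4 k0 k1 k2 k3 k4 : ℤ) :
    qf1 (g0 + 4 * k0) (g1 + 4 * k1) (g2 + 4 * k2) (g3 + 4 * k3) (g4 + 4 * k4) = qf1 g0 g1 g2 g3 g4 +
      8 * (3 * (g0 * k0) + 2 * (g0 * k2 + g2 * k0) + 1 * (g0 * k3 + g3 * k0) + 1 * (g0 * k4 + g4 * k0) + 2 * (g1 * k1) + 3 * (g1 * k2 + g2 * k1) + 1 * (g1 * k3 + g3 * k1) + 2 * (g1 * k4 + g4 * k1) + 7 * (g2 * k2) + 2 * (g2 * k3 + g3 * k2) + 4 * (g3 * k3) + 3 * (g3 * k4 + g4 * k3) + 3 * (g4 * k4) + 2 * qf1 k0 k1 k2 k3 k4) := by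
  simp only [qf1]; ring
lemma qf1_res (β g e : Q5 ℤ) (h : β = ⟨1, 6, 3, 2, 7⟩ * g ^ 2 + 8 * e) (n0 n1 n2 n3 n4 : ℕ) (k0 k1 k2 k3 k4 : ℤ)
    (h0 : g.c0 = n0 + 4 * k0) (h1 : g.c1 = n1 + 4 * k1) (h2 : g.c2 = n2 + 4 * k2)
    (h3 : g.c3 = n3 + 4 * k3) (h4 : g.c4 = n4 + 4 * k4) :
    (β.c1 + β.c2 - 10 * β.c4) % 8 = ((qf1 n0 n1 n2 n3 n4 : ℕ) : ℤ) % 8 := by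
  have hc : ((qf1 n0 n1 n2 n3 n4 : ℕ) : ℤ) = qf1 (n0 : ℤ) n1 n2 n3 n4 := by
    simp only [qf1]; push_cast; rfl
  have hs := qf1_shift n0 n1 n2 n3 n4 k0 k1 k2 k3 k4
  rw [← h0, ← h1, ← h2, ← h3, ← h4] at hs
  have hb : β.c1 + β.c2 - 10 * β.c4 = qf1 g.c0 g.c1 g.c2 g.c3 g.c4 + 8 * ((-8) * (g.c0 * g.c0) + (-47) * (g.c0 * g.c1) + (-72) * (g.c0 * g.c2) + (134) * (g.c0 * g.c3) + (693) * (g.c0 * g.c4) + (-36) * (g.c1 * g.c1) + (402) * (g.c1 * g.c2) + (693) * (g.c1 * g.c3) + (1511) * (g.c1 * g.c4) + (1039) * (g.c2 * g.c2) + (1511) * (g.c2 * g.c3) + (-2673) * (g.c2 * g.c4) + (-446) * (g.c3 * g.c3) + (-8804) * (g.c3 * g.c4) + (-13160) * (g.c4 * g.c4) + (e.c1 + e.c2 - 10 * e.c4)) := by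
    rw [h, ofNat_def]
    simp only [add_def, qmul_def, sq, qf1]
    ring
  rw [hc, hb, hs]
  omega

lemma qf2_shift (g0 g1 g2 g3 g4 k0 k1 k2 k3 k4 : ℤ) :
    qf2 (g0 + 4 * k0) (g1 + 4 * k1) (g2 + 4 * k2) (g3 + 4 * k3) (g4 + 4 * k4) = qf2 g0 g1 g2 g3 g4 +
      8 * (7 * (g0 * k0) + 3 * (g0 * k2 + g2 * k0) + 2 * (g0 * k4 + g4 * k0) + 7 * (g1 * k1) + 2 * (g1 * k3 + g3 * k1) + 6 * (g2 * k2) + 3 * (g2 * k4 + g4 * k2) + 5 * (g3 * k3) + 2 * (g3 * k4 + g4 * k3) + 2 * (g4 * k4) + 2 * qf2 k0 k1 k2 k3 k4) := by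
  simp only [qf2]; ring
lemma qf2_res (β g e : Q5 ℤ) (h : β = ⟨1, 6, 3, 2, 7⟩ * g ^ 2 + 8 * e) (n0 n1 n2 n3 n4 : ℕ) (k0 k1 k2 k3 k4 : ℤ)
    (h0 : g.c0 = n0 + 4 * k0) (h1 : g.c1 = n1 + 4 * k1) (h2 : g.c2 = n2 + 4 * k2)
    (h3 : g.c3 = n3 + 4 * k3) (h4 : g.c4 = n4 + 4 * k4) :
    (-2 * β.c2 - 2 * β.c3 - β.c4) % 8 = ((qf2 n0 n1 n2 n3 n4 : ℕ) : ℤ) % 8 := by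
  have hc : ((qf2 n0 n1 n2 n3 n4 : ℕ) : ℤ) = qf2 (n0 : ℤ) n1 n2 n3 n4 := by
    simp only [qf2]; push_cast; rfl
  have hs := qf2_shift n0 n1 n2 n3 n4 k0 k1 k2 k3 k4
  rw [← h0, ← h1, ← h2, ← h3, ← h4] at hs
  have hb : -2 * β.c2 - 2 * β.c3 - β.c4 = qf2 g.c0 g.c1 g.c2 g.c3 g.c4 + 8 * ((-3) * (g.c0 * g.c0) + (27) * (g.c0 * g.c1) + (155) * (g.c0 * g.c2) + (105) * (g.c0 * g.c3) + (-184) * (g.c0 * g.c4) + (77) * (g.c1 * g.c1) + (315) * (g.c1 * g.c2) + (-184) * (g.c1 * g.c3) + (-1937) * (g.c1 * g.c4) + (-276) * (g.c2 * g.c2) + (-1937) * (g.c2 * g.c3) + (-5649) * (g.c2 * g.c4) + (-942) * (g.c3 * g.c3) + (-52) * (g.c3 * g.c4) + (10746) * (g.c4 * g.c4) + (-2 * e.c2 - 2 * e.c3 - e.c4)) := by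
    rw [h, ofNat_def]
    simp only [add_def, qmul_def, sq, qf2]
    ring
  rw [hc, hb, hs]
  omega

lemma qf3_shift (g0 g1 g2 g3 g4 k0 k1 k2 k3 k4 : ℤ) :
    qf3 (g0 + 4 * k0) (g1 + 4 * k1) (g2 + 4 * k2) (g3 + 4 * k3) (g4 + 4 * k4) = qf3 g0 g1 g2 g3 g4 +
      8 * (1 * (g0 * k0) + 3 * (g0 * k1 + g1 * k0) + 1 * (g0 * k2 + g2 * k0) + 2 * (g0 * k4 + g4 * k0) + 1 * (g1 * k1) + 2 * (g1 * k3 + g3 * k1) + 3 * (g1 * k4 + g4 * k1) + 6 * (g2 * k2) + 3 * (g2 * k3 + g3 * k2) + 3 * (g2 * k4 + g4 * k2) + 5 * (g3 * k3) + 2 * (g3 * k4 + g4 * k3) + 4 * (g4 * k4) + 2 * qf3 k0 k1 k2 k3 k4) := by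
  simp only [qf3]; ring
lemma qf3_res (β g e : Q5 ℤ) (h : β = ⟨1, 6, 3, 2, 7⟩ * g ^ 2 + 8 * e) (n0 n1 n2 n3 n4 : ℕ) (k0 k1 k2 k3 k4 : ℤ)
    (h0 : g.c0 = n0 + 4 * k0) (h1 : g.c1 = n1 + 4 * k1) (h2 : g.c2 = n2 + 4 * k2)
    (h3 : g.c3 = n3 + 4 * k3) (h4 : g.c4 = n4 + 4 * k4) :
    (β.c3 + β.c4) % 8 = ((qf3 n0 n1 n2 n3 n4 : ℕ) : ℤ) % 8 := by
  have hc : ((qf3 n0 n1 n2 n3 n4 : ℕ) : ℤ) = qf3 (n0 : ℤ) n1 n2 n3 n4 := by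
    simp only [qf3]; push_cast; rfl
  have hs := qf3_shift n0 n1 n2 n3 n4 k0 k1 k2 k3 k4
  rw [← h0, ← h1, ← h2, ← h3, ← h4] at hs
  have hb : β.c3 + β.c4 = qf3 g.c0 g.c1 g.c2 g.c3 g.c4 + 8 * ((1) * (g.c0 * g.c0) + (2) * (g.c0 * g.c1) + (-46) * (g.c0 * g.c2) + (-47) * (g.c0 * g.c3) + (-72) * (g.c0 * g.c4) + (-23) * (g.c1 * g.c1) + (-141) * (g.c1 * g.c2) + (-72) * (g.c1 * g.c3) + (402) * (g.c1 * g.c4) + (-108) * (g.c2 * g.c2) + (402) * (g.c2 * g.c3) + (2079) * (g.c2 * g.c4) + (346) * (g.c3 * g.c3) + (1511) * (g.c3 * g.c4) + (-1337) * (g.c4 * g.c4) + (e.c3 + e.c4)) := by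
    rw [h, ofNat_def]
    simp only [add_def, qmul_def, sq, qf3]
    ring
  rw [hc, hb, hs]
  omega

lemma qf4_shift (g0 g1 g2 g3 g4 k0 k1 k2 k3 k4 : ℤ) :
    qf4 (g0 + 4 * k0) (g1 + 4 * k1) (g2 + 4 * k2) (g3 + 4 * k3) (g4 + 4 * k4) = qf4 g0 g1 g2 g3 g4 +
      8 * (3 * (g0 * k0) + 2 * (g0 * k3 + g3 * k0) + 3 * (g0 * k4 + g4 * k0) + 4 * (g1 * k1) + 2 * (g1 * k2 + g2 * k1) + 3 * (g1 * k3 + g3 * k1) + 2 * (g1 * k4 + g4 * k1) + 5 * (g2 * k2) + 2 * (g2 * k3 + g3 * k2) + 7 * (g4 * k4) + 2 * qf4 k0 k1 k2 k3 k4) := by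
  simp only [qf4]; ring
lemma qf4_res (β g e : Q5 ℤ) (h : β = ⟨1, 6, 3, 2, 7⟩ * g ^ 2 + 8 * e) (n0 n1 n2 n3 n4 : ℕ) (k0 k1 k2 k3 k4 : ℤ)
    (h0 : g.c0 = n0 + 4 * k0) (h1 : g.c1 = n1 + 4 * k1) (h2 : g.c2 = n2 + 4 * k2)
    (h3 : g.c3 = n3 + 4 * k3) (h4 : g.c4 = n4 + 4 * k4) :
    (β.c2) % 8 = ((qf4 n0 n1 n2 n3 n4 : ℕ) : ℤ) % 8 := by
  have hc : ((qf4 n0 n1 n2 n3 n4 : ℕ) : ℤ) = qf4 (n0 : ℤ) n1 n2 n3 n4 := by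
    simp only [qf4]; push_cast; rfl
  have hs := qf4_shift n0 n1 n2 n3 n4 k0 k1 k2 k3 k4
  rw [← h0, ← h1, ← h2, ← h3, ← h4] at hs
  have hb : β.c2 = qf4 g.c0 g.c1 g.c2 g.c3 g.c4 + 8 * ((-16) * (g.c0 * g.c1) + (-31) * (g.c0 * g.c2) + (-14) * (g.c0 * g.c3) + (147) * (g.c0 * g.c4) + (-16) * (g.c1 * g.c1) + (-41) * (g.c1 * g.c2) + (147) * (g.c1 * g.c3) + (545) * (g.c1 * g.c4) + (221) * (g.c2 * g.c2) + (545) * (g.c2 * g.c3) + (966) * (g.c2 * g.c4) + (161) * (g.c3 * g.c3) + (-1213) * (g.c3 * g.c4) + (-3796) * (g.c4 * g.c4) + (e.c2)) := by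
    rw [h, ofNat_def]
    simp only [add_def, qmul_def, sq, qf4]
    ring
  rw [hc, hb, hs]
  omega


lemma chk_spec (n0 n1 n2 n3 n4 : ℕ) (h0 : n0 < 4) (h1 : n1 < 4) (h2 : n2 < 4) (h3 : n3 < 4) (h4 : n4 < 4)
    (b0 b1 b2 b3 b4 : ℤ) (a0 : |b0| ≤ 11) (a1 : |b1| ≤ 6) (a2 : |b2| ≤ 5) (a3 : |b3| ≤ 5) (a4 : |b4| ≤ 4)
    (e0 : b0 % 8 = ((qf0 n0 n1 n2 n3 n4 : ℕ) : ℤ) % 8) (e1 : b1 % 8 = ((qf1 n0 n1 n2 n3 n4 : ℕ) : ℤ) % 8)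
    (e2 : b2 % 8 = ((qf2 n0 n1 n2 n3 n4 : ℕ) : ℤ) % 8) (e3 : b3 % 8 = ((qf3 n0 n1 n2 n3 n4 : ℕ) : ℤ) % 8)
    (e4 : b4 % 8 = ((qf4 n0 n1 n2 n3 n4 : ℕ) : ℤ) % 8) : okb b0 b1 b2 b3 b4 = true := by
  have ml : ∀ n, n < 4 → n ∈ l4 := by intro n hn; interval_cases n <;> decide
  have h := chk_true
  simp only [chk, List.all_eq_true] at h
  have h' := h n0 (ml _ h0) n1 (ml _ h1) n2 (ml _ h2) n3 (ml _ h3) n4 (ml _ h4)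
  simp only [chk1, List.all_eq_true] at h'
  exact h' b0 (mem_lift11 _ _ a0 e0) b1 (mem_lift6 _ _ a1 e1) b2 (mem_lift5 _ _ a2 e2)
    b3 (mem_lift5 _ _ a3 e3) b4 (mem_lift4 _ _ a4 e4)

lemma finite_beta (β g e : Q5 ℤ) (h : β = ⟨1, 6, 3, 2, 7⟩ * g ^ 2 + 8 * e) (h0 : β ≠ 0)
    (hβ : |σ1 β| + 2 * ‖σ2 β‖ + 2 * ‖σ3 β‖ ≤ 57) (hsq : IsSquare (Algebra.norm ℤ β)) :
    β = ⟨4, 0, 0, 0, 0⟩ ∨ β = ⟨-51, -50, 0, 2, -5⟩ ∨ β = ⟨13, 18, 0, -2, 2⟩ := by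
  have hg : ∀ c : ℤ, ∃ n : ℕ, n < 4 ∧ ∃ k : ℤ, c = n + 4 * k := fun c =>
    ⟨(c % 4).toNat, by omega, c / 4, by omega⟩
  obtain ⟨n0, l0, k0, g0⟩ := hg g.c0
  obtain ⟨n1, l1, k1, g1⟩ := hg g.c1
  obtain ⟨n2, l2, k2, g2⟩ := hg g.c2
  obtain ⟨n3, l3, k3, g3⟩ := hg g.c3
  obtain ⟨n4, l4, k4, g4⟩ := hg g.c4
  have r0 := qf0_res β g e h _ _ _ _ _ _ _ _ _ _ g0 g1 g2 g3 g4
  have r1 := qf1_res β g e h _ _ _ _ _ _ _ _ _ _ g0 g1 g2 g3 g4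
  have r2 := qf2_res β g e h _ _ _ _ _ _ _ _ _ _ g0 g1 g2 g3 g4
  have r3 := qf3_res β g e h _ _ _ _ _ _ _ _ _ _ g0 g1 g2 g3 g4
  have r4 := qf4_res β g e h _ _ _ _ _ _ _ _ _ _ g0 g1 g2 g3 g4
  generalize hb0 : -β.c0 + 6 * β.c3 + 12 * β.c4 = b0 at r0
  generalize hb1 : β.c1 + β.c2 - 10 * β.c4 = b1 at r1
  generalize hb2 : -2 * β.c2 - 2 * β.c3 - β.c4 = b2 at r2
  generalize hb3 : β.c3 + β.c4 = b3 at r3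
  generalize hb4 : β.c2 = b4 at r4
  obtain ⟨a0, a1, a2, a3, a4, f1, f2, f3, f4⟩ := box β hβ b0 b1 b2 b3 b4 hb0.symm hb1.symm hb2.symm
    hb3.symm hb4.symm
  have hok := chk_spec n0 n1 n2 n3 n4 l0 l1 l2 l3 l4 b0 b1 b2 b3 b4 a0 a1 a2 a3 a4 r0 r1 r2 r3 r4
  have toN : ∀ (x : ℤ) (B : ℕ), |x| ≤ B → Nat.ble x.natAbs B = true := by
    intro x B hx; rw [Nat.ble_eq]; rw [abs_le] at hx; omega
  have w0 : -b0 + 6 * b2 + 18 * b3 + 12 * b4 = β.c0 := by omega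
  have w1 : b1 + 10 * b2 + 20 * b3 + 19 * b4 = β.c1 := by omega
  have w3 : -b2 - b3 - 2 * b4 = β.c3 := by omega
  have w4 : b2 + 2 * b3 + 2 * b4 = β.c4 := by omega
  have hns : nsqK (-b0 + 6 * b2 + 18 * b3 + 12 * b4) (b1 + 10 * b2 + 20 * b3 + 19 * b4) b4
      (-b2 - b3 - 2 * b4) (b2 + 2 * b3 + 2 * b4) = false := by
    rw [nsqK_eq, w0, w1, w3, w4, ← hb4, ← norm_eq_nrm]
    by_contra hne
    exact nonsq_sound _ (by simpa using hne) hsq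
  rw [okb, toN _ 29 f1, toN _ 9 f2, toN _ 16 f3, toN _ 25 f4, hns] at hok
  simp only [Bool.not_true, Bool.false_or, decide_eq_true_eq] at hok
  rcases hok with ⟨p1, p4, (⟨p0, p2, p3⟩ | ⟨p0, p2, p3⟩ | ⟨p0, p2, p3⟩)⟩ | ⟨p0, p1, p2, p3, p4⟩
  · exfalso; apply h0; ext <;> simp only [zero_def] <;> omega
  · left; ext <;> simp only <;> omega
  · right; left; ext <;> simp only <;> omega
  · right; right; ext <;> simp only <;> omega

end C16

end


section
namespace C16
open Q5

/-- Reduction modulo the degree two prime `(17, θ² - 4θ + 1)`: constant coordinate. -/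
def p0 (x : Q5 ℤ) : ℤ := x.c0 - x.c2 - 7 * x.c3 - 5 * x.c4
/-- Reduction modulo the degree two prime `(17, θ² - 4θ + 1)`: linear coordinate. -/
def p1 (x : Q5 ℤ) : ℤ := x.c1 + 4 * x.c2 + 5 * x.c3 - 4 * x.c4

lemma p0_mul (x y : Q5 ℤ) : ((p0 (x * y) : ℤ) : ZMod 17) = (p0 x : ZMod 17) * p0 y - p1 x * p1 y := by
  have h : p0 (x * y) = p0 x * p0 y - p1 x * p1 y + 17 * (-1 * (x.c1 * y.c2) + -1 * (x.c2 * y.c1) + 1 * (x.c2 * y.c3) + 12 * (x.c2 * y.c4) + 1 * (x.c3 * y.c2) + 3 * (x.c3 * y.c3) + 6 * (x.c3 * y.c4) + 12 * (x.c4 * y.c2) + 6 * (x.c4 * y.c3) + 4 * (x.c4 * y.c4)) := by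
    simp only [p0, p1, qmul_def]; ring
  rw [h, Int.cast_add, Int.cast_mul (17 : ℤ)]
  rw [show (((17 : ℤ) : ZMod 17)) = 0 from by decide]
  push_cast; ring

lemma p1_mul (x y : Q5 ℤ) : ((p1 (x * y) : ℤ) : ZMod 17) =
    (p0 x : ZMod 17) * p1 y + p1 x * p0 y + 4 * (p1 x * p1 y) := by
  have h : p1 (x * y) = p0 x * p1 y + p1 x * p0 y + 4 * (p1 x * p1 y) + 17 * (-1 * (x.c1 * y.c3) + -2 * (x.c1 * y.c4) + -4 * (x.c2 * y.c2) + -6 * (x.c2 * y.c3) + -8 * (x.c2 * y.c4) + -1 * (x.c3 * y.c1) + -6 * (x.c3 * y.c2) + -6 * (x.c3 * y.c3) + 2 * (x.c3 * y.c4) + -2 * (x.c4 * y.c1) + -8 * (x.c4 * y.c2) + 2 * (x.c4 * y.c3) + 28 * (x.c4 * y.c4)) := by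
    simp only [p0, p1, qmul_def]; ring
  rw [h, Int.cast_add, Int.cast_mul (17 : ℤ)]
  rw [show (((17 : ℤ) : ZMod 17)) = 0 from by decide]
  push_cast; ring

lemma kill3 (α γ : Q5 ℤ) (h : α * ⟨13, 18, 0, -2, 2⟩ = γ ^ 2)
    (hα : ¬ (((p0 α : ℤ) : ZMod 17) = 0 ∧ ((p1 α : ℤ) : ZMod 17) = 0)) : False := by
  set β : Q5 ℤ := ⟨13, 18, 0, -2, 2⟩ with hβ
  set c : Q5 ℤ := ⟨1, 15, 4, 3, 0⟩ with hc
  set μ : Q5 ℤ := ⟨-7, -9, 0, -1, -2⟩ with hμ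
  have hcβ : c * β = 17 * μ := by
    rw [hc, hβ, hμ, ofNat_def]; simp only [qmul_def]; ext <;> norm_num
  have b0 : ((p0 β : ℤ) : ZMod 17) = 0 := by decide
  have b1 : ((p1 β : ℤ) : ZMod 17) = 0 := by decide
  have h0 := congrArg (fun z => ((p0 z : ℤ) : ZMod 17)) h
  have h1 := congrArg (fun z => ((p1 z : ℤ) : ZMod 17)) h
  simp only [sq, p0_mul, p1_mul, b0, b1] at h0 h1
  have key : ∀ a b : ZMod 17, a * 0 - b * 0 = 0 → ∀ p q : ZMod 17,
      (0 = p * p - q * q) → (0 = p * q + q * p + 4 * (q * q)) → p = 0 ∧ q = 0 := by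
    intro a b _; decide
  obtain ⟨g0, g1⟩ := key 0 0 (by simp) _ _ (by simpa using h0) (by simpa using h1)
  rw [ZMod.intCast_zmod_eq_zero_iff_dvd] at g0 g1
  have hdiv : ∃ δ : Q5 ℤ, c * γ = 17 * δ := by
    have e : ∀ z : Q5 ℤ, (∃ k0, z.c0 = 17 * k0) → (∃ k0, z.c1 = 17 * k0) → (∃ k0, z.c2 = 17 * k0) →
        (∃ k0, z.c3 = 17 * k0) → (∃ k0, z.c4 = 17 * k0) → ∃ δ : Q5 ℤ, z = 17 * δ := by
      rintro z ⟨k0, e0⟩ ⟨k1, e1⟩ ⟨k2, e2⟩ ⟨k3, e3⟩ ⟨k4, e4⟩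
      refine ⟨⟨k0, k1, k2, k3, k4⟩, ?_⟩
      rw [ofNat_def]; simp only [qmul_def]; ext <;> simp only [e0, e1, e2, e3, e4] <;> push_cast <;> ring
    obtain ⟨a, ha⟩ := g0
    obtain ⟨b, hb⟩ := g1
    simp only [p0, p1, Nat.cast_ofNat] at ha hb
    have d : ∀ n : ℤ, 17 ∣ n → ∃ k, n = 17 * k := fun n h => h
    apply e <;> simp only [hc, qmul_def] <;> apply d <;> omega
  obtain ⟨δ, hδ⟩ := hdiv
  have h17 : (17 : Q5 ℤ) * δ ^ 2 = c * μ * α := by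
    apply intCast_mul_inj (y := 17) (by norm_num)
    push_cast
    linear_combination (-(c * γ + 17 * δ)) * hδ - c ^ 2 * h + c * α * hcβ
  have k0 := congrArg (fun z => ((p0 z : ℤ) : ZMod 17)) h17
  have k1 := congrArg (fun z => ((p1 z : ℤ) : ZMod 17)) h17
  simp only [p0_mul, p1_mul] at k0 k1
  have s0 : ((p0 (17 : Q5 ℤ) : ℤ) : ZMod 17) = 0 := by rw [ofNat_def]; decide
  have s1 : ((p1 (17 : Q5 ℤ) : ℤ) : ZMod 17) = 0 := by rw [ofNat_def]; decide
  have c0 : ((p0 c : ℤ) : ZMod 17) * (p0 μ : ZMod 17) - p1 c * p1 μ = 2 := by decide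
  have c1 : ((p0 c : ℤ) : ZMod 17) * p1 μ + p1 c * p0 μ + 4 * (p1 c * p1 μ) = 10 := by decide
  rw [s0, s1, c0, c1] at k0 k1
  have key2 : ∀ p q : ZMod 17, 0 = 2 * p - 10 * q → 0 = 2 * q + 10 * p + 4 * (10 * q) → p = 0 ∧ q = 0 := by
    decide
  exact hα (key2 _ _ (by simpa using k0) (by simpa using k1))

lemma kill2 (α γ e : Q5 ℤ) (h : α * ⟨-51, -50, 0, 2, -5⟩ = γ ^ 2)
    (hα : α = ⟨1, 1, 2, 0, 1⟩ + 3 * e) : False := by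
  rw [hα, ofNat_def, sq] at h
  simp only [qmul_def, add_def, Q5.ext_iff] at h
  obtain ⟨h0, h1, h2, h3, h4⟩ := h
  have d0 : (3 : ℤ) ∣ γ.c0 := by
    have : (3 : ℤ) ∣ γ.c0 * γ.c0 := by
      refine Dvd.intro_left (e.c0 * (-51) + -17 - 2 * (-5-50) - 6 * (-5 * e.c1 - 50 * e.c4 + 2 * e.c2) - 8 + 
        60 * (-5 * e.c4) + 2 * (γ.c1 * γ.c4 + γ.c4 * γ.c1 + γ.c2 * γ.c3 + γ.c3 * γ.c2) - 20 * (γ.c4 * γ.c4) - 100) ?_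
      linear_combination h0
    rcases Int.prime_three.dvd_or_dvd this with h | h <;> exact h
  obtain ⟨k, hk⟩ := d0
  rw [hk] at h0 h2 h4
  have : ∃ m : ℤ, (γ.c1 + γ.c3) * (γ.c1 + γ.c3) = 2 + 3 * m := by
    refine ⟨-4 + (-22 * e.c0 + 12 * e.c1) - (k ^ 2 - 8 * (γ.c1 * γ.c4 + γ.c2 * γ.c3) + 35 * γ.c4 ^ 2
      + 2 * k * γ.c2 - 10 * γ.c2 * γ.c4 - 2 * γ.c3 ^ 2 - 8 * γ.c3 * γ.c4 + 2 * k * γ.c4 + γ.c2 ^ 2), ?_⟩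
    apply mul_left_cancel₀ (show (3 : ℤ) ≠ 0 by norm_num)
    linear_combination -(h0 + 3 * h2 + 3 * h4)
  obtain ⟨m, hm⟩ := this
  have := congrArg (fun z : ℤ => (z : ZMod 3)) hm
  push_cast at this
  rw [show (3 : ZMod 3) = 0 from by decide, zero_mul, add_zero] at this
  generalize ((γ.c1 : ZMod 3) + γ.c3) = z at this
  revert this; revert z; decide

lemma even_of_sq (γ a : Q5 ℤ) (h : 4 * a = γ ^ 2) : ∃ δ, γ = 2 * δ := by
  have key : ∀ g0 g1 g2 g3 g4 : ZMod 4, (⟨g0, g1, g2, g3, g4⟩ : Q5 (ZMod 4)) * ⟨g0, g1, g2, g3, g4⟩ = 0 →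
      2 * g0 = 0 ∧ 2 * g1 = 0 ∧ 2 * g2 = 0 ∧ 2 * g3 = 0 ∧ 2 * g4 = 0 := by decide +kernel
  have h' := congrArg (Q5.map (Int.castRingHom (ZMod 4))) h
  rw [sq, map_mul, map_mul, map_ofNat] at h'
  have e4 : (4 : Q5 (ZMod 4)) = 0 := by rw [ofNat_def]; decide
  rw [e4, zero_mul] at h'
  obtain ⟨k0, k1, k2, k3, k4⟩ := key _ _ _ _ _ h'.symm
  have d : ∀ n : ℤ, 2 * (Int.castRingHom (ZMod 4)) n = 0 → ∃ k, n = 2 * k := by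
    intro n hn
    have : ((2 * n : ℤ) : ZMod 4) = 0 := by push_cast; exact hn
    rw [ZMod.intCast_zmod_eq_zero_iff_dvd] at this
    refine ⟨n / 2, ?_⟩
    push_cast at this
    omega
  obtain ⟨m0, e0⟩ := d _ k0
  obtain ⟨m1, e1⟩ := d _ k1
  obtain ⟨m2, e2⟩ := d _ k2
  obtain ⟨m3, e3⟩ := d _ k3
  obtain ⟨m4, e4⟩ := d _ k4
  refine ⟨⟨m0, m1, m2, m3, m4⟩, ?_⟩
  rw [ofNat_def]; simp only [qmul_def]; ext <;> simp only [e0, e1, e2, e3, e4] <;> push_cast <;> ring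

lemma iota_mul : (⟨1, 6, 3, 2, 7⟩ : Q5 ℤ) * ⟨5, 4, 1, 0, 3⟩ = 1 + 8 * ⟨122, 296, 176, -79, -40⟩ := by
  rw [qone_def, ofNat_def]; simp only [qmul_def, add_def]; ext <;> norm_num

lemma kill1 (a K γ e : Q5 ℤ) (h : a * ⟨4, 0, 0, 0, 0⟩ = γ ^ 2)
    (hK : a * K ^ 2 = ⟨5, 4, 1, 0, 3⟩ + 8 * e) : False := by
  have e4 : (⟨4, 0, 0, 0, 0⟩ : Q5 ℤ) = 4 := by rw [ofNat_def]
  rw [e4, mul_comm] at h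
  obtain ⟨δ, rfl⟩ := even_of_sq _ _ h
  have ha : a = δ ^ 2 := by
    apply intCast_mul_inj (y := 4) (by norm_num)
    push_cast
    linear_combination h
  have := finite_beta 1 (K * δ) (-⟨1, 6, 3, 2, 7⟩ * e - ⟨122, 296, 176, -79, -40⟩) (by
    linear_combination -iota_mul - ⟨1, 6, 3, 2, 7⟩ * hK + ⟨1, 6, 3, 2, 7⟩ * K ^ 2 * ha)
    (by rw [qone_def, zero_def]; decide) (by simp only [map_one, abs_one, norm_one]; norm_num)
    ⟨1, by rw [map_one, mul_one]⟩
  revert this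
  rw [qone_def]
  decide

end C16

end


section
namespace C16
open Q5

lemma core (α a τ X X' K e e3 : Q5 ℤ) (M h y : ℤ) (hM : X * X' = (M : Q5 ℤ)) (hM0 : 0 < M) (k : ℕ)
    (hM6 : M ∣ 6 ^ k)
    (ht : (X * a) ^ 5 + 30 * h * (X * a) ^ 3 + 405 * (h : Q5 ℤ) ^ 2 * (X * a) = M * (y : Q5 ℤ) ^ 2)
    (hα : α = τ ^ 2 * a) (hy0 : y ≠ 0) (hy : IsCoprime y (30 * h)) (hX : 0 < σ1 X)
    (hK : a * K ^ 2 = ⟨5, 4, 1, 0, 3⟩ + 8 * e)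
    (hα3 : α = ⟨1, 1, 2, 0, 1⟩ + 3 * e3)
    (h17 : ¬ (((p0 α : ℤ) : ZMod 17) = 0 ∧ ((p1 α : ℤ) : ZMod 17) = 0)) : False := by
  -- coprimality of `a` to `M`
  have c8 : IsCoprime a (8 : Q5 ℤ) := by
    refine ⟨K ^ 2 * ⟨1, 6, 3, 2, 7⟩, -(⟨122, 296, 176, -79, -40⟩ + ⟨1, 6, 3, 2, 7⟩ * e), ?_⟩
    linear_combination iota_mul + ⟨1, 6, 3, 2, 7⟩ * hK
  have c2 : IsCoprime a (2 : Q5 ℤ) := by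
    apply c8.of_isCoprime_of_dvd_right
    exact ⟨4, by norm_num⟩
  have c3 : IsCoprime a (3 : Q5 ℤ) := by
    have inv3 : (⟨1, 1, 2, 0, 1⟩ : Q5 ℤ) * ⟨1, 2, 1, 0, 2⟩ = 1 + 3 * ⟨32, 71, 30, -49, -7⟩ := by
      rw [qone_def, ofNat_def]; simp only [qmul_def, add_def]; ext <;> norm_num
    refine ⟨τ ^ 2 * ⟨1, 2, 1, 0, 2⟩, -(⟨32, 71, 30, -49, -7⟩ + ⟨1, 2, 1, 0, 2⟩ * e3), ?_⟩
    linear_combination inv3 + ⟨1, 2, 1, 0, 2⟩ * hα3 - ⟨1, 2, 1, 0, 2⟩ * hα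
  have cM : IsCoprime a (M : Q5 ℤ) := by
    have c6 : IsCoprime a (6 : Q5 ℤ) := by
      have := c2.mul_right c3
      convert this using 1; norm_num
    apply (c6.pow_right (n := k)).of_isCoprime_of_dvd_right
    have := map_dvd (Int.castRingHom (Q5 ℤ)) hM6
    simpa using this
  set t := X * a with hta
  set z := X * (t ^ 4 + 30 * h * t ^ 2 + 405 * (h : Q5 ℤ) ^ 2) with hz
  have haz : a * z = M * (y : Q5 ℤ) ^ 2 := by
    rw [← ht, hz]; linear_combination (-(t ^ 4 + 30 * h * t ^ 2 + 405 * (h : Q5 ℤ) ^ 2)) * hta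
  obtain ⟨α', hα'⟩ : (M : Q5 ℤ) ∣ z := cM.symm.dvd_of_dvd_mul_left ⟨_, haz⟩
  have hay : a * α' = (y : Q5 ℤ) ^ 2 := by
    apply intCast_mul_inj hM0.ne'
    rw [← haz, hα']; ring
  -- `a` is coprime to `30 h`, as it divides `y²`
  have ch : IsCoprime a (30 * h : Q5 ℤ) := by
    have h1 : IsCoprime (y : Q5 ℤ) ((30 * h : ℤ) : Q5 ℤ) := by
      have := hy.map (Int.castRingHom (Q5 ℤ))
      simpa using this
    push_cast at h1
    exact (h1.pow_left (m := 2)).of_isCoprime_of_dvd_left ⟨_, hay.symm⟩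
  have cX : IsCoprime a X := cM.of_isCoprime_of_dvd_right ⟨_, hM.symm⟩
  have cz : IsCoprime a z := by
    have h1 : IsCoprime a (X * (405 * (h : Q5 ℤ) ^ 2)) := by
      refine cX.mul_right ?_
      apply ((ch.pow_right (n := 4))).of_isCoprime_of_dvd_right
      refine ⟨2000 * (h : Q5 ℤ) ^ 2, ?_⟩
      ring
    have : z = X * (405 * (h : Q5 ℤ) ^ 2) + a * (X * X * (t ^ 3 + 30 * h * t)) := by
      rw [hz]; linear_combination (X * (t ^ 3 + 30 * h * t)) * hta
    rw [this]
    exact h1.add_mul_left_right _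
  have ca : IsCoprime a α' := cz.of_isCoprime_of_dvd_right ⟨_, by rw [hα']; ring⟩
  obtain ⟨s, r, hsr⟩ := ca
  -- positivity
  have hpos : 0 < σ1 a := by
    have h1 := congrArg σ1 ht
    simp only [map_add, map_mul, map_pow, map_intCast, map_ofNat] at h1
    have hMp : (0 : ℝ) < M := by exact_mod_cast hM0
    have hyr : (0 : ℝ) < (y : ℝ) ^ 2 := by positivity
    have h2 : 0 < σ1 t * ((σ1 t ^ 2 + 15 * h) ^ 2 + 180 * (h : ℝ) ^ 2) := by
      have : σ1 t * ((σ1 t ^ 2 + 15 * h) ^ 2 + 180 * (h : ℝ) ^ 2) = M * (y : ℝ) ^ 2 := by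
        rw [← h1]; ring
      rw [this]; positivity
    have h3 : 0 < σ1 t := pos_of_mul_pos_left h2 (by positivity)
    rw [hta, map_mul] at h3
    exact (pos_iff_pos_of_mul_pos h3).1 hX
  obtain ⟨β, γ, hβ0, hβ, hle, hsq⟩ := exists_beta a α' s r y hy0 hay hsr hpos
  have hform : β = ⟨1, 6, 3, 2, 7⟩ * (K * γ) ^ 2 + 8 * (-β * (⟨122, 296, 176, -79, -40⟩ + ⟨1, 6, 3, 2, 7⟩ * e)) := by
    linear_combination (-β) * iota_mul - ⟨1, 6, 3, 2, 7⟩ * β * hK + ⟨1, 6, 3, 2, 7⟩ * K ^ 2 * hβ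
  rcases finite_beta β _ _ hform hβ0 hle hsq with rfl | rfl | rfl
  · exact kill1 a K γ e hβ hK
  · exact kill2 α (τ * γ) e3 (by rw [hα]; linear_combination τ ^ 2 * hβ) hα3
  · exact kill3 α (τ * γ) (by rw [hα]; linear_combination τ ^ 2 * hβ) h17

end C16

end


section
set_option maxHeartbeats 4000000
namespace C16
open Q5

/-- The form `f`. -/
def FF {A : Type} [CommRing A] (u v : A) : A :=
  19683 * v ^ 30 - 590490 * u * v ^ 29 - 8562105 * u ^ 2 * v ^ 28 - 45664560 * u ^ 3 * v ^ 27 - 111307365 * u ^ 4 * v ^ 26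
    - 154117890 * u ^ 5 * v ^ 25 - 442375425 * u ^ 6 * v ^ 24 - 2968196400 * u ^ 7 * v ^ 23 - 13456775025 * u ^ 8 * v ^ 22
    - 42084331650 * u ^ 9 * v ^ 21 - 102118323645 * u ^ 10 * v ^ 20 - 203055076800 * u ^ 11 * v ^ 19
    - 323582560425 * u ^ 12 * v ^ 18 - 408808802250 * u ^ 13 * v ^ 17 - 459390230325 * u ^ 14 * v ^ 16
    - 577967879520 * u ^ 15 * v ^ 15 - 844178628375 * u ^ 16 * v ^ 14 - 1119258449550 * u ^ 17 * v ^ 13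
    - 1068882324075 * u ^ 18 * v ^ 12 - 561383751600 * u ^ 19 * v ^ 11 + 62314471665 * u ^ 20 * v ^ 10
    + 395258830650 * u ^ 21 * v ^ 9 + 394892797725 * u ^ 22 * v ^ 8 + 275540518800 * u ^ 23 * v ^ 7
    + 175903201125 * u ^ 24 * v ^ 6 + 112283394858 * u ^ 25 * v ^ 5 + 67302682785 * u ^ 26 * v ^ 4
    + 30539055520 * u ^ 27 * v ^ 3 + 8170447965 * u ^ 28 * v ^ 2 + 1348449810 * u ^ 29 * v + 168454745 * u ^ 30

/-- The form `h`. -/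
def HH {A : Type} [CommRing A] (u v : A) : A :=
  -81 * v ^ 12 - 324 * u * v ^ 11 - 1782 * u ^ 2 * v ^ 10 - 5940 * u ^ 3 * v ^ 9 - 4455 * u ^ 4 * v ^ 8
    + 7128 * u ^ 5 * v ^ 7 + 22572 * u ^ 6 * v ^ 6 + 26136 * u ^ 7 * v ^ 5 + 31185 * u ^ 8 * v ^ 4
    + 31020 * u ^ 9 * v ^ 3 + 9834 * u ^ 10 * v ^ 2 - 804 * u ^ 11 * v - 1657 * u ^ 12

/-- The sextic form `α` over the quintic ring. -/
def al {A : Type} [CommRing A] (u v : A) : Q5 A :=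
  ⟨459 * v ^ 6 + 54 * u * v ^ 5 - 3465 * u ^ 2 * v ^ 4 - 11400 * u ^ 3 * v ^ 3 - 5055 * u ^ 4 * v ^ 2
    - 846 * u ^ 5 * v - 131 * u ^ 6,
    450 * v ^ 6 - 108 * u * v ^ 5 - 4920 * u ^ 2 * v ^ 4 - 15960 * u ^ 3 * v ^ 3 - 7230 * u ^ 4 * v ^ 2
    - 1820 * u ^ 5 * v - 1108 * u ^ 6,
    3 * v ^ 6 - 105 * u ^ 2 * v ^ 4 - 320 * u ^ 3 * v ^ 3 - 115 * u ^ 4 * v ^ 2 - 32 * u ^ 5 * v - 55 * u ^ 6,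
    -18 * v ^ 6 + 36 * u * v ^ 5 + 420 * u ^ 2 * v ^ 4 + 1320 * u ^ 3 * v ^ 3 + 630 * u ^ 4 * v ^ 2
    + 212 * u ^ 5 * v + 176 * u ^ 6,
    45 * v ^ 6 - 12 * u * v ^ 5 - 495 * u ^ 2 * v ^ 4 - 1620 * u ^ 3 * v ^ 3 - 745 * u ^ 4 * v ^ 2
    - 200 * u ^ 5 * v - 117 * u ^ 6⟩

/-- The multiplier `x` of norm 648. -/
def xx : Q5 ℤ := ⟨1404, 2936, 1139, -1398, 572⟩

/-- The sextic form `x α`. -/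
def tt (u v : ℤ) : Q5 ℤ :=
  ⟨-108 * v ^ 6 + 1080 * u ^ 2 * v ^ 4 + 3600 * u ^ 3 * v ^ 3 + 1620 * u ^ 4 * v ^ 2 + 432 * u ^ 5 * v
    + 240 * u ^ 6,
    -90 * v ^ 6 + 36 * u * v ^ 5 + 1440 * u ^ 2 * v ^ 4 + 4800 * u ^ 3 * v ^ 3 + 2190 * u ^ 4 * v ^ 2
    + 780 * u ^ 5 * v + 596 * u ^ 6,
    -18 * u * v ^ 5 + 60 * u ^ 3 * v ^ 3 + 30 * u ^ 5 * v + 32 * u ^ 6,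
    -90 * u ^ 2 * v ^ 4 - 360 * u ^ 3 * v ^ 3 - 180 * u ^ 4 * v ^ 2 - 120 * u ^ 5 * v - 90 * u ^ 6,
    -9 * v ^ 6 + 135 * u ^ 2 * v ^ 4 + 480 * u ^ 3 * v ^ 3 + 225 * u ^ 4 * v ^ 2 + 96 * u ^ 5 * v + 65 * u ^ 6⟩

/-- The square of `x α`. -/
def ss (u v : ℤ) : Q5 ℤ :=
  ⟨6804 * v ^ 12 + 3888 * u * v ^ 11 - 77760 * u ^ 2 * v ^ 10 - 336960 * u ^ 3 * v ^ 9 - 471420 * u ^ 4 * v ^ 8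
    - 598752 * u ^ 5 * v ^ 7 - 951264 * u ^ 6 * v ^ 6 - 1270080 * u ^ 7 * v ^ 5 - 1900260 * u ^ 8 * v ^ 4
    - 2074320 * u ^ 9 * v ^ 3 - 831456 * u ^ 10 * v ^ 2 - 260352 * u ^ 11 * v - 119220 * u ^ 12,
    7290 * v ^ 12 - 116640 * u ^ 2 * v ^ 10 - 469800 * u ^ 3 * v ^ 9 - 527310 * u ^ 4 * v ^ 8 - 272160 * u ^ 5 * v ^ 7
    - 226800 * u ^ 6 * v ^ 6 - 900720 * u ^ 7 * v ^ 5 - 2110050 * u ^ 8 * v ^ 4 - 2518560 * u ^ 9 * v ^ 3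
    - 1047600 * u ^ 10 * v ^ 2 - 383400 * u ^ 11 * v - 197130 * u ^ 12,
    -972 * u * v ^ 11 - 1944 * u ^ 2 * v ^ 10 - 1620 * u ^ 3 * v ^ 9 + 9720 * u ^ 4 * v ^ 8 + 29160 * u ^ 5 * v ^ 7
    + 27216 * u ^ 6 * v ^ 6 - 26568 * u ^ 7 * v ^ 5 - 58320 * u ^ 8 * v ^ 4 - 52380 * u ^ 9 * v ^ 3
    - 6840 * u ^ 10 * v ^ 2 - 612 * u ^ 11 * v - 3624 * u ^ 12,
    -486 * v ^ 12 + 5832 * u ^ 2 * v ^ 10 + 22680 * u ^ 3 * v ^ 9 + 7290 * u ^ 4 * v ^ 8 - 54432 * u ^ 5 * v ^ 7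
    - 90720 * u ^ 6 * v ^ 6 + 11664 * u ^ 7 * v ^ 5 + 164430 * u ^ 8 * v ^ 4 + 217440 * u ^ 9 * v ^ 3
    + 79704 * u ^ 10 * v ^ 2 + 22680 * u ^ 11 * v + 15582 * u ^ 12,
    729 * v ^ 12 - 11178 * u ^ 2 * v ^ 10 - 45360 * u ^ 3 * v ^ 9 - 47385 * u ^ 4 * v ^ 8 - 15552 * u ^ 5 * v ^ 7
    - 11340 * u ^ 6 * v ^ 6 - 85536 * u ^ 7 * v ^ 5 - 209385 * u ^ 8 * v ^ 4 - 250560 * u ^ 9 * v ^ 3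
    - 99306 * u ^ 10 * v ^ 2 - 33840 * u ^ 11 * v - 19383 * u ^ 12⟩

/-- The quartic cofactor. -/
def qq (u v : ℤ) : Q5 ℤ :=
  ⟨531441 * v ^ 24 - 7085880 * u * v ^ 23 - 87156324 * u ^ 2 * v ^ 22 - 9920232 * u ^ 3 * v ^ 21 + 4045683186 * u ^ 4 * v ^ 20
    + 26324988984 * u ^ 5 * v ^ 19 + 91510597260 * u ^ 6 * v ^ 18 + 221569326504 * u ^ 7 * v ^ 17
    + 449454002607 * u ^ 8 * v ^ 16 + 743023172304 * u ^ 9 * v ^ 15 + 917242864056 * u ^ 10 * v ^ 14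
    + 947002667760 * u ^ 11 * v ^ 13 + 1136197212156 * u ^ 12 * v ^ 12 + 1772862296688 * u ^ 13 * v ^ 11
    + 2538660869496 * u ^ 14 * v ^ 10 + 2401656569424 * u ^ 15 * v ^ 9 + 920680384095 * u ^ 16 * v ^ 8
    - 686000681496 * u ^ 17 * v ^ 7 - 1252306097748 * u ^ 18 * v ^ 6 - 937964407176 * u ^ 19 * v ^ 5
    - 526352555214 * u ^ 20 * v ^ 4 - 238147727400 * u ^ 21 * v ^ 3 - 64133208324 * u ^ 22 * v ^ 2
    - 10441508472 * u ^ 23 * v - 1380155679 * u ^ 24,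
    1299078 * v ^ 24 - 19840464 * u * v ^ 23 - 276349320 * u ^ 2 * v ^ 22 - 887782032 * u ^ 3 * v ^ 21
    + 2921665788 * u ^ 4 * v ^ 20 + 29703694032 * u ^ 5 * v ^ 19 + 111853135224 * u ^ 6 * v ^ 18
    + 280901604240 * u ^ 7 * v ^ 17 + 583102064682 * u ^ 8 * v ^ 16 + 972095465952 * u ^ 9 * v ^ 15
    + 1190438652528 * u ^ 10 * v ^ 14 + 1194795471456 * u ^ 11 * v ^ 13 + 1414269010440 * u ^ 12 * v ^ 12
    + 2283653059488 * u ^ 13 * v ^ 11 + 3366123406128 * u ^ 14 * v ^ 10 + 3202711594272 * u ^ 15 * v ^ 9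
    + 1168849400634 * u ^ 16 * v ^ 8 - 1026335247120 * u ^ 17 * v ^ 7 - 1724315753448 * u ^ 18 * v ^ 6
    - 1176959306448 * u ^ 19 * v ^ 5 - 568269002052 * u ^ 20 * v ^ 4 - 224733846384 * u ^ 21 * v ^ 3
    - 55927449000 * u ^ 22 * v ^ 2 - 8691287472 * u ^ 23 * v - 1105461162 * u ^ 24,
    236196 * v ^ 24 + 944784 * u * v ^ 23 - 6613488 * u ^ 2 * v ^ 22 - 48183984 * u ^ 3 * v ^ 21 - 42357816 * u ^ 4 * v ^ 20
    + 407201904 * u ^ 5 * v ^ 19 + 2112222096 * u ^ 6 * v ^ 18 + 6248486448 * u ^ 7 * v ^ 17 + 14769887004 * u ^ 8 * v ^ 16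
    + 27626813856 * u ^ 9 * v ^ 15 + 36810114336 * u ^ 10 * v ^ 14 + 31846289184 * u ^ 11 * v ^ 13
    + 22315833072 * u ^ 12 * v ^ 12 + 40479842016 * u ^ 13 * v ^ 11 + 93153672864 * u ^ 14 * v ^ 10
    + 125899419744 * u ^ 15 * v ^ 9 + 93578962716 * u ^ 16 * v ^ 8 + 31977520848 * u ^ 17 * v ^ 7
    - 114010416 * u ^ 18 * v ^ 6 + 1276042896 * u ^ 19 * v ^ 5 + 6808028616 * u ^ 20 * v ^ 4 + 6323623344 * u ^ 21 * v ^ 3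
    + 2885237712 * u ^ 22 * v ^ 2 + 581011056 * u ^ 23 * v + 71319204 * u ^ 24,
    -354294 * v ^ 24 + 944784 * u * v ^ 23 + 30705480 * u ^ 2 * v ^ 22 + 144551952 * u ^ 3 * v ^ 21
    - 6062364 * u ^ 4 * v ^ 20 - 1923265296 * u ^ 5 * v ^ 19 - 8323704504 * u ^ 6 * v ^ 18 - 21930011280 * u ^ 7 * v ^ 17
    - 46280519802 * u ^ 8 * v ^ 16 - 78069181536 * u ^ 9 * v ^ 15 - 99195216624 * u ^ 10 * v ^ 14
    - 105343346016 * u ^ 11 * v ^ 13 - 131422866120 * u ^ 12 * v ^ 12 - 221435931168 * u ^ 13 * v ^ 11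
    - 335707311024 * u ^ 14 * v ^ 10 - 332105269536 * u ^ 15 * v ^ 9 - 152374082634 * u ^ 16 * v ^ 8
    + 46268813520 * u ^ 17 * v ^ 7 + 113016553128 * u ^ 18 * v ^ 6 + 70507777104 * u ^ 19 * v ^ 5
    + 24586444836 * u ^ 20 * v ^ 4 + 5645815344 * u ^ 21 * v ^ 3 + 690347880 * u ^ 22 * v ^ 2 + 33903792 * u ^ 23 * v
    - 39612294 * u ^ 24,
    177147 * v ^ 24 - 1417176 * u * v ^ 23 - 25272972 * u ^ 2 * v ^ 22 - 87392520 * u ^ 3 * v ^ 21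
    + 287883558 * u ^ 4 * v ^ 20 + 3000791448 * u ^ 5 * v ^ 19 + 11498257476 * u ^ 6 * v ^ 18 + 29370657672 * u ^ 7 * v ^ 17
    + 61723821285 * u ^ 8 * v ^ 16 + 103991010192 * u ^ 9 * v ^ 15 + 130041591912 * u ^ 10 * v ^ 14
    + 134277495984 * u ^ 11 * v ^ 13 + 159034712148 * u ^ 12 * v ^ 12 + 250119025200 * u ^ 13 * v ^ 11
    + 362797225128 * u ^ 14 * v ^ 10 + 344607479568 * u ^ 15 * v ^ 9 + 132382105461 * u ^ 16 * v ^ 8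
    - 96425815608 * u ^ 17 * v ^ 7 - 170713725660 * u ^ 18 * v ^ 6 - 116612642088 * u ^ 19 * v ^ 5
    - 55774427418 * u ^ 20 * v ^ 4 - 21867911496 * u ^ 21 * v ^ 3 - 5473989612 * u ^ 22 * v ^ 2
    - 905062680 * u ^ 23 * v - 113739957 * u ^ 24⟩

lemma tt_eq (u v : ℤ) : xx * al u v = tt u v := by
  simp only [xx, al, tt, qmul_def]
  ext <;> simp only <;> ring

lemma ss_eq (u v : ℤ) : tt u v * tt u v = ss u v := by
  simp only [ss, tt, qmul_def]
  ext <;> simp only <;> ring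

lemma qq_eq (u v : ℤ) : ss u v * ss u v + ((30 * HH u v : ℤ) : Q5 ℤ) * ss u v
    + ((405 * HH u v ^ 2 : ℤ) : Q5 ℤ) = qq u v := by
  simp only [ss, qq, HH, qmul_def, add_def, intCast_def]
  ext <;> simp only [Int.cast_id] <;> ring

lemma tq_eq (u v : ℤ) : tt u v * qq u v = ((648 * FF u v : ℤ) : Q5 ℤ) := by
  simp only [tt, qq, FF, qmul_def, intCast_def]
  ext <;> simp only [Int.cast_id] <;> ring

lemma main_id (u v : ℤ) : (xx * al u v) ^ 5 + 30 * ((HH u v : ℤ) : Q5 ℤ) * (xx * al u v) ^ 3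
    + 405 * ((HH u v : ℤ) : Q5 ℤ) ^ 2 * (xx * al u v) = 648 * ((FF u v : ℤ) : Q5 ℤ) := by
  have h1 := ss_eq u v
  have h2 := qq_eq u v
  have h3 := tq_eq u v
  rw [tt_eq]
  push_cast at h2 h3
  rw [← h3, ← h2, ← h1]
  ring

end C16

end


section
set_option maxHeartbeats 4000000
namespace C16
open Q5

/-- The sextic form `α / τ²` on the branch `u = 3 v + 16 w`. -/
def bl {A : Type} [CommRing A] (w v : A) : Q5 A :=
  ⟨-137511 * v ^ 6 - 3689640 * w * v ^ 5 - 40743360 * w ^ 2 * v ^ 4 - 236313600 * w ^ 3 * v ^ 3 - 756817920 * w ^ 4 * v ^ 2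
    - 1263796224 * w ^ 5 * v - 854589440 * w ^ 6,
    -371502 * v ^ 6 - 9996336 * w * v ^ 5 - 110941440 * w ^ 2 * v ^ 4 - 648529920 * w ^ 3 * v ^ 3 - 2101493760 * w ^ 4 * v ^ 2
    - 3570925568 * w ^ 5 * v - 2478833664 * w ^ 6,
    -295287 * v ^ 6 - 8008944 * w * v ^ 5 - 90071040 * w ^ 2 * v ^ 4 - 537067520 * w ^ 3 * v ^ 3 - 1790361600 * w ^ 4 * v ^ 2
    - 3165913088 * w ^ 5 * v - 2323644416 * w ^ 6,
    -104634 * v ^ 6 - 3044016 * w * v ^ 5 - 38023680 * w ^ 2 * v ^ 4 - 259799040 * w ^ 3 * v ^ 3 - 1019658240 * w ^ 4 * v ^ 2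
    - 2171600896 * w ^ 5 * v - 1954545664 * w ^ 6,
    40707 * v ^ 6 + 1032792 * w * v ^ 5 + 10305600 * w ^ 2 * v ^ 4 + 50027520 * w ^ 3 * v ^ 3 + 113745920 * w ^ 4 * v ^ 2
    + 73924608 * w ^ 5 * v - 70254592 * w ^ 6⟩

/-- The sextic form `α / τ²` on the branch `u = -3 v + 16 w`. -/
def cl {A : Type} [CommRing A] (w v : A) : Q5 A :=
  ⟨7533 * v ^ 6 - 121320 * w * v ^ 5 - 498240 * w ^ 2 * v ^ 4 + 23024640 * w ^ 3 * v ^ 3 - 189849600 * w ^ 4 * v ^ 2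
    + 659030016 * w ^ 5 * v - 854589440 * w ^ 6,
    5688 * v ^ 6 + 107568 * w * v ^ 5 - 6673920 * w ^ 2 * v ^ 4 + 96491520 * w ^ 3 * v ^ 3 - 634798080 * w ^ 4 * v ^ 2
    + 2006450176 * w ^ 5 * v - 2478833664 * w ^ 6,
    -25521 * v ^ 6 + 977232 * w * v ^ 5 - 16227840 * w ^ 2 * v ^ 4 + 147128320 * w ^ 3 * v ^ 3 - 755712000 * w ^ 4 * v ^ 2
    + 2062286848 * w ^ 5 * v - 2323644416 * w ^ 6,
    -105336 * v ^ 6 + 3200688 * w * v ^ 5 - 40684800 * w ^ 2 * v ^ 4 + 277309440 * w ^ 3 * v ^ 3 - 1070776320 * w ^ 4 * v ^ 2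
    + 2226126848 * w ^ 5 * v - 1954545664 * w ^ 6,
    -29745 * v ^ 6 + 851064 * w * v ^ 5 - 9825600 * w ^ 2 * v ^ 4 + 57461760 * w ^ 3 * v ^ 3 - 173056000 * w ^ 4 * v ^ 2
    + 231997440 * w ^ 5 * v - 70254592 * w ^ 6⟩

/-- The element `τ`. -/
def ta : Q5 ℤ := ⟨212, 296, 6, -24, 30⟩

lemma bl_eq (w v : ℤ) : al (3 * v + 16 * w) v = ta ^ 2 * bl w v := by
  rw [sq, show ta * ta = ⟨-5888, -4888, 40, 120, -480⟩ from by simp only [ta, qmul_def]; ext <;> norm_num]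
  simp only [al, bl, qmul_def]
  ext <;> simp only <;> ring

lemma cl_eq (w v : ℤ) : al (-3 * v + 16 * w) v = ta ^ 2 * cl w v := by
  rw [sq, show ta * ta = ⟨-5888, -4888, 40, 120, -480⟩ from by simp only [ta, qmul_def]; ext <;> norm_num]
  simp only [al, cl, qmul_def]
  ext <;> simp only <;> ring

lemma map_al (n : ℕ) (u v : ℤ) :
    Q5.map (Int.castRingHom (ZMod n)) (al u v) =
      al (Int.castRingHom (ZMod n) u) (Int.castRingHom (ZMod n) v) := by
  simp only [al, Q5.map, RingHom.coe_mk, MonoidHom.coe_mk, OneHom.coe_mk, Int.coe_castRingHom]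
  push_cast; rfl
lemma map_bl (n : ℕ) (u v : ℤ) :
    Q5.map (Int.castRingHom (ZMod n)) (bl u v) =
      bl (Int.castRingHom (ZMod n) u) (Int.castRingHom (ZMod n) v) := by
  simp only [bl, Q5.map, RingHom.coe_mk, MonoidHom.coe_mk, OneHom.coe_mk, Int.coe_castRingHom]
  push_cast; rfl
lemma map_cl (n : ℕ) (u v : ℤ) :
    Q5.map (Int.castRingHom (ZMod n)) (cl u v) =
      cl (Int.castRingHom (ZMod n) u) (Int.castRingHom (ZMod n) v) := by
  simp only [cl, Q5.map, RingHom.coe_mk, MonoidHom.coe_mk, OneHom.coe_mk, Int.coe_castRingHom]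
  push_cast; rfl

lemma lift_mod (n : ℕ) (z w : Q5 ℤ) (h : Q5.map (Int.castRingHom (ZMod n)) z = Q5.map (Int.castRingHom (ZMod n)) w) :
    ∃ e, z = w + (n : Q5 ℤ) * e := by
  simp only [Q5.map, RingHom.coe_mk, MonoidHom.coe_mk, OneHom.coe_mk, Q5.ext_iff] at h
  obtain ⟨h0, h1, h2, h3, h4⟩ := h
  have d : ∀ a b : ℤ, Int.castRingHom (ZMod n) a = Int.castRingHom (ZMod n) b → ∃ k, a = b + n * k := by
    intro a b hab
    have := (ZMod.intCast_eq_intCast_iff_dvd_sub b a n).1 hab.symm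
    obtain ⟨k, hk⟩ := this
    exact ⟨k, by linarith⟩
  obtain ⟨k0, e0⟩ := d _ _ h0
  obtain ⟨k1, e1⟩ := d _ _ h1
  obtain ⟨k2, e2⟩ := d _ _ h2
  obtain ⟨k3, e3⟩ := d _ _ h3
  obtain ⟨k4, e4⟩ := d _ _ h4
  refine ⟨⟨k0, k1, k2, k3, k4⟩, ?_⟩
  rw [natCast_def]; simp only [qmul_def, add_def]
  ext <;> simp only [e0, e1, e2, e3, e4] <;> ring

lemma al_mod3 (u v : ℤ) (h : ((u : ℤ) : ZMod 3) = 2 * (v : ZMod 3)) (hv : (v : ZMod 3) ≠ 0) :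
    ∃ e, al u v = ⟨1, 1, 2, 0, 1⟩ + 3 * e := by
  have key : ∀ u v : ZMod 3, u = 2 * v → v ≠ 0 → al u v = ⟨1, 1, 2, 0, 1⟩ := by decide +kernel
  have := lift_mod 3 (al u v) ⟨1, 1, 2, 0, 1⟩ (by
    rw [map_al]
    exact key _ _ h hv)
  simpa using this

lemma al_mod17 (u v : ℤ) (h : ¬ ((u : ZMod 17) = 0 ∧ (v : ZMod 17) = 0)) :
    ¬ (((p0 (al u v) : ℤ) : ZMod 17) = 0 ∧ ((p1 (al u v) : ℤ) : ZMod 17) = 0) := by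
  have key : ∀ u v : ZMod 17, (al u v).c0 - (al u v).c2 - 7 * (al u v).c3 - 5 * (al u v).c4 = 0 →
      (al u v).c1 + 4 * (al u v).c2 + 5 * (al u v).c3 - 4 * (al u v).c4 = 0 → u = 0 ∧ v = 0 := by
    decide +kernel
  have hm := map_al 17 u v
  simp only [Q5.map, RingHom.coe_mk, MonoidHom.coe_mk, OneHom.coe_mk, Q5.ext_iff, Int.coe_castRingHom] at hm
  obtain ⟨h0, h1, h2, h3, h4⟩ := hm
  rintro ⟨e0, e1⟩
  apply h
  apply key
  · rw [← h0, ← h2, ← h3, ← h4, ← e0, p0]; push_cast; ring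
  · rw [← h1, ← h2, ← h3, ← h4, ← e1, p1]; push_cast; ring

lemma al_mod8 (u v : ℤ) (hu : Odd u) (hv : Even v) :
    ∃ K e : Q5 ℤ, al u v * K ^ 2 = ⟨5, 4, 1, 0, 3⟩ + 8 * e := by
  have key : ∀ u v : ZMod 8, 4 * u = 4 → 4 * v = 0 →
      al u v * ⟨1, 0, v, 0, 0⟩ ^ 2 = ⟨5, 4, 1, 0, 3⟩ := by decide +kernel
  obtain ⟨m, rfl⟩ := hu
  obtain ⟨n, rfl⟩ := hv
  have := lift_mod 8 (al (2 * m + 1) (n + n) * ⟨1, 0, n + n, 0, 0⟩ ^ 2) ⟨5, 4, 1, 0, 3⟩ (by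
    rw [map_mul, map_pow, map_al]
    have e8 : (8 : ZMod 8) = 0 := by decide
    have := key (Int.castRingHom (ZMod 8) (2 * m + 1)) (Int.castRingHom (ZMod 8) (n + n))
      (by simp only [map_add, map_mul, map_ofNat, map_one]; linear_combination (m : ZMod 8) * e8)
      (by simp only [map_add]; linear_combination (n : ZMod 8) * e8)
    have hk : Q5.map (Int.castRingHom (ZMod 8)) (⟨1, 0, n + n, 0, 0⟩ : Q5 ℤ) =
        ⟨1, 0, Int.castRingHom (ZMod 8) (n + n), 0, 0⟩ := by simp [Q5.map]
    rw [hk]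
    exact this)
  obtain ⟨e, he⟩ := this
  exact ⟨_, e, by simpa using he⟩

lemma bl_mod8 (u v : ℤ) (hv : Odd v) :
    ∃ K e : Q5 ℤ, bl u v * K ^ 2 = ⟨5, 4, 1, 0, 3⟩ + 8 * e := by
  have key : ∀ u v : ZMod 8, 4 * v = 4 →
      bl u v * ⟨1, 1, 3, 3, 1⟩ ^ 2 = ⟨5, 4, 1, 0, 3⟩ := by decide +kernel
  obtain ⟨m, rfl⟩ := hv
  have := lift_mod 8 (bl u (2 * m + 1) * ⟨1, 1, 3, 3, 1⟩ ^ 2) ⟨5, 4, 1, 0, 3⟩ (by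
    rw [map_mul, map_pow, map_bl]
    have e8 : (8 : ZMod 8) = 0 := by decide
    exact key _ (Int.castRingHom (ZMod 8) (2 * m + 1))
      (by simp only [map_add, map_mul, map_ofNat, map_one]; linear_combination (m : ZMod 8) * e8))
  obtain ⟨e, he⟩ := this
  exact ⟨_, e, by simpa using he⟩

lemma cl_mod8 (u v : ℤ) (hv : Odd v) :
    ∃ K e : Q5 ℤ, cl u v * K ^ 2 = ⟨5, 4, 1, 0, 3⟩ + 8 * e := by
  have key : ∀ u v : ZMod 8, 4 * v = 4 →
      cl u v * ⟨1, 1, 0, 3, 0⟩ ^ 2 = ⟨5, 4, 1, 0, 3⟩ := by decide +kernel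
  obtain ⟨m, rfl⟩ := hv
  have := lift_mod 8 (cl u (2 * m + 1) * ⟨1, 1, 0, 3, 0⟩ ^ 2) ⟨5, 4, 1, 0, 3⟩ (by
    rw [map_mul, map_pow, map_cl]
    have e8 : (8 : ZMod 8) = 0 := by decide
    exact key _ (Int.castRingHom (ZMod 8) (2 * m + 1))
      (by simp only [map_add, map_mul, map_ofNat, map_one]; linear_combination (m : ZMod 8) * e8))
  obtain ⟨e, he⟩ := this
  exact ⟨_, e, by simpa using he⟩

end C16

end


section
namespace C16
open Q5

lemma xx_pos : 0 < σ1 xx := by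
  rw [σ1_apply, xx]
  have h := r1_near
  rw [abs_le] at h
  have l : r1 ≤ -2.444 := by linarith [h.2]
  have l' : -2.445 ≤ r1 := by linarith [h.1]
  have h2 : 5.97 ≤ r1 ^ 2 := by nlinarith
  have h3 : r1 ^ 3 ≤ 0 := by
    have : r1 ^ 3 = r1 * r1 ^ 2 := by ring
    rw [this]; exact mul_nonpos_of_nonpos_of_nonneg (by linarith) (by positivity)
  have h4 : 0 ≤ r1 ^ 4 := by positivity
  push_cast
  linarith

lemma xx_adj : xx * ⟨-3807, -2106, 108, -54, -189⟩ = ((648 : ℤ) : Q5 ℤ) := by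
  rw [xx, intCast_def]; simp only [qmul_def]; ext <;> norm_num

lemma ta_adj : ta * ⟨64, 128, 64, 0, 0⟩ = ((-256 : ℤ) : Q5 ℤ) := by
  rw [ta, intCast_def]; simp only [qmul_def]; ext <;> norm_num

lemma caseA (u v y : ℤ) (hu : Odd u) (hv : Even v) (h3 : (u : ZMod 3) = 2 * (v : ZMod 3))
    (hv3 : (v : ZMod 3) ≠ 0) (h17 : ¬ ((u : ZMod 17) = 0 ∧ (v : ZMod 17) = 0))
    (hf : y ^ 2 = FF u v) (hy0 : y ≠ 0) (hy : IsCoprime y (30 * HH u v)) : False := by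
  obtain ⟨K, e, hK⟩ := al_mod8 u v hu hv
  obtain ⟨e3, he3⟩ := al_mod3 u v h3 hv3
  refine core (al u v) (al u v) 1 xx _ K e e3 648 (HH u v) y xx_adj (by norm_num) 4 (by norm_num)
    ?_ (by ring) hy0 hy xx_pos hK he3 (al_mod17 u v h17)
  rw [main_id, ← hf]
  push_cast; ring

lemma caseB (u v y : ℤ) (a : Q5 ℤ) (ha : al u v = ta ^ 2 * a)
    (hK : ∃ K e : Q5 ℤ, a * K ^ 2 = ⟨5, 4, 1, 0, 3⟩ + 8 * e) (h3 : (u : ZMod 3) = 2 * (v : ZMod 3))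
    (hv3 : (v : ZMod 3) ≠ 0) (h17 : ¬ ((u : ZMod 17) = 0 ∧ (v : ZMod 17) = 0))
    (hf : 65536 * y ^ 2 = FF u v) (hy0 : y ≠ 0) (hy : IsCoprime y (30 * HH u v)) : False := by
  obtain ⟨K, e, hK⟩ := hK
  obtain ⟨e3, he3⟩ := al_mod3 u v h3 hv3
  have e1 := xx_adj
  have e2 := ta_adj
  push_cast at e1 e2
  have hta : σ1 ta ≠ 0 := by
    intro h0
    have := congrArg σ1 e2
    rw [map_mul, h0, zero_mul] at this
    simp only [map_neg, map_ofNat] at this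
    norm_num at this
  refine core (al u v) a ta (xx * ta ^ 2) (⟨-3807, -2106, 108, -54, -189⟩ * ⟨64, 128, 64, 0, 0⟩ ^ 2) K e e3
    (648 * 65536) (HH u v) y ?_ (by norm_num) 19 (by norm_num)
    ?_ ha hy0 hy ?_ hK he3 (al_mod17 u v h17)
  · push_cast
    linear_combination (ta * ⟨64, 128, 64, 0, 0⟩) ^ 2 * e1 + 648 * (ta * ⟨64, 128, 64, 0, 0⟩ - 256) * e2
  · have := main_id u v
    rw [mul_assoc xx, ← ha, main_id, ← hf]
    push_cast; ring
  · rw [map_mul, map_pow]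
    have := xx_pos
    positivity

end C16

end


section
set_option maxHeartbeats 4000000
namespace C16
open Q5

lemma odd_val (p : ℕ) (hp : p.Prime) (k : ℕ) (y m : ℤ) (h : y ^ 2 = (p : ℤ) ^ (2 * k + 1) * m)
    (hm : ¬ (p : ℤ) ∣ m) : False := by
  have : Fact p.Prime := ⟨hp⟩
  have hm0 : m ≠ 0 := by rintro rfl; exact hm (dvd_zero _)
  have hp0 : (p : ℤ) ≠ 0 := by exact_mod_cast hp.ne_zero
  have hy0 : y ≠ 0 := by
    rintro rfl
    have : (p : ℤ) ^ (2 * k + 1) * m ≠ 0 := mul_ne_zero (pow_ne_zero _ hp0) hm0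
    rw [← h] at this; simp at this
  have h1 := congrArg (padicValInt p) h
  rw [sq, padicValInt.mul hy0 hy0, padicValInt.mul (pow_ne_zero _ hp0) hm0,
    padicValInt.eq_zero_of_not_dvd hm] at h1
  have h2 : padicValInt p ((p : ℤ) ^ (2 * k + 1)) = 2 * k + 1 := by
    have : (p : ℤ) ^ (2 * k + 1) = ((p ^ (2 * k + 1) : ℕ) : ℤ) := by push_cast; rfl
    rw [this, padicValInt.of_nat, padicValNat.prime_pow]
  omega

lemma FF_cast (n : ℕ) (u v : ℤ) : ((FF u v : ℤ) : ZMod n) = FF (u : ZMod n) (v : ZMod n) := by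
  simp only [FF]; push_cast; rfl

lemma HH_cast (n : ℕ) (u v : ℤ) : ((HH u v : ℤ) : ZMod n) = HH (u : ZMod n) (v : ZMod n) := by
  simp only [HH]; push_cast; rfl

/-- The form `f(v + 2w, v) / 2^16`. -/
def F2 {A : Type} [CommRing A] (w v : A) : A :=
  -64150629 * v ^ 30 - 1710723885 * w * v ^ 29 - 19055494725 * w ^ 2 * v ^ 28 - 87239523470 * w ^ 3 * v ^ 27
    + 387864053370 * w ^ 4 * v ^ 26 + 9833607205560 * w ^ 5 * v ^ 25 + 89823616641900 * w ^ 6 * v ^ 24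
    + 554677054988400 * w ^ 7 * v ^ 23 + 2626892365788000 * w ^ 8 * v ^ 22 + 10066511166613200 * w ^ 9 * v ^ 21
    + 32163522487101360 * w ^ 10 * v ^ 20 + 87345666205999200 * w ^ 11 * v ^ 19 + 204287201109477600 * w ^ 12 * v ^ 18
    + 415309187336659200 * w ^ 13 * v ^ 17 + 738508863339921600 * w ^ 14 * v ^ 16 + 1153090576114997760 * w ^ 15 * v ^ 15
    + 1583622943431033600 * w ^ 16 * v ^ 14 + 1912783478595206400 * w ^ 17 * v ^ 13 + 2028230784152582400 * w ^ 18 * v ^ 12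
    + 1881668567135116800 * w ^ 19 * v ^ 11 + 1519961450591393280 * w ^ 20 * v ^ 10 + 1062215379100416000 * w ^ 21 * v ^ 9
    + 637046241622041600 * w ^ 22 * v ^ 8 + 324557063684812800 * w ^ 23 * v ^ 7 + 138657892571136000 * w ^ 24 * v ^ 6
    + 48834863358160896 * w ^ 25 * v ^ 5 + 13848600990781440 * w ^ 26 * v ^ 4 + 3052970979532800 * w ^ 27 * v ^ 3
    + 493786343546880 * w ^ 28 * v ^ 2 + 52445938974720 * w ^ 29 * v + 2759962542080 * w ^ 30

lemma F2_eq (w v : ℤ) : FF (v + 2 * w) v = 65536 * F2 w v := by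
  simp only [FF, F2]; ring

lemma F2_cast (n : ℕ) (u v : ℤ) : ((F2 u v : ℤ) : ZMod n) = F2 (u : ZMod n) (v : ZMod n) := by
  simp only [F2]; push_cast; rfl

lemma no3a (y w v : ℤ) (hv : ¬ (3 : ℤ) ∣ v) (h : y ^ 2 = FF (3 * w) v) : False := by
  refine odd_val 3 (by norm_num) 4 y (1 * v ^ 30 + 3 * (-30 * w * v ^ 29 - 1305 * w ^ 2 * v ^ 28 - 20880 * w ^ 3 * v ^ 27 - 152685 * w ^ 4 * v ^ 26 - 634230 * w ^ 5 * v ^ 25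
    - 5461425 * w ^ 6 * v ^ 24 - 109933200 * w ^ 7 * v ^ 23 - 1495197225 * w ^ 8 * v ^ 22 - 14028110550 * w ^ 9 * v ^ 21
    - 102118323645 * w ^ 10 * v ^ 20 - 609165230400 * w ^ 11 * v ^ 19 - 2912243043825 * w ^ 12 * v ^ 18
    - 11037837660750 * w ^ 13 * v ^ 17 - 37210608656325 * w ^ 14 * v ^ 16 - 140446194723360 * w ^ 15 * v ^ 15
    - 615406220085375 * w ^ 16 * v ^ 14 - 2447818229165850 * w ^ 17 * v ^ 13 - 7012936928256075 * w ^ 18 * v ^ 12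
    - 11049716382742800 * w ^ 19 * v ^ 11 + 3679607237346585 * w ^ 20 * v ^ 10 + 70018916073155550 * w ^ 21 * v ^ 9
    + 209862223315771725 * w ^ 22 * v ^ 8 + 439300586554772400 * w ^ 23 * v ^ 7 + 841339557981640125 * w ^ 24 * v ^ 6
    + 1611143990461720206 * w ^ 25 * v ^ 5 + 2897159808397397985 * w ^ 26 * v ^ 4 + 3943818607718849760 * w ^ 27 * v ^ 3
    + 3165398945949354885 * w ^ 28 * v ^ 2 + 1567251254346471270 * w ^ 29 * v + 587365377140432745 * w ^ 30)) ?_ ?_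
  · rw [h]; simp only [FF]; push_cast; ring
  · intro hd
    rw [Nat.cast_ofNat] at hd
    have h1 := (Int.dvd_iff_dvd_of_dvd_add hd).2 (dvd_mul_right _ _)
    have h2 : (3 : ℤ) ∣ v ^ 30 := by
      refine IsCoprime.dvd_of_dvd_mul_left ?_ h1
      norm_num
    exact hv (Int.Prime.dvd_pow' (by norm_num) h2)

lemma no3b (y w v : ℤ) (hv : ¬ (3 : ℤ) ∣ v) (h : y ^ 2 = FF (v + 3 * w) v) : False := by
  refine odd_val 3 (by norm_num) 0 y (1 * v ^ 30 + 3 * (-467130624683 * v ^ 30 - 18685666754560 * w * v ^ 29 - 312205225574400 * w ^ 2 * v ^ 28 - 2143998528798720 * w ^ 3 * v ^ 27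
    + 14298220463431680 * w ^ 4 * v ^ 26 + 543759144038645760 * w ^ 5 * v ^ 25 + 7450330058745753600 * w ^ 6 * v ^ 24
    + 69010700473436774400 * w ^ 7 * v ^ 23 + 490241160872819712000 * w ^ 8 * v ^ 22 + 2817978869937032755200 * w ^ 9 * v ^ 21
    + 13505591746423809469440 * w ^ 10 * v ^ 20 + 55015191933845832115200 * w ^ 11 * v ^ 19 + 193007279013016684838400 * w ^ 12 * v ^ 18
    + 588566212873017338419200 * w ^ 13 * v ^ 17 + 1569895555368925100102400 * w ^ 14 * v ^ 16
    + 3676797653166783147432960 * w ^ 15 * v ^ 15 + 7574419446119387346758400 * w ^ 16 * v ^ 14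
    + 13723176122749553639702400 * w ^ 17 * v ^ 13 + 21827171172256859000577600 * w ^ 18 * v ^ 12
    + 30374873183975678322004800 * w ^ 19 * v ^ 11 + 36804013028079182733057120 * w ^ 20 * v ^ 10
    + 38580375149475332514696000 * w ^ 21 * v ^ 9 + 34706920281303306072704400 * w ^ 22 * v ^ 8
    + 26523293130247707460432800 * w ^ 23 * v ^ 7 + 16996998406379441753304000 * w ^ 24 * v ^ 6
    + 8979432176014552699153416 * w ^ 25 * v ^ 5 + 3819583944078827590993860 * w ^ 26 * v ^ 4 + 1263060320272548694242300 * w ^ 27 * v ^ 3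
    + 306430330360678294688370 * w ^ 28 * v ^ 2 + 48819777873950990401920 * w ^ 29 * v + 3853704239418379239945 * w ^ 30)) ?_ ?_
  · rw [h]; simp only [FF]; push_cast; ring
  · intro hd
    rw [Nat.cast_ofNat] at hd
    have h1 := (Int.dvd_iff_dvd_of_dvd_add hd).2 (dvd_mul_right _ _)
    have h2 : (3 : ℤ) ∣ v ^ 30 := by
      refine IsCoprime.dvd_of_dvd_mul_left ?_ h1
      norm_num
    exact hv (Int.Prime.dvd_pow' (by norm_num) h2)

lemma no5a (y w v : ℤ) (hv : ¬ (5 : ℤ) ∣ v) (h : y ^ 2 = FF (-v + 5 * w) v) : False := by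
  refine odd_val 5 (by norm_num) 2 y (2 * v ^ 30 + 5 * (-170394 * v ^ 30 + 16220160 * w * v ^ 29 - 748339200 * w ^ 2 * v ^ 28 + 22390784000 * w ^ 3 * v ^ 27
    - 493102080000 * w ^ 4 * v ^ 26 + 8659353600000 * w ^ 5 * v ^ 25 - 128797862400000 * w ^ 6 * v ^ 24
    + 1693084032000000 * w ^ 7 * v ^ 23 - 20054822400000000 * w ^ 8 * v ^ 22 + 213465079200000000 * w ^ 9 * v ^ 21
    - 2011756575600000000 * w ^ 10 * v ^ 20 + 16512344046000000000 * w ^ 11 * v ^ 19 - 116402962395000000000 * w ^ 12 * v ^ 18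
    + 696027139650000000000 * w ^ 13 * v ^ 17 - 3478146829312500000000 * w ^ 14 * v ^ 16 + 14174348132250000000000 * w ^ 15 * v ^ 15
    - 44679299110312500000000 * w ^ 16 * v ^ 14 + 92361309138281250000000 * w ^ 17 * v ^ 13 - 8002331197265625000000 * w ^ 18 * v ^ 12
    - 947473363212890625000000 * w ^ 19 * v ^ 11 + 5036215882719726562500000 * w ^ 20 * v ^ 10
    - 17029749095800781250000000 * w ^ 21 * v ^ 9 + 43421348872375488281250000 * w ^ 22 * v ^ 8
    - 87493008301391601562500000 * w ^ 23 * v ^ 7 + 141504035751342773437500000 * w ^ 24 * v ^ 6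
    - 184317509785308837890625000 * w ^ 25 * v ^ 5 + 192684573698043823242187500 * w ^ 26 * v ^ 4
    - 159592213315963745117187500 * w ^ 27 * v ^ 3 + 100954097628593444824218750 * w ^ 28 * v ^ 2
    - 44169337034225463867187500 * w ^ 29 * v + 10040685236454010009765625 * w ^ 30)) ?_ ?_
  · rw [h]; simp only [FF]; push_cast; ring
  · intro hd
    rw [Nat.cast_ofNat] at hd
    have h1 := (Int.dvd_iff_dvd_of_dvd_add hd).2 (dvd_mul_right _ _)
    have h2 : (5 : ℤ) ∣ v ^ 30 := by
      refine IsCoprime.dvd_of_dvd_mul_left ?_ h1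
      norm_num
    exact hv (Int.Prime.dvd_pow' (by norm_num) h2)

lemma no5b (y u w : ℤ) (hu : ¬ (5 : ℤ) ∣ u) (h : y ^ 2 = FF u (5 * w)) : False := by
  refine odd_val 5 (by norm_num) 0 y (-1 * u ^ 30 + 5 * (733248889446258544921875 * w ^ 30 - 4399493336677551269531250 * u * w ^ 29 - 12758530676364898681640625 * u ^ 2 * w ^ 28
    - 13609099388122558593750000 * u ^ 3 * w ^ 27 - 6634435951709747314453125 * u ^ 4 * w ^ 26
    - 1837228417396545410156250 * u ^ 5 * w ^ 25 - 1054705202579498291015625 * u ^ 6 * w ^ 24 - 1415346336364746093750000 * u ^ 7 * w ^ 23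
    - 1283338072299957275390625 * u ^ 8 * w ^ 22 - 802694924354553222656250 * u ^ 9 * w ^ 21 - 389550489978790283203125 * u ^ 10 * w ^ 20
    - 154918729248046875000000 * u ^ 11 * w ^ 19 - 49374780338287353515625 * u ^ 12 * w ^ 18 - 12475854560852050781250 * u ^ 13 * w ^ 17
    - 2803895448760986328125 * u ^ 14 * w ^ 16 - 705527196679687500000 * u ^ 15 * w ^ 15 - 206098297943115234375 * u ^ 16 * w ^ 14
    - 54651291481933593750 * u ^ 17 * w ^ 13 - 10438303946044921875 * u ^ 18 * w ^ 12 - 1096452639843750000 * u ^ 19 * w ^ 11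
    + 24341590494140625 * u ^ 20 * w ^ 10 + 30879596144531250 * u ^ 21 * w ^ 9 + 6170199964453125 * u ^ 22 * w ^ 8
    + 861064121250000 * u ^ 23 * w ^ 7 + 109939500703125 * u ^ 24 * w ^ 6 + 14035424357250 * u ^ 25 * w ^ 5
    + 1682567069625 * u ^ 26 * w ^ 4 + 152695277600 * u ^ 27 * w ^ 3 + 8170447965 * u ^ 28 * w ^ 2
    + 269689962 * u ^ 29 * w + 6738190 * u ^ 30)) ?_ ?_
  · rw [h]; simp only [FF]; push_cast; ring
  · intro hd
    rw [Nat.cast_ofNat] at hd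
    have h1 := (Int.dvd_iff_dvd_of_dvd_add hd).2 (dvd_mul_right _ _)
    have h2 : (5 : ℤ) ∣ u ^ 30 := by
      refine IsCoprime.dvd_of_dvd_mul_left ?_ h1
      norm_num
    exact hu (Int.Prime.dvd_pow' (by norm_num) h2)

end C16

end


section
set_option maxHeartbeats 4000000
namespace C16
open Q5

/-- The form `h_u / 12`. -/
def AA {A : Type} [CommRing A] (u v : A) : A :=
  -27 * v ^ 11 - 297 * u * v ^ 10 - 1485 * u ^ 2 * v ^ 9 - 1485 * u ^ 3 * v ^ 8 + 2970 * u ^ 4 * v ^ 7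
    + 11286 * u ^ 5 * v ^ 6 + 15246 * u ^ 6 * v ^ 5 + 20790 * u ^ 7 * v ^ 4 + 23265 * u ^ 8 * v ^ 3
    + 8195 * u ^ 9 * v ^ 2 - 737 * u ^ 10 * v - 1657 * u ^ 11

/-- The form `h_v / 12`. -/
def BB {A : Type} [CommRing A] (u v : A) : A :=
  -81 * v ^ 11 - 297 * u * v ^ 10 - 1485 * u ^ 2 * v ^ 9 - 4455 * u ^ 3 * v ^ 8 - 2970 * u ^ 4 * v ^ 7
    + 4158 * u ^ 5 * v ^ 6 + 11286 * u ^ 6 * v ^ 5 + 10890 * u ^ 7 * v ^ 4 + 10395 * u ^ 8 * v ^ 3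
    + 7755 * u ^ 9 * v ^ 2 + 1639 * u ^ 10 * v - 67 * u ^ 11

lemma euler {A : Type} [CommRing A] (u v : A) : HH u v = u * AA u v + v * BB u v := by
  simp only [HH, AA, BB]; ring

lemma FF_mod_HH {A : Type} [CommRing A] (u v : A) : v ^ 3 * FF u v = -AA u v ^ 3 + HH u v *
    (15309 * u * v ^ 20 + 172773 * u ^ 2 * v ^ 19 + 781488 * u ^ 3 * v ^ 18 + 1183167 * u ^ 4 * v ^ 17
    - 2084211 * u ^ 5 * v ^ 16 - 12185964 * u ^ 6 * v ^ 15 - 19350576 * u ^ 7 * v ^ 14 + 1455084 * u ^ 8 * v ^ 13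
    + 73031706 * u ^ 9 * v ^ 12 + 216848502 * u ^ 10 * v ^ 11 + 455788944 * u ^ 11 * v ^ 10 + 715707954 * u ^ 12 * v ^ 9
    + 851669154 * u ^ 13 * v ^ 8 + 833292036 * u ^ 14 * v ^ 7 + 620456112 * u ^ 15 * v ^ 6 + 244153116 * u ^ 16 * v ^ 5
    - 24069447 * u ^ 17 * v ^ 4 - 74894067 * u ^ 18 * v ^ 3 - 23944128 * u ^ 19 * v ^ 2 + 2331399 * u ^ 20 * v
    + 2745649 * u ^ 21) := by
  simp only [FF, HH, AA]; ring

lemma bezout {A : Type} [CommRing A] (u v : A) :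
    (-938826477 * v ^ 10 + 5106104091 * u * v ^ 9 - 140674716666 * u ^ 2 * v ^ 8 - 176748357258 * u ^ 3 * v ^ 7
    + 7245120894 * u ^ 4 * v ^ 6 + 347840134620 * u ^ 5 * v ^ 5 + 336501439296 * u ^ 6 * v ^ 4
    + 336340777234 * u ^ 7 * v ^ 3 + 329879695167 * u ^ 8 * v ^ 2 + 78447903809 * u ^ 9 * v - 3149565078 * u ^ 10) * AA u v +
    (-9640337841 * v ^ 10 + 37088234469 * u * v ^ 9 + 86130343332 * u ^ 2 * v ^ 8 + 32779681044 * u ^ 3 * v ^ 7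
    - 288959103840 * u ^ 4 * v ^ 6 - 400060733358 * u ^ 5 * v ^ 5 - 539231910206 * u ^ 6 * v ^ 4
    - 921827429028 * u ^ 7 * v ^ 3 - 390839584311 * u ^ 8 * v ^ 2 - 5386535 * u ^ 9 * v + 77892975138 * u ^ 10) * BB u v = 2 ^ 16 * 3 ^ 9 * 5 ^ 4 * v ^ 21 := by
  simp only [AA, BB]; ring

lemma coprime_FH (u v : ℤ) (huv : IsCoprime u v) (p : ℕ) (hp : p.Prime) (h2 : p ≠ 2) (h3 : p ≠ 3)
    (h5 : p ≠ 5) (hF : (p : ℤ) ∣ FF u v) (hH : (p : ℤ) ∣ HH u v) : False := by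
  have : Fact p.Prime := ⟨hp⟩
  rw [← ZMod.intCast_zmod_eq_zero_iff_dvd, FF_cast] at hF
  rw [← ZMod.intCast_zmod_eq_zero_iff_dvd, HH_cast] at hH
  have huv' : (u : ZMod p) ≠ 0 ∨ (v : ZMod p) ≠ 0 := by
    by_contra! hc
    obtain ⟨s, t, hst⟩ := huv
    have := congrArg (fun z : ℤ => (z : ZMod p)) hst
    push_cast at this
    rw [hc.1, hc.2] at this
    simp at this
  generalize (u : ZMod p) = U at *
  generalize (v : ZMod p) = V at *
  have prime_ne : ∀ q : ℕ, q.Prime → p ≠ q → ((q : ℕ) : ZMod p) ≠ 0 := by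
    intro q hq hpq h
    rw [ZMod.natCast_eq_zero_iff] at h
    exact hpq ((Nat.prime_dvd_prime_iff_eq hp hq).1 h)
  have n2 : (2 : ZMod p) ≠ 0 := by exact_mod_cast prime_ne 2 (by norm_num) h2
  have n3 : (3 : ZMod p) ≠ 0 := by exact_mod_cast prime_ne 3 (by norm_num) h3
  have n5 : (5 : ZMod p) ≠ 0 := by exact_mod_cast prime_ne 5 (by norm_num) h5
  by_cases hV : V = 0
  · subst hV
    have hU : U ≠ 0 := by simpa using huv'
    have e1 : (1657 : ZMod p) = 0 := by
      have : (1657 : ZMod p) * U ^ 12 = 0 := by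
        rw [← neg_eq_zero, ← hH]; simp only [HH]; ring
      exact (mul_eq_zero.1 this).resolve_right (pow_ne_zero _ hU)
    have e2 : (168454745 : ZMod p) = 0 := by
      have : (168454745 : ZMod p) * U ^ 30 = 0 := by
        rw [← hF]; simp only [FF]; ring
      exact (mul_eq_zero.1 this).resolve_right (pow_ne_zero _ hU)
    have : (1 : ZMod p) = 0 := by linear_combination (-28872147) * e1 + (284) * e2
    exact one_ne_zero this
  · have hA : AA U V = 0 := by
      have := FF_mod_HH U V
      rw [hF, hH] at this
      simpa using this
    have hB : BB U V = 0 := by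
      have := euler U V
      rw [hH, hA] at this
      simpa [hV] using this
    have := bezout U V
    rw [hA, hB, mul_zero, mul_zero, add_zero] at this
    exact (mul_ne_zero (mul_ne_zero (mul_ne_zero (pow_ne_zero _ n2) (pow_ne_zero _ n3)) (pow_ne_zero _ n5))
      (pow_ne_zero _ hV)) this.symm

end C16

end


section
namespace C16
open Q5

lemma loc3 (u v y : ℤ) (huv : IsCoprime u v) (h : y ^ 2 = FF u v) :
    (u : ZMod 3) = 2 * (v : ZMod 3) ∧ (v : ZMod 3) ≠ 0 ∧ ¬ (3 : ℤ) ∣ y := by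
  have key : ∀ u v : ZMod 3, (u ≠ 0 ∨ v ≠ 0) → ∀ y : ZMod 3, y ^ 2 = FF u v →
      (u = 0 ∧ v ≠ 0) ∨ (u = v ∧ v ≠ 0) ∨ (u = 2 * v ∧ v ≠ 0 ∧ y ≠ 0) := by decide +kernel
  have hne : (u : ZMod 3) ≠ 0 ∨ (v : ZMod 3) ≠ 0 := by
    by_contra! hc
    obtain ⟨s, t, hst⟩ := huv
    have := congrArg (fun z : ℤ => (z : ZMod 3)) hst
    push_cast at this
    rw [hc.1, hc.2] at this
    simp at this
  have h' := congrArg (fun z : ℤ => (z : ZMod 3)) h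
  simp only [FF_cast] at h'
  push_cast at h'
  have dv : ∀ z : ℤ, (z : ZMod 3) ≠ 0 → ¬ (3 : ℤ) ∣ z := by
    intro z hz hd
    exact hz ((ZMod.intCast_zmod_eq_zero_iff_dvd z 3).2 hd)
  rcases key _ _ hne _ h' with ⟨a, b⟩ | ⟨a, b⟩ | ⟨a, b, c⟩
  · obtain ⟨w, rfl⟩ := (ZMod.intCast_zmod_eq_zero_iff_dvd u 3).1 a
    exact (no3a y w v (dv v b) (by simpa using h)).elim
  · obtain ⟨w, hw⟩ := (ZMod.intCast_eq_intCast_iff_dvd_sub v u 3).1 a.symm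
    have : u = v + 3 * w := by push_cast at hw; linarith
    rw [this] at h
    exact (no3b y w v (dv v b) h).elim
  · exact ⟨a, b, dv y c⟩

lemma loc5 (u v y : ℤ) (huv : IsCoprime u v) (h : y ^ 2 = FF u v) : ¬ (5 : ℤ) ∣ y := by
  have key : ∀ u v : ZMod 5, (u ≠ 0 ∨ v ≠ 0) → ∀ y : ZMod 5, y ^ 2 = FF u v →
      (v = 0 ∧ u ≠ 0) ∨ (u = -v ∧ v ≠ 0) ∨ (y ≠ 0) := by decide +kernel
  have hne : (u : ZMod 5) ≠ 0 ∨ (v : ZMod 5) ≠ 0 := by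
    by_contra! hc
    obtain ⟨s, t, hst⟩ := huv
    have := congrArg (fun z : ℤ => (z : ZMod 5)) hst
    push_cast at this
    rw [hc.1, hc.2] at this
    revert this; simp only [mul_zero, add_zero]; decide
  have h' := congrArg (fun z : ℤ => (z : ZMod 5)) h
  simp only [FF_cast] at h'
  push_cast at h'
  have dv : ∀ z : ℤ, (z : ZMod 5) ≠ 0 → ¬ (5 : ℤ) ∣ z := by
    intro z hz hd
    exact hz ((ZMod.intCast_zmod_eq_zero_iff_dvd z 5).2 hd)
  rcases key _ _ hne _ h' with ⟨a, b⟩ | ⟨a, b⟩ | c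
  · obtain ⟨w, rfl⟩ := (ZMod.intCast_zmod_eq_zero_iff_dvd v 5).1 a
    exact (no5b y u w (dv u b) (by simpa using h)).elim
  · obtain ⟨w, hw⟩ := (ZMod.intCast_eq_intCast_iff_dvd_sub (-v) u 5).1 (by push_cast; exact a.symm)
    have : u = -v + 5 * w := by push_cast at hw; linarith
    rw [this] at h
    exact (no5a y w v (dv v b) h).elim
  · exact dv y c

lemma cop (u v y y' : ℤ) (huv : IsCoprime u v) (h : y ^ 2 = FF u v) (hd : y' ∣ y) (h2 : ¬ (2 : ℤ) ∣ y') :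
    IsCoprime y' (30 * HH u v) := by
  rw [Int.isCoprime_iff_gcd_eq_one]
  by_contra hg
  obtain ⟨p, hp, hpd⟩ := Nat.exists_prime_and_dvd hg
  have hpi : Prime (p : ℤ) := Nat.prime_iff_prime_int.1 hp
  have hd' : (p : ℤ) ∣ (Int.gcd y' (30 * HH u v) : ℤ) := by exact_mod_cast hpd
  have p1 : (p : ℤ) ∣ y' := hd'.trans (Int.gcd_dvd_left ..)
  have p2 : (p : ℤ) ∣ 30 * HH u v := hd'.trans (Int.gcd_dvd_right ..)
  have py : (p : ℤ) ∣ y := p1.trans hd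
  have n2 : p ≠ 2 := by rintro rfl; exact h2 p1
  have n3 : p ≠ 3 := by rintro rfl; exact (loc3 u v y huv h).2.2 py
  have n5 : p ≠ 5 := by rintro rfl; exact loc5 u v y huv h py
  have hH : (p : ℤ) ∣ HH u v := by
    rcases hpi.dvd_or_dvd p2 with h30 | h'
    · exfalso
      have : p ∣ 2 * 3 * 5 := by
        have : (p : ℤ) ∣ ((30 : ℕ) : ℤ) := h30
        exact_mod_cast this
      rcases (Nat.Prime.dvd_mul hp).1 this with h6 | h6
      · rcases (Nat.Prime.dvd_mul hp).1 h6 with h7 | h7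
        · exact n2 ((Nat.prime_dvd_prime_iff_eq hp (by norm_num)).1 h7)
        · exact n3 ((Nat.prime_dvd_prime_iff_eq hp (by norm_num)).1 h7)
      · exact n5 ((Nat.prime_dvd_prime_iff_eq hp (by norm_num)).1 h6)
    · exact h'
  have hF : (p : ℤ) ∣ FF u v := by rw [← h]; exact dvd_pow py two_ne_zero
  exact coprime_FH u v huv p hp n2 n3 n5 hF hH

lemma no_coprime (u v y : ℤ) (huv : IsCoprime u v) (h : y ^ 2 = FF u v) : False := by
  obtain ⟨h3, hv3, -⟩ := loc3 u v y huv h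
  have h17 : ¬ ((u : ZMod 17) = 0 ∧ (v : ZMod 17) = 0) := by
    rintro ⟨a, b⟩
    obtain ⟨s, t, hst⟩ := huv
    have := congrArg (fun z : ℤ => (z : ZMod 17)) hst
    push_cast at this
    rw [a, b] at this
    revert this; simp only [mul_zero, add_zero]; decide
  rcases Int.even_or_odd u with hu | hu
  · have hv : Odd v := by
      rw [← Int.not_even_iff_odd]
      intro hv
      obtain ⟨s, t, hst⟩ := huv
      obtain ⟨a, rfl⟩ := hu
      obtain ⟨b, rfl⟩ := hv
      have : 2 * (s * a + t * b) = 1 := by linarith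
      omega
    have key : ∀ u v : ZMod 4, 2 * u = 0 → 2 * v = 2 → ∀ y : ZMod 4, y ^ 2 ≠ FF u v := by decide +kernel
    have h' := congrArg (fun z : ℤ => (z : ZMod 4)) h
    simp only [FF_cast] at h'
    push_cast at h'
    have e4 : (4 : ZMod 4) = 0 := by decide
    obtain ⟨a, rfl⟩ := hu
    obtain ⟨b, rfl⟩ := hv
    exact key _ _ (by push_cast; linear_combination (a : ZMod 4) * e4)
      (by push_cast; linear_combination (b : ZMod 4) * e4) _ h'
  rcases Int.even_or_odd v with hv | hv
  · have y2 : ¬ (2 : ℤ) ∣ y := by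
      have key : ∀ u v : ZMod 2, u = 1 → v = 0 → ∀ y : ZMod 2, y ^ 2 = FF u v → y ≠ 0 := by decide +kernel
      have h' := congrArg (fun z : ℤ => (z : ZMod 2)) h
      simp only [FF_cast] at h'
      push_cast at h'
      intro hd
      exact key _ _ ((ZMod.intCast_eq_one_iff_odd).2 hu) ((ZMod.intCast_eq_zero_iff_even).2 hv) _ h'
        ((ZMod.intCast_zmod_eq_zero_iff_dvd y 2).2 hd)
    exact caseA u v y hu hv h3 hv3 h17 h (by rintro rfl; exact y2 (dvd_zero _))
      (cop u v y y huv h dvd_rfl y2)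
  · obtain ⟨w, hw⟩ : ∃ w, u = v + 2 * w := by
      obtain ⟨a, rfl⟩ := hu
      obtain ⟨b, rfl⟩ := hv
      exact ⟨a - b, by ring⟩
    have hF : FF u v = 65536 * F2 w v := by rw [hw, F2_eq]
    obtain ⟨y', rfl⟩ : (256 : ℤ) ∣ y := by
      rw [← Int.pow_dvd_pow_iff two_ne_zero, h, hF]
      exact ⟨F2 w v, by norm_num⟩
    have hy' : y' ^ 2 = F2 w v := by
      rw [hF] at h; linarith
    have key : ∀ w v : ZMod 8, 4 * v = 4 → ∀ y : ZMod 8, y ^ 2 = F2 w v →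
        4 * y ≠ 0 ∧ (w = v ∨ w = -2 * v) := by decide +kernel
    have h' := congrArg (fun z : ℤ => (z : ZMod 8)) hy'
    simp only [F2_cast] at h'
    push_cast at h'
    have e8 : (8 : ZMod 8) = 0 := by decide
    obtain ⟨k1, k2⟩ := key _ _ (by
      obtain ⟨b, rfl⟩ := hv
      push_cast; linear_combination (b : ZMod 8) * e8) _ h'
    have y2 : ¬ (2 : ℤ) ∣ y' := by
      rintro ⟨a, rfl⟩
      apply k1; push_cast; linear_combination (a : ZMod 8) * e8
    have hc := cop u v _ y' huv h (dvd_mul_left _ _) y2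
    have hy0 : y' ≠ 0 := by rintro rfl; exact y2 (dvd_zero _)
    have hf : 65536 * y' ^ 2 = FF u v := by rw [← h]; ring
    rcases k2 with k2 | k2
    · obtain ⟨z, hz⟩ := (ZMod.intCast_eq_intCast_iff_dvd_sub v w 8).1 k2.symm
      have hu' : u = 3 * v + 16 * z := by push_cast at hz; linarith
      exact caseB u v y' (bl z v) (by rw [hu', bl_eq]) (bl_mod8 z v hv) h3 hv3 h17 hf hy0 hc
    · obtain ⟨z, hz⟩ := (ZMod.intCast_eq_intCast_iff_dvd_sub (-2 * v) w 8).1 (by push_cast; exact k2.symm)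
      have hu' : u = -3 * v + 16 * z := by push_cast at hz; linarith
      exact caseB u v y' (cl z v) (by rw [hu', cl_eq]) (cl_mod8 z v hv) h3 hv3 h17 hf hy0 hc

lemma no_points (u v y : ℤ) (huv : ¬ (u = 0 ∧ v = 0)) (h : y ^ 2 = FF u v) : False := by
  have hg : Int.gcd u v ≠ 0 := by
    rw [Ne, Int.gcd_eq_zero_iff]; exact huv
  obtain ⟨g, u', v', hg', hco, hu, hv⟩ := Int.exists_gcd_one' (Nat.pos_of_ne_zero hg)
  have hs : FF u v = ((g : ℤ) ^ 15) ^ 2 * FF u' v' := by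
    rw [hu, hv]; simp only [FF]; ring
  have hg0 : (g : ℤ) ^ 15 ≠ 0 := pow_ne_zero _ (by exact_mod_cast hg'.ne')
  obtain ⟨z, rfl⟩ : (g : ℤ) ^ 15 ∣ y := by
    rw [← Int.pow_dvd_pow_iff two_ne_zero, h, hs]; exact dvd_mul_right _ _
  refine no_coprime u' v' z (Int.isCoprime_iff_gcd_eq_one.2 hco) ?_
  apply mul_left_cancel₀ (pow_ne_zero 2 hg0)
  rw [← hs, ← h]; ring

end C16

end


section
set_option maxHeartbeats 4000000
namespace C16

def Hu {A : Type} [CommRing A] (u v : A) : A :=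
  -324 * v ^ 11 - 3564 * u * v ^ 10 - 17820 * u ^ 2 * v ^ 9 - 17820 * u ^ 3 * v ^ 8 + 35640 * u ^ 4 * v ^ 7
     + 135432 * u ^ 5 * v ^ 6 + 182952 * u ^ 6 * v ^ 5 + 249480 * u ^ 7 * v ^ 4 + 279180 * u ^ 8 * v ^ 3
     + 98340 * u ^ 9 * v ^ 2 - 8844 * u ^ 10 * v - 19884 * u ^ 11

def Hv {A : Type} [CommRing A] (u v : A) : A :=
  -972 * v ^ 11 - 3564 * u * v ^ 10 - 17820 * u ^ 2 * v ^ 9 - 53460 * u ^ 3 * v ^ 8 - 35640 * u ^ 4 * v ^ 7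
     + 49896 * u ^ 5 * v ^ 6 + 135432 * u ^ 6 * v ^ 5 + 130680 * u ^ 7 * v ^ 4 + 124740 * u ^ 8 * v ^ 3
     + 93060 * u ^ 9 * v ^ 2 + 19668 * u ^ 10 * v - 804 * u ^ 11

def Huu {A : Type} [CommRing A] (u v : A) : A :=
  -3564 * v ^ 10 - 35640 * u * v ^ 9 - 53460 * u ^ 2 * v ^ 8 + 142560 * u ^ 3 * v ^ 7 + 677160 * u ^ 4 * v ^ 6
     + 1097712 * u ^ 5 * v ^ 5 + 1746360 * u ^ 6 * v ^ 4 + 2233440 * u ^ 7 * v ^ 3 + 885060 * u ^ 8 * v ^ 2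
     - 88440 * u ^ 9 * v - 218724 * u ^ 10

def Huv {A : Type} [CommRing A] (u v : A) : A :=
  -3564 * v ^ 10 - 35640 * u * v ^ 9 - 160380 * u ^ 2 * v ^ 8 - 142560 * u ^ 3 * v ^ 7 + 249480 * u ^ 4 * v ^ 6
     + 812592 * u ^ 5 * v ^ 5 + 914760 * u ^ 6 * v ^ 4 + 997920 * u ^ 7 * v ^ 3 + 837540 * u ^ 8 * v ^ 2
     + 196680 * u ^ 9 * v - 8844 * u ^ 10

def Hvv {A : Type} [CommRing A] (u v : A) : A :=
  -10692 * v ^ 10 - 35640 * u * v ^ 9 - 160380 * u ^ 2 * v ^ 8 - 427680 * u ^ 3 * v ^ 7 - 249480 * u ^ 4 * v ^ 6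
     + 299376 * u ^ 5 * v ^ 5 + 677160 * u ^ 6 * v ^ 4 + 522720 * u ^ 7 * v ^ 3 + 374220 * u ^ 8 * v ^ 2
     + 186120 * u ^ 9 * v + 19668 * u ^ 10

def GG {A : Type} [CommRing A] (u v : A) : A :=
  1458 * v ^ 20 + 14580 * u * v ^ 19 - 277020 * u ^ 3 * v ^ 17 - 1246590 * u ^ 4 * v ^ 16 - 2881008 * u ^ 5 * v ^ 15
     - 5909760 * u ^ 6 * v ^ 14 - 12927600 * u ^ 7 * v ^ 13 - 27609660 * u ^ 8 * v ^ 12 - 52551720 * u ^ 9 * v ^ 11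
     - 71278272 * u ^ 10 * v ^ 10 - 53618760 * u ^ 11 * v ^ 9 - 15338700 * u ^ 12 * v ^ 8 + 3324240 * u ^ 13 * v ^ 7
     - 10177920 * u ^ 14 * v ^ 6 - 28544688 * u ^ 15 * v ^ 5 - 28175670 * u ^ 16 * v ^ 4 - 14381100 * u ^ 17 * v ^ 3
     - 6013120 * u ^ 18 * v ^ 2 - 2236540 * u ^ 19 * v - 251382 * u ^ 20

def Gu {A : Type} [CommRing A] (u v : A) : A :=
  14580 * v ^ 19 - 831060 * u ^ 2 * v ^ 17 - 4986360 * u ^ 3 * v ^ 16 - 14405040 * u ^ 4 * v ^ 15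
     - 35458560 * u ^ 5 * v ^ 14 - 90493200 * u ^ 6 * v ^ 13 - 220877280 * u ^ 7 * v ^ 12 - 472965480 * u ^ 8 * v ^ 11
     - 712782720 * u ^ 9 * v ^ 10 - 589806360 * u ^ 10 * v ^ 9 - 184064400 * u ^ 11 * v ^ 8 + 43215120 * u ^ 12 * v ^ 7
     - 142490880 * u ^ 13 * v ^ 6 - 428170320 * u ^ 14 * v ^ 5 - 450810720 * u ^ 15 * v ^ 4 - 244478700 * u ^ 16 * v ^ 3
     - 108236160 * u ^ 17 * v ^ 2 - 42494260 * u ^ 18 * v - 5027640 * u ^ 19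

def Gv {A : Type} [CommRing A] (u v : A) : A :=
  29160 * v ^ 19 + 277020 * u * v ^ 18 - 4709340 * u ^ 3 * v ^ 16 - 19945440 * u ^ 4 * v ^ 15
     - 43215120 * u ^ 5 * v ^ 14 - 82736640 * u ^ 6 * v ^ 13 - 168058800 * u ^ 7 * v ^ 12 - 331315920 * u ^ 8 * v ^ 11
     - 578068920 * u ^ 9 * v ^ 10 - 712782720 * u ^ 10 * v ^ 9 - 482568840 * u ^ 11 * v ^ 8 - 122709600 * u ^ 12 * v ^ 7
     + 23269680 * u ^ 13 * v ^ 6 - 61067520 * u ^ 14 * v ^ 5 - 142723440 * u ^ 15 * v ^ 4 - 112702680 * u ^ 16 * v ^ 3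
     - 43143300 * u ^ 17 * v ^ 2 - 12026240 * u ^ 18 * v - 2236540 * u ^ 19

lemma pd_lit {A K : Type} [CommRing A] [CommRing K] [Algebra K A] (D : Derivation K A A) (n : ℕ) [n.AtLeastTwo] :
    D (ofNat(n) : A) = 0 :=
  Derivation.map_natCast D n

lemma map_lit {A B : Type} [CommRing A] [CommRing B] (φ : A →+* B) (n : ℕ) [n.AtLeastTwo] :
    φ (ofNat(n) : A) = (ofNat(n) : B) :=
  map_natCast φ n

lemma pd00 : MvPolynomial.pderiv (0 : Fin 2) (MvPolynomial.X 0 : MvPolynomial (Fin 2) ℚ) = 1 :=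
  MvPolynomial.pderiv_X_self _
lemma pd11 : MvPolynomial.pderiv (1 : Fin 2) (MvPolynomial.X 1 : MvPolynomial (Fin 2) ℚ) = 1 :=
  MvPolynomial.pderiv_X_self _
lemma pd01 : MvPolynomial.pderiv (0 : Fin 2) (MvPolynomial.X 1 : MvPolynomial (Fin 2) ℚ) = 0 :=
  MvPolynomial.pderiv_X_of_ne (by decide)
lemma pd10 : MvPolynomial.pderiv (1 : Fin 2) (MvPolynomial.X 0 : MvPolynomial (Fin 2) ℚ) = 0 :=
  MvPolynomial.pderiv_X_of_ne (by decide)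

lemma D_HH {A K : Type} [CommRing A] [CommRing K] [Algebra K A] (D : Derivation K A A) (u v : A) :
    D (HH u v) = Hu u v * D u + Hv u v * D v := by
  simp only [HH, Hu, Hv, map_add, map_sub, map_neg, Derivation.leibniz, Derivation.leibniz_pow, pd_lit,
    smul_eq_mul, nsmul_eq_mul, Nat.cast_ofNat, Nat.cast_one]
  ring

lemma D_Hu {A K : Type} [CommRing A] [CommRing K] [Algebra K A] (D : Derivation K A A) (u v : A) :
    D (Hu u v) = Huu u v * D u + Huv u v * D v := by
  simp only [Hu, Huu, Huv, map_add, map_sub, map_neg, Derivation.leibniz, Derivation.leibniz_pow, pd_lit,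
    smul_eq_mul, nsmul_eq_mul, Nat.cast_ofNat, Nat.cast_one]
  ring

lemma D_Hv {A K : Type} [CommRing A] [CommRing K] [Algebra K A] (D : Derivation K A A) (u v : A) :
    D (Hv u v) = Huv u v * D u + Hvv u v * D v := by
  simp only [Hv, Huv, Hvv, map_add, map_sub, map_neg, Derivation.leibniz, Derivation.leibniz_pow, pd_lit,
    smul_eq_mul, nsmul_eq_mul, Nat.cast_ofNat, Nat.cast_one]
  ring

lemma D_GG {A K : Type} [CommRing A] [CommRing K] [Algebra K A] (D : Derivation K A A) (u v : A) :
    D (GG u v) = Gu u v * D u + Gv u v * D v := by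
  simp only [GG, Gu, Gv, map_add, map_sub, map_neg, Derivation.leibniz, Derivation.leibniz_pow, pd_lit,
    smul_eq_mul, nsmul_eq_mul, Nat.cast_ofNat, Nat.cast_one]
  ring

lemma d_Hu : MvPolynomial.pderiv (0 : Fin 2) (HH (MvPolynomial.X 0) (MvPolynomial.X 1) : MvPolynomial (Fin 2) ℚ) =
    Hu (MvPolynomial.X 0) (MvPolynomial.X 1) := by
  refine (D_HH (MvPolynomial.pderiv (R := ℚ) (0 : Fin 2)) (MvPolynomial.X 0) (MvPolynomial.X 1)).trans ?_
  rw [pd00, pd01]; simp only [mul_one, mul_zero, add_zero, zero_add]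

lemma d_Hv : MvPolynomial.pderiv (1 : Fin 2) (HH (MvPolynomial.X 0) (MvPolynomial.X 1) : MvPolynomial (Fin 2) ℚ) =
    Hv (MvPolynomial.X 0) (MvPolynomial.X 1) := by
  refine (D_HH (MvPolynomial.pderiv (R := ℚ) (1 : Fin 2)) (MvPolynomial.X 0) (MvPolynomial.X 1)).trans ?_
  rw [pd10, pd11]; simp only [mul_one, mul_zero, add_zero, zero_add]

lemma d_Huu : MvPolynomial.pderiv (0 : Fin 2) (Hu (MvPolynomial.X 0) (MvPolynomial.X 1) : MvPolynomial (Fin 2) ℚ) =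
    Huu (MvPolynomial.X 0) (MvPolynomial.X 1) := by
  refine (D_Hu (MvPolynomial.pderiv (R := ℚ) (0 : Fin 2)) (MvPolynomial.X 0) (MvPolynomial.X 1)).trans ?_
  rw [pd00, pd01]; simp only [mul_one, mul_zero, add_zero, zero_add]

lemma d_Huv : MvPolynomial.pderiv (1 : Fin 2) (Hu (MvPolynomial.X 0) (MvPolynomial.X 1) : MvPolynomial (Fin 2) ℚ) =
    Huv (MvPolynomial.X 0) (MvPolynomial.X 1) := by
  refine (D_Hu (MvPolynomial.pderiv (R := ℚ) (1 : Fin 2)) (MvPolynomial.X 0) (MvPolynomial.X 1)).trans ?_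
  rw [pd10, pd11]; simp only [mul_one, mul_zero, add_zero, zero_add]

lemma d_Hvv : MvPolynomial.pderiv (1 : Fin 2) (Hv (MvPolynomial.X 0) (MvPolynomial.X 1) : MvPolynomial (Fin 2) ℚ) =
    Hvv (MvPolynomial.X 0) (MvPolynomial.X 1) := by
  refine (D_Hv (MvPolynomial.pderiv (R := ℚ) (1 : Fin 2)) (MvPolynomial.X 0) (MvPolynomial.X 1)).trans ?_
  rw [pd10, pd11]; simp only [mul_one, mul_zero, add_zero, zero_add]

lemma d_Gu : MvPolynomial.pderiv (0 : Fin 2) (GG (MvPolynomial.X 0) (MvPolynomial.X 1) : MvPolynomial (Fin 2) ℚ) =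
    Gu (MvPolynomial.X 0) (MvPolynomial.X 1) := by
  refine (D_GG (MvPolynomial.pderiv (R := ℚ) (0 : Fin 2)) (MvPolynomial.X 0) (MvPolynomial.X 1)).trans ?_
  rw [pd00, pd01]; simp only [mul_one, mul_zero, add_zero, zero_add]

lemma d_Gv : MvPolynomial.pderiv (1 : Fin 2) (GG (MvPolynomial.X 0) (MvPolynomial.X 1) : MvPolynomial (Fin 2) ℚ) =
    Gv (MvPolynomial.X 0) (MvPolynomial.X 1) := by
  refine (D_GG (MvPolynomial.pderiv (R := ℚ) (1 : Fin 2)) (MvPolynomial.X 0) (MvPolynomial.X 1)).trans ?_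
  rw [pd10, pd11]; simp only [mul_one, mul_zero, add_zero, zero_add]

lemma GG_id {A : Type} [CommRing A] (u v : A) :
    Huu u v * Hvv u v - Huv u v * Huv u v = 17424 * GG u v := by
  simp only [Huu, Hvv, Huv, GG]; ring

lemma FF_id {A : Type} [CommRing A] (u v : A) :
    Hu u v * Gv u v - Hv u v * Gu u v = 240 * FF u v := by
  simp only [Hu, Hv, Gu, Gv, FF]; ring

lemma FF_map {A B : Type} [CommRing A] [CommRing B] (φ : A →+* B) (u v : A) :
    φ (FF u v) = FF (φ u) (φ v) := by
  simp only [FF, map_add, map_sub, map_mul, map_pow, map_lit]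

end C16

end

set_option maxHeartbeats 4000000 in
lemma C16.h_eq : hC16 = C16.HH (X 0) (X 1) := by
  unfold hC16
  have hb : ∀ i : Fin 13, (Nat.choose 12 i : ℚ) * alphaC16 i =
      (((![-81, -324, -1782, -5940, -4455, 7128, 22572, 26136, 31185, 31020, 9834, -804, -1657] : Fin 13 → ℤ) i : ℤ) : ℚ) := by
    intro i
    fin_cases i <;> simp [alphaC16, Nat.choose] <;> norm_num
  simp only [hb, map_intCast]
  simp only [Fin.sum_univ_succ, Fin.sum_univ_zero, C16.HH]
  simp [Fin.succ]
  ring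

lemma C16.g_eq : gC16 = C16.GG (X 0) (X 1) := by
  unfold gC16
  rw [C16.h_eq, C16.d_Hu, C16.d_Hv, C16.d_Huu, C16.d_Huv, C16.d_Hvv, C16.GG_id, ← mul_assoc,
    ← map_ofNat (C : ℚ →+* MvPolynomial (Fin 2) ℚ) 17424, ← C_mul]
  norm_num

lemma C16.f_eq : fC16 = C16.FF (X 0) (X 1) := by
  unfold fC16
  rw [C16.g_eq, C16.h_eq, C16.d_Hu, C16.d_Hv, C16.d_Gu, C16.d_Gv, C16.FF_id, ← mul_assoc,
    ← map_ofNat (C : ℚ →+* MvPolynomial (Fin 2) ℚ) 240, ← C_mul]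
  norm_num

lemma C16.f_hom : fC16.IsHomogeneous 30 := by
  have h : hC16.IsHomogeneous 12 := by
    unfold hC16
    refine IsHomogeneous.sum _ _ _ fun i _ => ?_
    have h1 := ((isHomogeneous_C (Fin 2) ((Nat.choose 12 i : ℚ) * alphaC16 i)).mul
      (isHomogeneous_X_pow (R := ℚ) (0 : Fin 2) (i : ℕ))).mul
      (isHomogeneous_X_pow (R := ℚ) (1 : Fin 2) (12 - (i : ℕ)))
    rwa [show 0 + (i : ℕ) + (12 - (i : ℕ)) = 12 by omega] at h1
  have g : gC16.IsHomogeneous 20 := by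
    unfold gC16
    exact (isHomogeneous_C (Fin 2) _).mul ((h.pderiv.pderiv.mul h.pderiv.pderiv).sub
      (h.pderiv.pderiv.mul h.pderiv.pderiv))
  unfold fC16
  exact (isHomogeneous_C (Fin 2) _).mul ((h.pderiv.mul g.pderiv).sub (h.pderiv.mul g.pderiv))

/-- The form `f` is homogeneous of degree 30 with integer coefficients, and the
genus-14 hyperelliptic curve `C_16 : y² = f(u,v)` has no rational points. -/
theorem rational_points_C16 :
    fC16.IsHomogeneous 30 ∧
    (∀ m : Fin 2 →₀ ℕ, ∃ z : ℤ, coeff m fC16 = (z : ℚ)) ∧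
    ¬ ∃ u v y : ℤ, (u, v) ≠ (0, 0) ∧
        (y : ℚ) ^ 2 = eval ![(u : ℚ), (v : ℚ)] fC16 := by
  refine ⟨C16.f_hom, ?_⟩
  rw [C16.f_eq]
  refine ⟨?_, ?_⟩
  · intro m
    refine ⟨coeff m (C16.FF (X 0) (X 1) : MvPolynomial (Fin 2) ℤ), ?_⟩
    have := C16.FF_map (MvPolynomial.map (σ := Fin 2) (Int.castRingHom ℚ)) (X 0) (X 1)
    rw [map_X, map_X] at this
    rw [← this, coeff_map]
    rfl
  · rintro ⟨u, v, y, huv, h⟩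
    have e := C16.FF_map (MvPolynomial.eval ![(u : ℚ), (v : ℚ)]) (X 0) (X 1)
    rw [eval_X, eval_X] at e
    have e2 := C16.FF_map (Int.castRingHom ℚ) u v
    have h2 : (y : ℚ) ^ 2 = ((C16.FF u v : ℤ) : ℚ) := by
      rw [h, e]; exact e2.symm
    refine C16.no_points u v y ?_ (by exact_mod_cast h2)
    rintro ⟨rfl, rfl⟩
    exact huv rfl
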